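/- Fix an integer j ≥ 0 and assume (A)–(D). Then (S) admits a sequence S^{(j)} = {(u^{(j)}_{1,l},…,u^{(j)}_{N,l}) : l ∈ ℕ} of classical solutions with every component nodal (taking both positive and negative values in Ω), unbounded in the sense that sup_l Σ_{i=1}^N ∫_Ω (|∇u^{(j)}_{i,l}|² + (u^{(j)}_{i,l})²) dx = ∞, such that each u^{(j)}_{i,l} is 𝓡_{2π/2^j}-invariant but not 𝓡_{2π/2^{j+1}}-invariant (in particular non-radial). Moreover, for all j₁ ≠ j₂ one has S^{(j₁)} ∩ S^{(j₂)} = ∅. -/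

import Mathlib

noncomputable section

open Real MeasureTheory Finset

abbrev Euc (n : ℕ) := EuclideanSpace ℝ (Fin n)

/-- The rotation `R_θ` by angle `θ` in the `(x₁,x₂)`-plane (fixing remaining coordinates). -/
def rotPt {n : ℕ} (θ : ℝ) (x : Euc n) : Euc n :=
  WithLp.toLp 2 fun i => if (i : ℕ) = 0 then Real.cos θ * x i - Real.sin θ * x ⟨1 % n, Nat.mod_lt 1 i.pos⟩
    else if (i : ℕ) = 1 then Real.sin θ * x ⟨0, i.pos⟩ + Real.cos θ * x i
    else x i

/-- `u` is `𝓡_θ`-invariant on `Ω`, i.e. `u (R_{-θ} x) = u x` on `Ω`. -/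
def RotInv {n : ℕ} (θ : ℝ) (Ω : Set (Euc n)) (u : Euc n → ℝ) : Prop :=
  ∀ x ∈ Ω, u (rotPt (-θ) x) = u x

def IsRadialFn {n : ℕ} (Ω : Set (Euc n)) (u : Euc n → ℝ) : Prop :=
  ∀ x ∈ Ω, ∀ y ∈ Ω, ‖x‖ = ‖y‖ → u x = u y

/-- `Ω` is an open ball or an open annulus centered at the origin. -/
def RadialDomain {n : ℕ} (Ω : Set (Euc n)) : Prop :=
  (∃ R : ℝ, 0 < R ∧ Ω = Metric.ball (0 : Euc n) R) ∨
  (∃ r R : ℝ, 0 < r ∧ r < R ∧ Ω = {x : Euc n | r < ‖x‖ ∧ ‖x‖ < R})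

/-- The Laplacian of `u`. -/
def lap {n : ℕ} (u : Euc n → ℝ) (x : Euc n) : ℝ :=
  ∑ i : Fin n, fderiv ℝ (fun y => fderiv ℝ u y (EuclideanSpace.single i 1)) x
    (EuclideanSpace.single i 1)

/-- The squared `H¹` norm. -/
def H1norm2 {n : ℕ} (Ω : Set (Euc n)) (u : Euc n → ℝ) : ℝ :=
  ∫ x in Ω, (‖fderiv ℝ u x‖ ^ 2 + (u x) ^ 2)

/-- 1-based block cyclic shift `π`. -/
def blockCycle (p : ℕ) (j : ℕ) : ℕ := if j % p = 0 then j + 1 - p else j + 1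

/-- Assumptions (A)-(D). -/
def SysAssump (N p B : ℕ) (lam mu : ℕ → ℝ) (beta : ℕ → ℕ → ℝ) : Prop :=
  p.Prime ∧ N = p * B ∧ 0 < B ∧
  -- (A)
  (∀ b ∈ Finset.Icc 1 B, ∀ i ∈ Finset.Icc (p * b - p + 1) (p * b),
    lam i = lam (p * b) ∧ 0 < lam i) ∧
  -- (B)
  (∀ i ∈ Finset.Icc 1 N, ∀ j ∈ Finset.Icc 1 N, i ≠ j → beta i j = beta j i ∧ beta i j ≤ 0) ∧
  (∀ j ∈ Finset.Icc 1 N, 0 < mu j) ∧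
  -- (C)
  (∀ i ∈ Finset.Icc 1 N, ∀ j ∈ Finset.Icc 1 N, i ≠ j →
    beta (blockCycle p i) (blockCycle p j) = beta i j) ∧
  -- (D)
  (∀ b ∈ Finset.Icc 1 B, ∀ j ∈ Finset.Icc (p * b - p + 1) (p * b),
    mu j + ∑ i ∈ (Finset.Icc (p * b - p + 1) (p * b)).erase j, beta i j ≤ 0)

/-- Classical solution of the system (S). -/
def IsClassicalSolution {n : ℕ} (Ω : Set (Euc n)) (N : ℕ) (lam mu : ℕ → ℝ)
    (beta : ℕ → ℕ → ℝ) (u : ℕ → Euc n → ℝ) : Prop :=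
  ∀ j ∈ Finset.Icc 1 N,
    ContDiffOn ℝ 2 (u j) Ω ∧ ContinuousOn (u j) (closure Ω) ∧
    (∀ x ∈ frontier Ω, u j x = 0) ∧
    (∀ x ∈ Ω, -(lap (u j) x) + lam j * u j x =
      mu j * (u j x) ^ 3 + ∑ m ∈ (Finset.Icc 1 N).erase j, beta j m * u j x * (u m x) ^ 2)


noncomputable section
open Real MeasureTheory Finset
open scoped ContDiff

/-- Kernel pair used for the regularity theory: `lap e = ρ - 2^n ρ(2·)`. -/
structure Ker (n : ℕ) where
  e : Euc n → ℝ
  ρ : Euc n → ℝ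
  q : ℝ → ℝ
  h : ℝ → ℝ
  a : ℝ
  e_smooth : ContDiff ℝ ∞ e
  ρ_smooth : ContDiff ℝ ∞ ρ
  e_supp : ∀ x, 2 ≤ ‖x‖ → e x = 0
  ρ_supp : ∀ x, 2 ≤ ‖x‖ → ρ x = 0
  e_nonneg : ∀ x, 0 ≤ e x
  ρ_nonneg : ∀ x, 0 ≤ ρ x
  ρ_int : ∫ x, ρ x = 1
  ρ_rad : ∀ x, ρ x = q ‖x‖
  e_rad : ∀ x, e x = h ‖x‖
  q_cont : Continuous q
  a_pos : 0 < a
  q_pos : 0 < q a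
  lap_e : ∀ x, lap e x = ρ x - 2 ^ n * ρ ((2 : ℝ) • x)

def stepP (s : ℝ) : ℝ := Real.smoothTransition (s - 1)

lemma stepP_smooth : ContDiff ℝ ∞ stepP := by
  unfold stepP
  exact Real.smoothTransition.contDiff.comp (contDiff_id.sub contDiff_const)

lemma stepP_zero {s : ℝ} (h : s ≤ 1) : stepP s = 0 :=
  Real.smoothTransition.zero_of_nonpos (by linarith)

lemma stepP_one {s : ℝ} (h : 2 ≤ s) : stepP s = 1 :=
  Real.smoothTransition.one_of_one_le (by linarith)

lemma stepP_mono : Monotone stepP := by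
  intro a b hab
  exact Real.smoothTransition.monotone (by linarith)

def hd (n : ℕ) (s : ℝ) : ℝ := s ^ (-(n : ℝ) / 2) * (stepP s - stepP (4 * s)) / 4

lemma hd_zero_small (n : ℕ) {s : ℝ} (h : s ≤ 1 / 4) : hd n s = 0 := by
  unfold hd; rw [stepP_zero (by linarith), stepP_zero (by linarith)]; simp

lemma hd_zero_large (n : ℕ) {s : ℝ} (h : 2 ≤ s) : hd n s = 0 := by
  unfold hd; rw [stepP_one (by linarith), stepP_one (by linarith)]; simp

lemma hd_nonpos (n : ℕ) (s : ℝ) : hd n s ≤ 0 := by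
  rcases le_total s 0 with h | h
  · rw [hd_zero_small n (by linarith)]
  · have h1 : stepP s ≤ stepP (4 * s) := stepP_mono (by linarith)
    have h2 := Real.rpow_nonneg h (-(n : ℝ) / 2)
    unfold hd
    have := mul_nonneg h2 (sub_nonneg.2 h1)
    nlinarith

lemma hd_smooth (n : ℕ) : ContDiff ℝ ∞ (hd n) := by
  rw [contDiff_iff_contDiffAt]
  intro s
  rcases lt_or_ge s (1 / 4) with h | h
  · have : hd n =ᶠ[nhds s] fun _ => 0 := by
      filter_upwards [gt_mem_nhds h] with t ht
      exact hd_zero_small n ht.le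
    exact contDiffAt_const.congr_of_eventuallyEq this
  · have h0 : s ≠ 0 := by linarith
    unfold hd
    refine ContDiffAt.div_const (ContDiffAt.mul (contDiffAt_id.rpow_const_of_ne h0) ?_) _
    exact (stepP_smooth.sub (stepP_smooth.comp (contDiff_const.mul contDiff_id))).contDiffAt

def hh (n : ℕ) (s : ℝ) : ℝ := ∫ t in (2 : ℝ)..s, hd n t

lemma hh_deriv (n : ℕ) (s : ℝ) : HasDerivAt (hh n) (hd n s) s :=
  intervalIntegral.integral_hasDerivAt_right
    ((hd_smooth n).continuous.intervalIntegrable _ _)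
    ((hd_smooth n).continuous.stronglyMeasurableAtFilter _ _) (hd_smooth n).continuous.continuousAt

lemma hh_smooth (n : ℕ) : ContDiff ℝ ∞ (hh n) := by
  rw [contDiff_infty_iff_deriv]
  refine ⟨fun s => (hh_deriv n s).differentiableAt, ?_⟩
  have : deriv (hh n) = hd n := funext fun s => (hh_deriv n s).deriv
  rw [this]; exact hd_smooth n

lemma hh_zero (n : ℕ) {s : ℝ} (h : 2 ≤ s) : hh n s = 0 := by
  unfold hh
  rw [intervalIntegral.integral_congr (g := fun _ => 0)]
  · simp
  · intro t ht
    rw [Set.uIcc_of_le h] at ht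
    exact hd_zero_large n ht.1

lemma hh_nonneg (n : ℕ) (s : ℝ) : 0 ≤ hh n s := by
  rcases le_total 2 s with h | h
  · rw [hh_zero n h]
  · unfold hh
    rw [intervalIntegral.integral_symm, ← intervalIntegral.integral_neg]
    exact intervalIntegral.integral_nonneg h fun t _ => by linarith [hd_nonpos n t]

def qq (n : ℕ) (s : ℝ) : ℝ := s ^ (1 - (n : ℝ) / 2) * deriv stepP s

lemma dP_smooth : ContDiff ℝ ∞ (deriv stepP) :=
  (contDiff_infty_iff_deriv.1 stepP_smooth).2

lemma dP_zero {s : ℝ} (h : s < 1) : deriv stepP s = 0 := by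
  have : stepP =ᶠ[nhds s] fun _ => 0 := by
    filter_upwards [gt_mem_nhds h] with t ht
    exact stepP_zero ht.le
  rw [this.deriv_eq]; simp

lemma dP_zero' {s : ℝ} (h : 2 < s) : deriv stepP s = 0 := by
  have : stepP =ᶠ[nhds s] fun _ => 1 := by
    filter_upwards [lt_mem_nhds h] with t ht
    exact stepP_one ht.le
  rw [this.deriv_eq]; simp

lemma qq_smooth (n : ℕ) : ContDiff ℝ ∞ (qq n) := by
  rw [contDiff_iff_contDiffAt]
  intro s
  rcases lt_or_ge s 1 with h | h
  · have : qq n =ᶠ[nhds s] fun _ => 0 := by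
      filter_upwards [gt_mem_nhds h] with t ht
      simp [qq, dP_zero ht]
    exact contDiffAt_const.congr_of_eventuallyEq this
  · have h0 : s ≠ 0 := by linarith
    unfold qq
    exact (contDiffAt_id.rpow_const_of_ne h0).mul dP_smooth.contDiffAt

lemma qq_nonneg (n : ℕ) (s : ℝ) : 0 ≤ qq n s := by
  unfold qq
  rcases lt_or_ge s 1 with h | h
  · simp [dP_zero h]
  · exact mul_nonneg (Real.rpow_nonneg (by linarith) _) stepP_mono.deriv_nonneg

lemma hd_ode (n : ℕ) (s : ℝ) :
    4 * s * deriv (hd n) s + 2 * n * hd n s = qq n s - 2 ^ n * qq n (4 * s) := by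
  rcases lt_or_ge s (1 / 4) with h | h
  · have : hd n =ᶠ[nhds s] fun _ => 0 := by
      filter_upwards [gt_mem_nhds h] with t ht
      exact hd_zero_small n ht.le
    rw [this.deriv_eq, hd_zero_small n h.le]
    simp [qq, dP_zero (show s < 1 by linarith), dP_zero (show 4 * s < 1 by linarith)]
  · have h0 : 0 < s := by linarith
    have hP : ∀ t, HasDerivAt stepP (deriv stepP t) t := fun t =>
      ((contDiff_infty_iff_deriv.1 stepP_smooth).1 t).hasDerivAt
    have h1 : HasDerivAt (fun t => stepP (4 * t)) (deriv stepP (4 * s) * (4 * 1)) s :=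
      (hP (4 * s)).comp s ((hasDerivAt_id s).const_mul 4)
    have h2 : HasDerivAt (hd n) _ s :=
      (((Real.hasDerivAt_rpow_const (p := -(n : ℝ) / 2) (Or.inl h0.ne')).mul
        ((hP s).sub h1))).div_const 4
    rw [h2.deriv]
    unfold hd qq
    have e1 : s ^ (-(n : ℝ) / 2 - 1) = s ^ (-(n : ℝ) / 2) / s := by
      rw [Real.rpow_sub h0, Real.rpow_one]
    have e2 : s ^ (1 - (n : ℝ) / 2) = s * s ^ (-(n : ℝ) / 2) := by
      rw [show 1 - (n : ℝ) / 2 = 1 + (-(n : ℝ) / 2) by ring, Real.rpow_add h0, Real.rpow_one]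
    have e3 : (4 * s) ^ (1 - (n : ℝ) / 2) = 4 * ((2 : ℝ) ^ n)⁻¹ * (s * s ^ (-(n : ℝ) / 2)) := by
      rw [Real.mul_rpow (by norm_num) h0.le, e2]
      congr 1
      rw [show (4 : ℝ) = 2 ^ (2 : ℝ) by norm_num, ← Real.rpow_mul (by norm_num),
        show (2 : ℝ) * (1 - n / 2) = 2 - n by ring, Real.rpow_sub (by norm_num)]
      norm_num [div_eq_mul_inv]
    rw [e1, e2, e3]
    have : (2 : ℝ) ^ n ≠ 0 := by positivity
    simp only [Pi.sub_apply]
    field_simp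
    ring

lemma lap_radial {n : ℕ} (n0 : ℕ) (x : Euc n) :
    lap (fun y : Euc n => hh n0 (‖y‖ ^ 2)) x
      = 4 * ‖x‖ ^ 2 * deriv (hd n0) (‖x‖ ^ 2) + 2 * n * hd n0 (‖x‖ ^ 2) := by
  have h1 : ∀ y : Euc n, ∀ i, fderiv ℝ (fun y : Euc n => hh n0 (‖y‖ ^ 2)) y
      (EuclideanSpace.single i 1) = hd n0 (‖y‖ ^ 2) * (2 * y i) := by
    intro y i
    have a1 : HasFDerivAt (fun y : Euc n => ‖y‖ ^ 2) (2 • innerSL ℝ y) y :=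
      (hasStrictFDerivAt_norm_sq y).hasFDerivAt
    have a2 := (hh_deriv n0 (‖y‖ ^ 2)).comp_hasFDerivAt y a1
    rw [show (fun y : Euc n => hh n0 (‖y‖ ^ 2)) = hh n0 ∘ fun y : Euc n => ‖y‖ ^ 2 from rfl,
      a2.fderiv]
    simp [EuclideanSpace.inner_single_right]
  have h2 : ∀ i, fderiv ℝ (fun y : Euc n => fderiv ℝ (fun y : Euc n => hh n0 (‖y‖ ^ 2)) y
      (EuclideanSpace.single i 1)) x (EuclideanSpace.single i 1)
      = deriv (hd n0) (‖x‖ ^ 2) * (2 * x i) * (2 * x i) + hd n0 (‖x‖ ^ 2) * 2 := by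
    intro i
    simp_rw [h1]
    have a1 : HasFDerivAt (fun y : Euc n => ‖y‖ ^ 2) (2 • innerSL ℝ x) x :=
      (hasStrictFDerivAt_norm_sq x).hasFDerivAt
    have a0 : HasDerivAt (hd n0) (deriv (hd n0) (‖x‖ ^ 2)) (‖x‖ ^ 2) :=
      ((contDiff_infty_iff_deriv.1 (hd_smooth n0)).1 _).hasDerivAt
    have a2 := a0.comp_hasFDerivAt x a1
    have a3 : HasFDerivAt (fun y : Euc n => 2 * y i) ((2 : ℝ) • (EuclideanSpace.proj i : Euc n →L[ℝ] ℝ)) x :=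
      (EuclideanSpace.proj i : Euc n →L[ℝ] ℝ).hasFDerivAt.const_mul 2
    have a4 := a2.mul a3
    rw [show (fun y : Euc n => hd n0 (‖y‖ ^ 2) * (2 * y i))
      = (hd n0 ∘ fun y : Euc n => ‖y‖ ^ 2) * (fun y : Euc n => 2 * y i) from rfl, a4.fderiv]
    simp [EuclideanSpace.inner_single_right]
    ring
  unfold lap
  simp_rw [h2]
  rw [Finset.sum_add_distrib]
  have : ∑ i, deriv (hd n0) (‖x‖ ^ 2) * (2 * x i) * (2 * x i)
      = 4 * ‖x‖ ^ 2 * deriv (hd n0) (‖x‖ ^ 2) := by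
    rw [EuclideanSpace.real_norm_sq_eq, Finset.mul_sum, Finset.sum_mul]
    exact Finset.sum_congr rfl fun i _ => by ring
  rw [this]; simp; ring

lemma lap_const_mul {n : ℕ} {u : Euc n → ℝ} (c : ℝ) (x : Euc n) :
    lap (fun y => c * u y) x = c * lap u x := by
  unfold lap
  have h1 : ∀ (f : Euc n → ℝ) (y v : Euc n), fderiv ℝ (fun y => c * f y) y v = c * fderiv ℝ f y v := by
    intro f y v
    change fderiv ℝ (c • f) y v = _
    rw [fderiv_const_smul_field]; simp
  simp_rw [h1]
  rw [Finset.mul_sum]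

theorem Ker.nonempty {n : ℕ} (hn : 2 ≤ n) : Nonempty (Ker n) := by
  have hsm : ContDiff ℝ ∞ (fun x : Euc n => ‖x‖ ^ 2) := contDiff_norm_sq ℝ
  have hsupp : ∀ x : Euc n, 2 ≤ ‖x‖ → qq n (‖x‖ ^ 2) = 0 := fun x hx => by
    simp [qq, dP_zero' (show 2 < ‖x‖ ^ 2 by nlinarith)]
  have hcs : HasCompactSupport (fun x : Euc n => qq n (‖x‖ ^ 2)) := by
    refine HasCompactSupport.intro (isCompact_closedBall (0 : Euc n) 2) fun x hx => ?_
    simp at hx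
    exact hsupp x hx.le
  have hcont : Continuous (fun x : Euc n => qq n (‖x‖ ^ 2)) :=
    ((qq_smooth n).comp hsm).continuous
  -- a positive point
  obtain ⟨s, hs1, hs⟩ : ∃ s, 1 ≤ s ∧ 0 < qq n s := by
    by_contra hcon
    push Not at hcon
    have hz : ∀ s ∈ Set.Ioo (1:ℝ) 2, deriv stepP s = 0 := by
      intro s hs
      have h1 := hcon s hs.1.le
      have h2 : 0 ≤ deriv stepP s := stepP_mono.deriv_nonneg
      have h3 : 0 < s ^ (1 - (n : ℝ) / 2) := Real.rpow_pos_of_pos (by linarith [hs.1]) _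
      unfold qq at h1
      nlinarith
    obtain ⟨c, hc, hc2⟩ := exists_deriv_eq_slope stepP (show (1:ℝ) < 2 by norm_num)
      stepP_smooth.continuous.continuousOn
      (fun t _ => ((contDiff_infty_iff_deriv.1 stepP_smooth).1 t).differentiableWithinAt)
    rw [hz c hc, stepP_one le_rfl, stepP_zero le_rfl] at hc2
    norm_num at hc2
  have hn0 : 0 < n := by omega
  set x0 : Euc n := EuclideanSpace.single ⟨0, hn0⟩ (√s)
  have hx0 : ‖x0‖ ^ 2 = s := by
    simp [x0, Real.sq_sqrt (show 0 ≤ s by linarith)]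
  have hIntg : 0 < ∫ x : Euc n, qq n (‖x‖ ^ 2) := by
    refine hcont.integral_pos_of_hasCompactSupport_nonneg_nonzero hcs
      (fun x => qq_nonneg n _) (x := x0) ?_
    rw [hx0]; exact hs.ne'
  set c := ∫ x : Euc n, qq n (‖x‖ ^ 2) with hc
  refine ⟨{
    e := fun x => c⁻¹ * hh n (‖x‖ ^ 2)
    ρ := fun x => c⁻¹ * qq n (‖x‖ ^ 2)
    q := fun r => c⁻¹ * qq n (r ^ 2)
    h := fun r => c⁻¹ * hh n (r ^ 2)
    a := √s
    e_smooth := contDiff_const.mul ((hh_smooth n).comp hsm)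
    ρ_smooth := contDiff_const.mul ((qq_smooth n).comp hsm)
    e_supp := fun x hx => by rw [hh_zero n (by nlinarith)]; simp
    ρ_supp := fun x hx => by rw [hsupp x hx]; simp
    e_nonneg := fun x => mul_nonneg (inv_nonneg.2 hIntg.le) (hh_nonneg _ _)
    ρ_nonneg := fun x => mul_nonneg (inv_nonneg.2 hIntg.le) (qq_nonneg _ _)
    ρ_int := by rw [integral_const_mul, ← hc, inv_mul_cancel₀ hIntg.ne']
    ρ_rad := fun x => rfl
    e_rad := fun x => rfl
    q_cont := continuous_const.mul ((qq_smooth n).continuous.comp (continuous_pow 2))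
    a_pos := Real.sqrt_pos.2 (by linarith)
    q_pos := by
      rw [Real.sq_sqrt (by linarith)]
      exact mul_pos (inv_pos.2 hIntg) hs
    lap_e := fun x => ?_ }⟩
  rw [lap_const_mul, lap_radial, hd_ode n, norm_smul, mul_pow]
  norm_num
  ring
end

noncomputable section
open Real MeasureTheory Finset
open scoped ContDiff Topology

/-- Test functions on `Ω`. -/
structure Test {n : ℕ} (Ω : Set (Euc n)) (φ : Euc n → ℝ) : Prop where
  smooth : ContDiff ℝ ∞ φ
  compact : HasCompactSupport φ
  supp : tsupport φ ⊆ Ω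

/-- convolution-type integral -/
def cv {n : ℕ} (k u : Euc n → ℝ) (x : Euc n) : ℝ := ∫ y, k (x - y) * u y

lemma lap_comp_affine {n : ℕ} (u : Euc n → ℝ) (t : ℝ) (b x : Euc n) :
    lap (fun y => u (t • y + b)) x = t ^ 2 * lap u (t • x + b) := by
  have h1 : ∀ (f : Euc n → ℝ) (y v : Euc n),
      fderiv ℝ (fun y => f (t • y + b)) y v = t * fderiv ℝ f (t • y + b) v := by
    intro f y v
    have := fderiv_comp_smul (𝕜 := ℝ) (f := fun z => f (z + b)) (x := y) t
    rw [this, fderiv_comp_add_right]; simp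
  unfold lap
  simp_rw [h1]
  rw [Finset.mul_sum]
  refine Finset.sum_congr rfl fun i _ => ?_
  have h2 := h1 (fun z => fderiv ℝ u z (EuclideanSpace.single i 1)) x (EuclideanSpace.single i 1)
  have h3 : ∀ (f : Euc n → ℝ) (y v : Euc n), fderiv ℝ (fun y => t * f y) y v = t * fderiv ℝ f y v := by
    intro f y v
    change fderiv ℝ (t • f) y v = _
    rw [fderiv_const_smul_field]; simp
  rw [h3 (fun y => fderiv ℝ u (t • y + b) (EuclideanSpace.single i 1)), h2]
  ring

lemma lap_comp_sub {n : ℕ} (u : Euc n → ℝ) (x y : Euc n) :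
    lap (fun y => u (x - y)) y = lap u (x - y) := by
  have := lap_comp_affine u (-1) x y
  simp only [neg_smul, one_smul, neg_add_eq_sub] at this
  rw [this]; norm_num

namespace Ker
variable {n : ℕ} (K : Ker n)

def ei (i : ℕ) (x : Euc n) : ℝ := 2 ^ (i * (n - 2)) * K.e ((2 : ℝ) ^ i • x)
def ri (i : ℕ) (x : Euc n) : ℝ := 2 ^ (i * n) * K.ρ ((2 : ℝ) ^ i • x)

lemma ei_smooth (i : ℕ) : ContDiff ℝ ∞ (K.ei i) :=
  contDiff_const.mul (K.e_smooth.comp (contDiff_const_smul _))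
lemma ri_smooth (i : ℕ) : ContDiff ℝ ∞ (K.ri i) :=
  contDiff_const.mul (K.ρ_smooth.comp (contDiff_const_smul _))

lemma ei_nonneg (i : ℕ) (x : Euc n) : 0 ≤ K.ei i x := mul_nonneg (by positivity) (K.e_nonneg _)
lemma ri_nonneg (i : ℕ) (x : Euc n) : 0 ≤ K.ri i x := mul_nonneg (by positivity) (K.ρ_nonneg _)

lemma scale_le {i : ℕ} {x : Euc n} (h : 2 * (1 / 2) ^ i ≤ ‖x‖) : 2 ≤ ‖(2 : ℝ) ^ i • x‖ := by
  rw [norm_smul, norm_pow, Real.norm_ofNat]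
  have h2 : (0:ℝ) < 2 ^ i := by positivity
  calc (2:ℝ) = 2 ^ i * (2 * (1 / 2) ^ i) := by rw [one_div, inv_pow]; field_simp
    _ ≤ _ := by gcongr

lemma ei_supp {i : ℕ} {x : Euc n} (h : 2 * (1 / 2) ^ i ≤ ‖x‖) : K.ei i x = 0 := by
  unfold ei; rw [K.e_supp _ (scale_le h), mul_zero]
lemma ri_supp {i : ℕ} {x : Euc n} (h : 2 * (1 / 2) ^ i ≤ ‖x‖) : K.ri i x = 0 := by
  unfold ri; rw [K.ρ_supp _ (scale_le h), mul_zero]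

lemma ei_compact (i : ℕ) : HasCompactSupport (K.ei i) := by
  refine HasCompactSupport.intro (isCompact_closedBall (0 : Euc n) (2 * (1 / 2) ^ i)) fun x hx => ?_
  simp only [Metric.mem_closedBall, dist_zero_right, not_le] at hx
  exact K.ei_supp hx.le
lemma ri_compact (i : ℕ) : HasCompactSupport (K.ri i) := by
  refine HasCompactSupport.intro (isCompact_closedBall (0 : Euc n) (2 * (1 / 2) ^ i)) fun x hx => ?_
  simp only [Metric.mem_closedBall, dist_zero_right, not_le] at hx
  exact K.ri_supp hx.le

lemma ri_even (i : ℕ) (x : Euc n) : K.ri i (-x) = K.ri i x := by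
  unfold ri; rw [K.ρ_rad, K.ρ_rad]; simp

lemma lap_ei (hn : 2 ≤ n) (i : ℕ) (x : Euc n) : lap (K.ei i) x = K.ri i x - K.ri (i + 1) x := by
  unfold ei
  rw [lap_const_mul]
  have := lap_comp_affine K.e ((2:ℝ) ^ i) 0 x
  simp only [add_zero] at this
  rw [this, K.lap_e]
  unfold ri
  obtain ⟨m, rfl⟩ : ∃ m, n = m + 2 := ⟨n - 2, by omega⟩
  simp only [Nat.add_sub_cancel, smul_smul]
  rw [show (2:ℝ) * 2 ^ i = 2 ^ (i + 1) by ring]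
  ring

lemma ri_int (i : ℕ) : ∫ x, K.ri i x = 1 := by
  unfold ri
  rw [integral_const_mul, Measure.integral_comp_smul_of_nonneg _ _ _ (hR := by positivity), K.ρ_int]
  simp
  rw [← pow_mul]
  exact mul_inv_cancel₀ (by positivity)

lemma test_ei (i : ℕ) {Ω : Set (Euc n)} {x : Euc n}
    (h : Metric.closedBall x (2 * (1 / 2) ^ i) ⊆ Ω) : Test Ω (fun y => K.ei i (x - y)) := by
  have hs : tsupport (fun y => K.ei i (x - y)) ⊆ Metric.closedBall x (2 * (1 / 2) ^ i) := by
    refine closure_minimal ?_ Metric.isClosed_closedBall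
    intro y hy
    by_contra hcon
    simp only [Metric.mem_closedBall, not_le, dist_eq_norm] at hcon
    rw [← norm_neg, neg_sub] at hcon
    exact hy (K.ei_supp hcon.le)
  refine ⟨(K.ei_smooth i).comp (contDiff_const.sub contDiff_id), ?_, hs.trans h⟩
  exact HasCompactSupport.of_support_subset_isCompact (isCompact_closedBall x _)
    (subset_closure.trans hs)

end Ker

lemma integrable_cv {n : ℕ} {k u : Euc n → ℝ} (hk : Continuous k) (hk2 : HasCompactSupport k)
    (hu : LocallyIntegrable u) (x : Euc n) : Integrable (fun y => k (x - y) * u y) := by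
  have h1 : HasCompactSupport (fun y => k (x - y)) :=
    hk2.comp_homeomorph (Homeomorph.subLeft x)
  exact hu.integrable_smul_left_of_hasCompactSupport (hk.comp (continuous_const.sub continuous_id)) h1

/-- the weak equation `-Δu = F` in `Ω`. -/
def WeakEq {n : ℕ} (Ω : Set (Euc n)) (u F : Euc n → ℝ) : Prop :=
  ∀ φ, Test Ω φ → -∫ y, u y * lap φ y = ∫ y, F y * φ y

namespace Ker
variable {n : ℕ} (K : Ker n)

lemma int_lap_ei (hn : 2 ≤ n) (i : ℕ) {u : Euc n → ℝ} (hu : LocallyIntegrable u) (x : Euc n) :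
    -∫ y, u y * lap (fun y => K.ei i (x - y)) y = cv (K.ri (i + 1)) u x - cv (K.ri i) u x := by
  unfold cv
  rw [← integral_sub (integrable_cv (K.ri_smooth _).continuous (K.ri_compact _) hu x)
    (integrable_cv (K.ri_smooth _).continuous (K.ri_compact _) hu x), ← integral_neg]
  congr 1; ext y
  rw [lap_comp_sub, K.lap_ei hn]; ring

lemma step (hn : 2 ≤ n) {Ω : Set (Euc n)} {u F : Euc n → ℝ} (hu : LocallyIntegrable u)
    (h : WeakEq Ω u F) {i : ℕ} {x : Euc n} (hx : Metric.closedBall x (2 * (1 / 2) ^ i) ⊆ Ω) :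
    cv (K.ri (i + 1)) u x = cv (K.ri i) u x + cv (K.ei i) F x := by
  have h1 := h _ (K.test_ei i hx)
  rw [K.int_lap_ei hn i hu] at h1
  have : cv (K.ei i) F x = ∫ y, F y * K.ei i (x - y) := by
    unfold cv; congr 1; ext y; ring
  rw [this, ← h1]; ring

lemma steps (hn : 2 ≤ n) {Ω : Set (Euc n)} {u F : Euc n → ℝ} (hu : LocallyIntegrable u)
    (h : WeakEq Ω u F) {i : ℕ} {x : Euc n} (hx : Metric.closedBall x (2 * (1 / 2) ^ i) ⊆ Ω) (m : ℕ) :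
    cv (K.ri (i + m)) u x = cv (K.ri i) u x + ∑ j ∈ range m, cv (K.ei (i + j)) F x := by
  induction m with
  | zero => simp
  | succ m ih =>
    rw [Finset.sum_range_succ, ← add_assoc, ← add_assoc, ← ih]
    refine K.step hn hu h ((Metric.closedBall_subset_closedBall ?_).trans hx)
    have : ((1:ℝ) / 2) ^ (i + m) ≤ (1 / 2) ^ i :=
      pow_le_pow_of_le_one (by norm_num) (by norm_num) (by omega)
    linarith

/-- a.e. convergence of mollifications -/
lemma ae_tendsto {v : Euc n → ℝ} (hv : LocallyIntegrable v) (hn : 2 ≤ n) :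
    ∀ᵐ x, Filter.Tendsto (fun m => cv (K.ri m) v x) Filter.atTop (𝓝 (v x)) := by
  haveI : Nonempty (Fin n) := ⟨⟨0, by omega⟩⟩
  obtain ⟨C, hC⟩ := (show HasCompactSupport K.ρ from
      HasCompactSupport.intro (isCompact_closedBall (0 : Euc n) 2) fun x hx => by
        simp at hx; exact K.ρ_supp x hx.le).exists_bound_of_continuous K.ρ_smooth.continuous
  filter_upwards [(Besicovitch.vitaliFamily (volume : Measure (Euc n))).ae_tendsto_average_norm_sub hv]
    with x hx
  have hr : Filter.Tendsto (fun m : ℕ => 2 * ((1:ℝ) / 2) ^ m) Filter.atTop (𝓝[>] 0) := by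
    refine tendsto_nhdsWithin_iff.2 ⟨?_, Filter.Eventually.of_forall fun m => ?_⟩
    · have := (tendsto_pow_atTop_nhds_zero_of_lt_one (r := (1:ℝ)/2) (by norm_num) (by norm_num)).const_mul 2
      simpa using this
    · simp
  have h0 := (hx.comp (Besicovitch.tendsto_filterAt volume x)).comp hr
  have hb : ∀ m : ℕ, (volume : Measure (Euc n)).real (Metric.closedBall x (2 * ((1:ℝ) / 2) ^ m))
      = ((2 * ((1:ℝ) / 2) ^ m) ^ n) * volume.real (Metric.closedBall (0 : Euc n) 1) := by
    intro m
    rw [Measure.addHaar_real_closedBall _ _ (by positivity), ← Measure.addHaar_real_closedBall_eq_addHaar_real_ball]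
    simp
  have hpos : 0 < volume.real (Metric.closedBall (0 : Euc n) 1) := by
    exact ENNReal.toReal_pos (Metric.measure_closedBall_pos _ _ (by norm_num)).ne'
      measure_closedBall_lt_top.ne
  have := tendsto_integral_smul_of_tendsto_average_norm_sub (μ := (volume : Measure (Euc n)))
    (g := fun m y => K.ri m (x - y)) (C * 2 ^ n * volume.real (Metric.closedBall (0 : Euc n) 1)) h0
    (Filter.Eventually.of_forall fun m => hv.integrableOn_isCompact (isCompact_closedBall _ _))
    ?_ ?_ ?_
  · exact this
  · refine tendsto_const_nhds.congr fun m => ?_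
    rw [integral_sub_left_eq_self (fun y => K.ri m y), K.ri_int]
  · refine Filter.Eventually.of_forall fun m y hy => ?_
    by_contra hcon
    simp only [Function.comp, Metric.mem_closedBall, not_le, dist_eq_norm] at hcon
    rw [← norm_neg, neg_sub] at hcon
    exact hy (K.ri_supp hcon.le)
  · refine Filter.Eventually.of_forall fun m y => ?_
    simp only [Function.comp]
    rw [hb, abs_of_nonneg (K.ri_nonneg _ _)]
    have h1 : K.ri m (x - y) ≤ 2 ^ (m * n) * C := by
      unfold ri
      gcongr
      exact (le_abs_self _).trans (hC _)
    refine h1.trans (le_of_eq ?_)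
    rw [mul_pow, one_div, inv_pow, inv_pow, ← pow_mul]
    field_simp
end Ker
end

noncomputable section
open Real MeasureTheory Finset
open scoped ContDiff Topology

lemma cs_int {α : Type*} [MeasurableSpace α] {μ : Measure α} {f g : α → ℝ}
    (hf : MemLp f 2 μ) (hg : MemLp g 2 μ) :
    |∫ x, f x * g x ∂μ| ≤ √(∫ x, f x ^ 2 ∂μ) * √(∫ x, g x ^ 2 ∂μ) := by
  have h := integral_mul_norm_le_Lp_mul_Lq (μ := μ) (f := f) (g := g) (p := 2) (q := 2)
    (by constructor <;> norm_num) (by simpa using hf) (by simpa using hg)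
  have h2 : |∫ x, f x * g x ∂μ| ≤ ∫ x, ‖f x‖ * ‖g x‖ ∂μ := by
    refine (norm_integral_le_integral_norm (fun x => f x * g x)).trans (le_of_eq ?_)
    simp
  refine h2.trans (h.trans (le_of_eq ?_))
  rw [Real.sqrt_eq_rpow, Real.sqrt_eq_rpow]
  norm_num

lemma Ker.memLp_ei {n : ℕ} (K : Ker n) (i : ℕ) : MemLp (K.ei i) 2 :=
  (K.ei_smooth i).continuous.memLp_of_hasCompactSupport (K.ei_compact i)
lemma Ker.memLp_ri {n : ℕ} (K : Ker n) (i : ℕ) : MemLp (K.ri i) 2 :=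
  (K.ri_smooth i).continuous.memLp_of_hasCompactSupport (K.ri_compact i)

lemma cv_le_L2 {n : ℕ} {k F : Euc n → ℝ} (hk : MemLp k 2) (hF : MemLp F 2) (x : Euc n) :
    |cv k F x| ≤ √(∫ y, k y ^ 2) * √(∫ y, F y ^ 2) := by
  have h1 : MemLp (fun y => k (x - y)) 2 := 
    hk.comp_measurePreserving (Measure.measurePreserving_sub_left volume x)
  have := cs_int h1 hF
  rwa [integral_sub_left_eq_self (fun y => k y ^ 2)] at this

lemma Ker.ei_L2 {n : ℕ} (hn : n = 2 ∨ n = 3) (K : Ker n) (i : ℕ) :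
    √(∫ y, K.ei i y ^ 2) ≤ √(∫ y, K.e y ^ 2) * (√(1/2)) ^ i := by
  have h : ∫ y, K.ei i y ^ 2 ≤ (∫ y, K.e y ^ 2) * (1/2) ^ i := by
    unfold Ker.ei
    simp_rw [mul_pow]
    have h0 : 0 ≤ ∫ y, K.e y ^ 2 := integral_nonneg fun y => sq_nonneg _
    rw [integral_const_mul, Measure.integral_comp_smul_of_nonneg (hR := by positivity) _ (fun y => K.e y ^ 2)]
    simp only [finrank_euclideanSpace, Fintype.card_fin, smul_eq_mul]
    have key : ((2:ℝ) ^ (i * (n - 2))) ^ 2 * ((2 ^ i) ^ n)⁻¹ ≤ (1/2) ^ i := by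
      have h2 : (0:ℝ) < 2 ^ i := by positivity
      rcases hn with rfl | rfl
      · simp
        rw [← inv_pow, ← inv_pow]
        have h3 : (2:ℝ)⁻¹ ^ i ≤ 1 := pow_le_one₀ (by norm_num) (by norm_num)
        have h4 : 0 ≤ (2:ℝ)⁻¹ ^ i := by positivity
        nlinarith
      · simp
        field_simp
        exact le_rfl
    calc _ = (∫ y, K.e y ^ 2) * (((2:ℝ) ^ (i * (n - 2))) ^ 2 * ((2 ^ i) ^ n)⁻¹) := by ring
      _ ≤ _ := by gcongr
  refine (Real.sqrt_le_sqrt h).trans (le_of_eq ?_)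
  rw [Real.sqrt_mul (integral_nonneg fun y => sq_nonneg _)]
  congr 1
  rw [← Real.sqrt_sq (by positivity : 0 ≤ √(1/2 : ℝ) ^ i), ← pow_mul, mul_comm, pow_mul,
    Real.sq_sqrt (by norm_num)]

/-- weak differential inequality on the whole space -/
def SubEq {n : ℕ} (v G : Euc n → ℝ) : Prop :=
  ∀ φ, Test Set.univ φ → (∀ x, 0 ≤ φ x) → -∫ y, v y * lap φ y ≤ ∫ y, G y * φ y

/-- exterior ball property -/
def ExtBall {n : ℕ} (Ω : Set (Euc n)) : Prop :=
  ∃ t0 > 0, ∀ z ∉ Ω, ∀ t, 0 < t → t ≤ t0 → ∃ p, ‖p - z‖ = t ∧ Metric.ball p t ⊆ Ωᶜ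

lemma exists_unit {n : ℕ} (hn : 2 ≤ n) (z : Euc n) : ∃ ν : Euc n, ‖ν‖ = 1 ∧ z = ‖z‖ • ν := by
  by_cases hz : z = 0
  · exact ⟨EuclideanSpace.single ⟨0, by omega⟩ 1, by simp, by simp [hz]⟩
  · have : ‖z‖ ≠ 0 := by simpa using hz
    exact ⟨‖z‖⁻¹ • z, by simp [norm_smul, this], by rw [smul_smul, mul_inv_cancel₀ this, one_smul]⟩

lemma RadialDomain.extBall {n : ℕ} (hn : 2 ≤ n) {Ω : Set (Euc n)} (h : RadialDomain Ω) : ExtBall Ω := by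
  have out : ∀ (R t : ℝ) (z : Euc n), 0 < t → R ≤ ‖z‖ → ∃ p, ‖p - z‖ = t ∧ ∀ y ∈ Metric.ball p t, R ≤ ‖y‖ := by
    intro R t z ht hz
    obtain ⟨ν, hν, hzν⟩ := exists_unit hn z
    refine ⟨(‖z‖ + t) • ν, ?_, fun y hy => ?_⟩
    · nth_rewrite 2 [hzν]
      rw [← sub_smul, norm_smul, hν]; simp [ht.le]
    · have h1 : ‖(‖z‖ + t) • ν‖ = ‖z‖ + t := by
        rw [norm_smul, hν, mul_one, Real.norm_of_nonneg (by positivity)]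
      rw [Metric.mem_ball, dist_eq_norm] at hy
      have := norm_sub_norm_le ((‖z‖ + t) • ν) y
      rw [norm_sub_rev] at this
      linarith
  rcases h with ⟨R, hR, rfl⟩ | ⟨r, R, hr, hrR, rfl⟩
  · refine ⟨1, one_pos, fun z hz t ht _ => ?_⟩
    obtain ⟨p, h1, h2⟩ := out R t z ht (by simpa using hz)
    exact ⟨p, h1, fun y hy => by simpa using h2 y hy⟩
  · refine ⟨r / 2, by positivity, fun z hz t ht ht2 => ?_⟩
    simp only [Set.mem_ofPred_eq, not_and_or, not_lt] at hz
    rcases hz with hz | hz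
    · obtain ⟨ν, hν, hzν⟩ := exists_unit hn z
      refine ⟨(‖z‖ - t) • ν, ?_, fun y hy => ?_⟩
      · nth_rewrite 2 [hzν]
        rw [← sub_smul, norm_smul, hν]; simp [ht.le]
      · have h1 : ‖(‖z‖ - t) • ν‖ = |‖z‖ - t| := by
          rw [norm_smul, hν, mul_one, Real.norm_eq_abs]
        rw [Metric.mem_ball, dist_eq_norm] at hy
        have h3 := norm_sub_norm_le y ((‖z‖ - t) • ν)
        have h4 : |‖z‖ - t| ≤ r - t := by
          rw [abs_le]; constructor <;> linarith [norm_nonneg z]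
        simp only [Set.mem_compl_iff, Set.mem_ofPred_eq, not_and_or, not_lt]
        left; linarith
    · obtain ⟨p, h1, h2⟩ := out R t z ht hz
      refine ⟨p, h1, fun y hy => ?_⟩
      simp only [Set.mem_compl_iff, Set.mem_ofPred_eq, not_and_or, not_lt]
      exact Or.inr (h2 y hy)

namespace Ker
variable {n : ℕ} (K : Ker n)

lemma sub_step (hn : 2 ≤ n) {v G : Euc n → ℝ} (hv : LocallyIntegrable v)
    (h : SubEq v G) (i : ℕ) (x : Euc n) :
    cv (K.ri (i + 1)) v x ≤ cv (K.ri i) v x + cv (K.ei i) G x := by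
  have h1 := h _ (K.test_ei i (x := x) (Set.subset_univ _)) fun y => K.ei_nonneg _ _
  rw [K.int_lap_ei hn i hv] at h1
  have : cv (K.ei i) G x = ∫ y, G y * K.ei i (x - y) := by
    unfold cv; congr 1; ext y; ring
  rw [this]; linarith

lemma exists_tail (hn : n = 2 ∨ n = 3) {F : Euc n → ℝ} (hF : MemLp F 2) :
    ∃ A, 0 ≤ A ∧ ∀ i x, |cv (K.ei i) F x| ≤ A * √(1/2) ^ i := by
  refine ⟨√(∫ y, K.e y ^ 2) * √(∫ y, F y ^ 2), by positivity, fun i x => ?_⟩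
  refine (cv_le_L2 (K.memLp_ei i) hF x).trans ?_
  have := K.ei_L2 hn i
  calc _ ≤ (√(∫ y, K.e y ^ 2) * √(1/2) ^ i) * √(∫ y, F y ^ 2) := by gcongr
    _ = _ := by ring

end Ker

lemma sqrt_half_lt : √(1/2 : ℝ) < 1 := by
  rw [Real.sqrt_lt' one_pos]; norm_num

lemma geom_tail {r : ℝ} (h0 : 0 ≤ r) (h1 : r < 1) (i m : ℕ) :
    ∑ j ∈ range m, r ^ (i + j) ≤ r ^ i / (1 - r) := by
  simp_rw [pow_add]
  rw [← Finset.mul_sum, div_eq_mul_inv]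
  gcongr
  have := Summable.sum_le_tsum (range m) (fun i _ => pow_nonneg h0 i) (summable_geometric_of_lt_one h0 h1)
  rwa [tsum_geometric_of_lt_one h0 h1] at this

/-- the pointwise a.e. inequality -/
lemma Ker.sub_ae {n : ℕ} (K : Ker n) (hn : n = 2 ∨ n = 3) {v G : Euc n → ℝ} (hv : LocallyIntegrable v)
    (hG : MemLp G 2) (h : SubEq v G) :
    ∃ A, 0 ≤ A ∧ ∀ᵐ x, ∀ i, v x ≤ cv (K.ri i) v x + A * √(1/2) ^ i := by
  have hn2 : 2 ≤ n := by omega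
  obtain ⟨A, hA, hA2⟩ := K.exists_tail hn hG
  have h1r : 0 < 1 - √(1/2 : ℝ) := by linarith [sqrt_half_lt]
  refine ⟨A / (1 - √(1/2)), by positivity, ?_⟩
  filter_upwards [K.ae_tendsto hv hn2] with x hx i
  have hm : ∀ m, cv (K.ri (i + m)) v x ≤ cv (K.ri i) v x + A * ∑ j ∈ range m, √(1/2) ^ (i + j) := by
    intro m
    induction m with
    | zero => simp
    | succ m ih =>
      rw [Finset.sum_range_succ, ← add_assoc, mul_add]
      have h1 := K.sub_step hn2 hv h (i + m) x
      have h2 := (le_abs_self _).trans (hA2 (i + m) x)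
      linarith
  have hx2 : Filter.Tendsto (fun m => cv (K.ri (i + m)) v x) Filter.atTop (𝓝 (v x)) :=
    (Filter.tendsto_add_atTop_iff_nat i (f := fun m => cv (K.ri m) v x)).2 hx |>.congr fun m => by rw [add_comm]
  refine le_of_tendsto' hx2 fun m => (hm m).trans ?_
  have := geom_tail (Real.sqrt_nonneg _) sqrt_half_lt i m
  calc _ ≤ cv (K.ri i) v x + A * (√(1/2) ^ i / (1 - √(1/2))) := by gcongr
    _ = _ := by ring
end

noncomputable section
open Real MeasureTheory Finset
open scoped ContDiff Topology

namespace Ker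
variable {n : ℕ} (K : Ker n)

/-- exterior density of the mollifier mass -/
lemma ext_mass (hn : 2 ≤ n) {Ω : Set (Euc n)} (hΩ : ExtBall Ω) (hm : MeasurableSet Ω) :
    ∃ η > 0, ∃ c > 0, ∃ i0 : ℕ, ∀ i ≥ i0, ∀ x : Euc n, (∃ z ∉ Ω, ‖x - z‖ < η * (1/2) ^ i) →
      c ≤ ∫ y in Ωᶜ, K.ri i (x - y) := by
  obtain ⟨t0, ht0, hext⟩ := hΩ
  have ha := K.a_pos
  have hcont := K.q_cont
  obtain ⟨s, hs, hsq⟩ : ∃ s > 0, ∀ t, |t - K.a| < 2 * s → K.q K.a / 2 ≤ K.q t := by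
    have := Metric.continuousAt_iff.1 (hcont.continuousAt (x := K.a)) (K.q K.a / 2) (by linarith [K.q_pos])
    obtain ⟨δ, hδ, h⟩ := this
    refine ⟨δ / 2, by positivity, fun t ht => ?_⟩
    have := h (x := t) (by rw [Real.dist_eq]; linarith)
    rw [Real.dist_eq, abs_lt] at this
    linarith
  set η := min s K.a with hη
  have hηpos : 0 < η := lt_min hs ha
  have hvol : 0 < volume.real (Metric.ball (0 : Euc n) 1) :=
    ENNReal.toReal_pos (Metric.measure_ball_pos _ _ (by norm_num)).ne' measure_ball_lt_top.ne
  obtain ⟨i0, hi0⟩ : ∃ i0 : ℕ, K.a * (1/2 : ℝ) ^ i0 < t0 := by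
    obtain ⟨i0, h⟩ := exists_pow_lt_of_lt_one (show 0 < t0 / K.a by positivity) (show (1/2:ℝ) < 1 by norm_num)
    exact ⟨i0, by rwa [lt_div_iff₀' ha] at h⟩
  refine ⟨η, hηpos, K.q K.a / 2 * (η ^ n * volume.real (Metric.ball (0 : Euc n) 1)),
    by have := K.q_pos; positivity, i0, ?_⟩
  rintro i hi x ⟨z, hz, hxz⟩
  have h2i : (0:ℝ) < (1/2) ^ i := by positivity
  have hle : K.a * (1/2 : ℝ) ^ i ≤ t0 := by
    refine le_trans ?_ hi0.le
    gcongr ?_ * ?_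
    exact pow_le_pow_of_le_one (by norm_num) (by norm_num) hi
  obtain ⟨p, hp1, hp2⟩ := hext z hz (K.a * (1/2) ^ i) (by positivity) hle
  have hsub : Metric.ball p (η * (1/2) ^ i) ⊆ Ωᶜ := by
    refine (Metric.ball_subset_ball ?_).trans hp2
    gcongr; exact min_le_right _ _
  have hIntg : Integrable (fun y => K.ri i (x - y)) :=
    ((K.ri_smooth i).continuous.integrable_of_hasCompactSupport (K.ri_compact i)).comp_sub_left x
  have h1 : ∫ y in Metric.ball p (η * (1/2) ^ i), K.ri i (x - y) ≤ ∫ y in Ωᶜ, K.ri i (x - y) :=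
    setIntegral_mono_set hIntg.integrableOn (Filter.Eventually.of_forall fun y => K.ri_nonneg _ _)
      (HasSubset.Subset.eventuallyLE hsub)
  refine le_trans ?_ h1
  have h3 : ∀ y ∈ Metric.ball p (η * (1/2) ^ i), 2 ^ (i * n) * (K.q K.a / 2) ≤ K.ri i (x - y) := by
    intro y hy
    unfold ri
    rw [K.ρ_rad]
    gcongr
    apply hsq
    rw [norm_smul, norm_pow, Real.norm_ofNat]
    rw [Metric.mem_ball, dist_eq_norm] at hy
    have e1 : |‖x - y‖ - K.a * (1/2) ^ i| < 2 * s * (1/2) ^ i := by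
      rw [← hp1, ← norm_sub_rev]
      refine (abs_norm_sub_norm_le _ _).trans_lt ?_
      have : y - x - (p - z) = (y - p) - (x - z) := by abel
      rw [this]
      refine (norm_sub_le _ _).trans_lt ?_
      have : η ≤ s := min_le_left _ _
      nlinarith
    have h22 : (2:ℝ) ^ i * (1/2) ^ i = 1 := by rw [← mul_pow]; norm_num
    have e2 : 2 ^ i * ‖x - y‖ - K.a = 2 ^ i * (‖x - y‖ - K.a * (1/2) ^ i) := by
      linear_combination K.a * h22
    rw [e2, abs_mul, abs_of_pos (by positivity : (0:ℝ) < 2 ^ i)]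
    calc _ < 2 ^ i * (2 * s * (1/2) ^ i) := by gcongr
      _ = 2 * s := by linear_combination 2 * s * h22
  have h4 := setIntegral_mono_on (μ := volume) (f := fun _ => 2 ^ (i * n) * (K.q K.a / 2))
    (integrableOn_const (by exact measure_ball_lt_top.ne)) hIntg.integrableOn measurableSet_ball h3
  refine le_trans (le_of_eq ?_) h4
  have hball : volume.real (Metric.ball p (η * (1/2) ^ i))
      = (η * (1/2) ^ i) ^ n * volume.real (Metric.ball (0 : Euc n) 1) := by
    rw [measureReal_def, Measure.addHaar_ball_of_pos _ _ (by positivity), ENNReal.toReal_mul,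
      ENNReal.toReal_ofReal (by positivity), ← measureReal_def, finrank_euclideanSpace, Fintype.card_fin]
  rw [setIntegral_const, hball]
  simp only [smul_eq_mul]
  have : (2:ℝ) ^ (i * n) * ((1/2) ^ i) ^ n = 1 := by rw [pow_mul, ← mul_pow, ← mul_pow]; norm_num
  rw [mul_pow]
  linear_combination (-(K.q K.a / 2 * (η ^ n * volume.real (Metric.ball (0 : Euc n) 1)))) * this

lemma ri_cv_le {v : Euc n → ℝ} (hv : LocallyIntegrable v) {Ω : Set (Euc n)} (hm : MeasurableSet Ω)
    {x : Euc n} {w c : ℝ} {i : ℕ} (hw : 0 ≤ w)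
    (hzero : ∀ y ∉ Ω, v y = 0) (hb : ∀ᵐ y, ‖x - y‖ < 2 * (1/2) ^ i → v y ≤ w)
    (hc : c ≤ ∫ y in Ωᶜ, K.ri i (x - y)) : cv (K.ri i) v x ≤ (1 - c) * w := by
  have hIntg : Integrable (fun y => K.ri i (x - y)) :=
    ((K.ri_smooth i).continuous.integrable_of_hasCompactSupport (K.ri_compact i)).comp_sub_left x
  have h1 : cv (K.ri i) v x ≤ ∫ y, Ω.indicator (fun y => K.ri i (x - y) * w) y := by
    unfold cv
    refine integral_mono_ae (integrable_cv (K.ri_smooth _).continuous (K.ri_compact _) hv x)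
      ((hIntg.mul_const w).indicator hm) ?_
    filter_upwards [hb] with y hy
    by_cases hyΩ : y ∈ Ω
    · simp only [Set.indicator_of_mem hyΩ]
      by_cases h : ‖x - y‖ < 2 * (1/2) ^ i
      · exact mul_le_mul_of_nonneg_left (hy h) (K.ri_nonneg _ _)
      · rw [K.ri_supp (not_lt.1 h)]; simp
    · simp [Set.indicator_of_notMem hyΩ, hzero y hyΩ]
  rw [integral_indicator hm, integral_mul_const] at h1
  have h2 := integral_add_compl hm hIntg
  rw [integral_sub_left_eq_self (fun y => K.ri i y) volume x, K.ri_int] at h2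
  refine h1.trans ?_
  gcongr
  linarith

/-- essential smallness near the complement. -/
lemma bdry_small (K : Ker n) (hn : n = 2 ∨ n = 3) {Ω : Set (Euc n)} (hΩ : ExtBall Ω) (hm : MeasurableSet Ω)
    {v G : Euc n → ℝ} (hv : MemLp v 2) (hv0 : ∀ x, 0 ≤ v x) (hzero : ∀ y ∉ Ω, v y = 0)
    (hG : MemLp G 2) (h : SubEq v G) :
    (∃ M, ∀ᵐ x, v x ≤ M) ∧
    ∀ ε > 0, ∃ δ > 0, ∀ᵐ x, (∃ z ∉ Ω, ‖x - z‖ < δ) → v x ≤ ε := by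
  have hn2 : 2 ≤ n := by omega
  have hvl : LocallyIntegrable v := hv.locallyIntegrable (by norm_num)
  obtain ⟨A, hA, hAe⟩ := K.sub_ae hn hvl hG h
  obtain ⟨η, hη, c, hc, i0, hmass⟩ := K.ext_mass hn2 hΩ hm
  set r := √(1/2 : ℝ) with hr
  have hr0 : 0 ≤ r := Real.sqrt_nonneg _
  have hr1 : r < 1 := sqrt_half_lt
  set M := √(∫ y, K.ri 0 y ^ 2) * √(∫ y, v y ^ 2) + A with hM
  have hM0 : 0 ≤ M := by positivity
  have hMb : ∀ᵐ x, v x ≤ M := by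
    filter_upwards [hAe] with x hx
    have h1 := hx 0
    have h2 := (le_abs_self _).trans (cv_le_L2 (K.memLp_ri 0) hv x)
    simp only [pow_zero, mul_one] at h1
    linarith
  refine ⟨⟨M, hMb⟩, ?_⟩
  obtain ⟨i1, hi1⟩ : ∃ i1 : ℕ, (2 + η) * (1/2:ℝ) ^ i1 < η := by
    obtain ⟨i1, h⟩ := exists_pow_lt_of_lt_one (show 0 < η / (2 + η) by positivity) (show (1/2:ℝ) < 1 by norm_num)
    exact ⟨i1, by rwa [lt_div_iff₀' (by positivity)] at h⟩
  have hi1p : i1 ≠ 0 := by rintro rfl; simp at hi1; linarith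
  set t := max (max (1 - c) (r ^ i1)) 0 with ht
  have ht0 : 0 ≤ t := le_max_right _ _
  have ht1 : t < 1 := by
    simp only [ht, max_lt_iff]
    exact ⟨⟨by linarith, pow_lt_one₀ hr0 hr1 hi1p⟩, one_pos⟩
  have htc : 1 - c ≤ t := (le_max_left _ _).trans (le_max_left _ _)
  have htr : r ^ i1 ≤ t := (le_max_right _ _).trans (le_max_left _ _)
  have main : ∀ k : ℕ, ∀ᵐ x, (∃ z ∉ Ω, ‖x - z‖ < η * (1/2) ^ (i0 + k * i1)) → v x ≤ (M + A * k) * t ^ k := by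
    intro k
    induction k with
    | zero =>
      filter_upwards [hMb] with x hx _
      simpa using hx
    | succ k ih =>
      filter_upwards [hAe] with x hx hz
      have hx' := hx (i0 + (k + 1) * i1)
      have hw : 0 ≤ (M + A * k) * t ^ k := by positivity
      have hcv := K.ri_cv_le hvl hm hw hzero (x := x) (i := i0 + (k+1) * i1) ?_ (hmass _ (by omega) x hz)
      · refine hx'.trans ?_
        have e1 : r ^ (i0 + (k + 1) * i1) ≤ t ^ (k + 1) := by
          calc r ^ (i0 + (k + 1) * i1) ≤ r ^ ((k+1) * i1) :=
                pow_le_pow_of_le_one hr0 hr1.le (by omega)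
            _ = (r ^ i1) ^ (k + 1) := by rw [← pow_mul, mul_comm]
            _ ≤ _ := by gcongr
        have e2 : (1 - c) * ((M + A * k) * t ^ k) ≤ t * ((M + A * k) * t ^ k) := by gcongr
        have e3 : A * r ^ (i0 + (k + 1) * i1) ≤ A * t ^ (k + 1) := by gcongr
        push_cast
        calc _ ≤ t * ((M + A * k) * t ^ k) + A * t ^ (k + 1) := by linarith
          _ = _ := by ring
      · filter_upwards [ih] with y hy hxy
        apply hy
        obtain ⟨z, hz1, hz2⟩ := hz
        refine ⟨z, hz1, ?_⟩
        have : y - z = (x - z) - (x - y) := by abel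
        rw [this]
        refine (norm_sub_le _ _).trans_lt ?_
        have e4 : i0 + (k + 1) * i1 = i1 + (i0 + k * i1) := by ring
        rw [e4, pow_add] at hz2 hxy
        have e5 : (0:ℝ) < (1/2) ^ (i0 + k * i1) := by positivity
        nlinarith
  have hlim : Filter.Tendsto (fun k : ℕ => (M + A * k) * t ^ k) Filter.atTop (𝓝 0) := by
    have h1 := tendsto_pow_atTop_nhds_zero_of_lt_one ht0 ht1
    have h2 := tendsto_self_mul_const_pow_of_lt_one ht0 ht1
    have := (h1.const_mul M).add (h2.const_mul A)
    simp only [mul_zero, add_zero] at this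
    exact this.congr fun k => by ring
  intro ε hε
  obtain ⟨k, hk⟩ := (hlim.eventually (gt_mem_nhds hε)).exists
  refine ⟨η * (1/2) ^ (i0 + k * i1), by positivity, ?_⟩
  filter_upwards [main k] with x hx hz
  exact (hx hz).trans hk.le

end Ker

lemma cv_continuous {n : ℕ} {k u : Euc n → ℝ} (hk : Continuous k) (hk2 : HasCompactSupport k)
    (hu : LocallyIntegrable u) : Continuous (cv k u) := by
  have := HasCompactSupport.continuous_convolution_right (L := ContinuousLinearMap.mul ℝ ℝ) (μ := volume) hk2 hu hk
  convert this using 1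
  ext x
  unfold cv
  rw [convolution_def]
  congr 1; ext y; simp [mul_comm]

/-- a.e. bound on an open set holds everywhere for continuous function -/
lemma le_of_ae_le {n : ℕ} {O : Set (Euc n)} (hO : IsOpen O) {U : Euc n → ℝ} (hU : ContinuousOn U O) {w : ℝ}
    (h : ∀ᵐ x, x ∈ O → U x ≤ w) : ∀ x ∈ O, U x ≤ w := by
  by_contra hcon
  push Not at hcon
  obtain ⟨x, hx, hxw⟩ := hcon
  have hop : IsOpen (O ∩ U ⁻¹' Set.Ioi w) := hU.isOpen_inter_preimage hO isOpen_Ioi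
  have := hop.measure_pos volume ⟨x, hx, hxw⟩
  refine this.ne' ?_
  rw [ae_iff] at h
  refine measure_mono_null ?_ h
  rintro y ⟨hy1, hy2⟩ hy3
  exact absurd (hy3 hy1) (not_le.2 hy2)

/-- interior continuity -/
lemma Ker.interior_cont {n : ℕ} (K : Ker n) (hn : n = 2 ∨ n = 3) {Ω : Set (Euc n)} (hO : IsOpen Ω)
    {u F : Euc n → ℝ} (hu : LocallyIntegrable u) (hF : MemLp F 2) (h : WeakEq Ω u F) :
    ∃ U : Euc n → ℝ, ContinuousOn U Ω ∧ U =ᵐ[volume.restrict Ω] u := by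
  have hn2 : 2 ≤ n := by omega
  obtain ⟨A, hA, hA2⟩ := K.exists_tail hn hF
  have hsum : Summable fun i => A * √(1/2 : ℝ) ^ i :=
    (summable_geometric_of_lt_one (Real.sqrt_nonneg _) sqrt_half_lt).mul_left A
  have key : ∀ x ∈ Ω, ∃ i : ℕ, ∀ᶠ y in 𝓝 x, Metric.closedBall y (2 * (1/2) ^ i) ⊆ Ω := by
    intro x hx
    obtain ⟨ε, hε, hb⟩ := Metric.isOpen_iff.1 hO x hx
    obtain ⟨i, hi⟩ := exists_pow_lt_of_lt_one (show 0 < ε / 4 by positivity) (show (1/2:ℝ) < 1 by norm_num)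
    refine ⟨i, ?_⟩
    filter_upwards [Metric.ball_mem_nhds x (show 0 < ε / 2 by positivity)] with y hy z hz
    apply hb
    rw [Metric.mem_ball] at hy ⊢
    rw [Metric.mem_closedBall] at hz
    have := dist_triangle z y x
    linarith
  set S : ℕ → Euc n → ℝ := fun i x => cv (K.ri i) u x + ∑' j, cv (K.ei (i + j)) F x with hS
  have hb : ∀ i j x, ‖cv (K.ei (i + j)) F x‖ ≤ A * √(1/2 : ℝ) ^ j := by
    intro i j x
    rw [Real.norm_eq_abs]
    refine (hA2 (i + j) x).trans ?_
    gcongr ?_ * ?_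
    exact pow_le_pow_of_le_one (Real.sqrt_nonneg _) sqrt_half_lt.le (by omega)
  have hFl : LocallyIntegrable F := hF.locallyIntegrable (by norm_num)
  have hScont : ∀ i, Continuous (S i) := fun i =>
    (cv_continuous (K.ri_smooth _).continuous (K.ri_compact _) hu).add
      (continuous_tsum (fun j => cv_continuous (K.ei_smooth _).continuous (K.ei_compact _) hFl) hsum
        fun j x => hb i j x)
  have hlim : ∀ i x, Metric.closedBall x (2 * (1/2) ^ i) ⊆ Ω →
      Filter.Tendsto (fun m => cv (K.ri m) u x) Filter.atTop (𝓝 (S i x)) := by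
    intro i x hx
    rw [← Filter.tendsto_add_atTop_iff_nat i]
    have h1 := (Summable.of_norm_bounded hsum fun j => hb i j x).hasSum.tendsto_sum_nat
    refine (h1.const_add (cv (K.ri i) u x)).congr fun m => ?_
    rw [add_comm m i, K.steps hn2 hu h hx m]
  refine ⟨fun x => Filter.limUnder Filter.atTop (fun m => cv (K.ri m) u x), ?_, ?_⟩
  · intro x hx
    obtain ⟨i, hi⟩ := key x hx
    refine ContinuousAt.continuousWithinAt ?_
    refine ((hScont i).continuousAt).congr ?_
    filter_upwards [hi] with y hy
    exact (hlim i y hy).limUnder_eq.symm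
  · filter_upwards [ae_restrict_of_ae (K.ae_tendsto hu hn2)] with x hx
    exact hx.limUnder_eq

/-- continuous representative vanishing outside `Ω` -/
theorem exists_cont_rep {n : ℕ} (hn : n = 2 ∨ n = 3) {Ω : Set (Euc n)} (hO : IsOpen Ω) (hΩ : ExtBall Ω)
    {u F : Euc n → ℝ} (hu : MemLp u 2) (hzero : ∀ᵐ y, y ∉ Ω → u y = 0)
    (hF : MemLp F 2) (h : WeakEq Ω u F) (h2 : SubEq (fun x => |u x|) (fun x => |F x|)) :
    ∃ U : Euc n → ℝ, Continuous U ∧ (∀ x ∉ Ω, U x = 0) ∧ U =ᵐ[volume] u := by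
  obtain ⟨K⟩ := Ker.nonempty (n := n) (by omega)
  obtain ⟨U0, hU0, hU0e⟩ := K.interior_cont hn hO (hu.locallyIntegrable (by norm_num)) hF h
  set U := Ω.indicator U0 with hU
  have hUe : U =ᵐ[volume] u := by
    rw [Filter.EventuallyEq, ae_restrict_iff' hO.measurableSet] at hU0e
    filter_upwards [hU0e, hzero] with x hx hx2
    by_cases hxΩ : x ∈ Ω
    · simp [hU, hxΩ, hx hxΩ]
    · simp [hU, hxΩ, hx2 hxΩ]
  have hUc : ContinuousOn U Ω := hU0.congr fun x hx => by simp [hU, hx]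
  have hU0' : ∀ x ∉ Ω, U x = 0 := fun x hx => by simp [hU, hx]
  have hsub : SubEq (fun x => |U x|) (fun x => |F x|) := by
    intro φ hφ hφ0
    have : ∫ y, |U y| * lap φ y = ∫ y, |u y| * lap φ y := by
      refine integral_congr_ae ?_
      filter_upwards [hUe] with y hy
      rw [hy]
    rw [this]
    exact h2 φ hφ hφ0
  obtain ⟨-, hb⟩ := K.bdry_small hn hΩ hO.measurableSet (hu.ae_eq hUe.symm).abs (fun x => abs_nonneg _)
    (fun y hy => by simp [hU0' y hy]) hF.abs hsub
  refine ⟨U, ?_, hU0', hUe⟩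
  rw [continuous_iff_continuousAt]
  intro x
  by_cases hx : x ∈ Ω
  · exact hUc.continuousAt (hO.mem_nhds hx)
  · rw [Metric.continuousAt_iff]
    intro ε hε
    obtain ⟨δ, hδ, hae⟩ := hb (ε / 2) (by positivity)
    refine ⟨δ, hδ, fun {y} hy => ?_⟩
    rw [hU0' x hx, dist_zero_right, Real.norm_eq_abs]
    by_cases hyΩ : y ∈ Ω
    · have := le_of_ae_le (O := Ω ∩ Metric.ball x δ) (hO.inter Metric.isOpen_ball) (U := fun y => |U y|)
        (hUc.mono Set.inter_subset_left).abs (w := ε / 2) ?_ y ⟨hyΩ, hy⟩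
      · linarith
      · filter_upwards [hae] with z hz hz2
        exact hz ⟨x, hx, by simpa [dist_eq_norm] using hz2.2⟩
    · rw [hU0' y hyΩ]; simpa using hε
end

noncomputable section
open Real MeasureTheory Finset
open scoped ContDiff Topology

lemma cv_eq_conv {n : ℕ} (k u : Euc n → ℝ) :
    cv k u = convolution u k (ContinuousLinearMap.mul ℝ ℝ) volume := by
  ext x
  unfold cv
  rw [convolution_def]
  congr 1; ext y; simp [mul_comm]

lemma norm_conv_le {n : ℕ} {E₁ E₂ E₃ : Type*} [NormedAddCommGroup E₁] [NormedAddCommGroup E₂]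
    [NormedAddCommGroup E₃] [NormedSpace ℝ E₁] [NormedSpace ℝ E₂] [NormedSpace ℝ E₃]
    (L : E₁ →L[ℝ] E₂ →L[ℝ] E₃) {f : Euc n → E₁} {g : Euc n → E₂} {C : ℝ} (hC : 0 ≤ C) (hf : ∀ x, ‖f x‖ ≤ C)
    (hg : Integrable g) (x : Euc n) :
    ‖convolution f g L volume x‖ ≤ ‖L‖ * C * ∫ y, ‖g y‖ := by
  rw [convolution_def]
  have h1 : Integrable (fun t => ‖L‖ * C * ‖g (x - t)‖) := ((hg.comp_sub_left x).norm.const_mul _)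
  refine (norm_integral_le_of_norm_le h1 (Filter.Eventually.of_forall fun t => ?_)).trans (le_of_eq ?_)
  · refine (L.le_opNorm₂ _ _).trans ?_
    gcongr
    exact hf t
  · rw [integral_const_mul, integral_sub_left_eq_self (fun y => ‖g y‖)]

lemma conv_bound {n : ℕ} {E₁ E₂ E₃ : Type*} [NormedAddCommGroup E₁] [NormedAddCommGroup E₂]
    [NormedAddCommGroup E₃] [NormedSpace ℝ E₁] [NormedSpace ℝ E₂] [NormedSpace ℝ E₃]
    (L : E₁ →L[ℝ] E₂ →L[ℝ] E₃) : ∃ M : ℝ, 0 ≤ M ∧ ∀ (f : Euc n → E₁) (g : Euc n → E₂) (C : ℝ), 0 ≤ C →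
      (∀ x, ‖f x‖ ≤ C) → Integrable g → ∀ x, ‖convolution f g L volume x‖ ≤ M * C * ∫ y, ‖g y‖ :=
  ⟨‖L‖, L.opNorm_nonneg, fun _ _ _ hC hf hg x => norm_conv_le L hC hf hg x⟩

namespace Ker
variable {n : ℕ} (K : Ker n)

lemma int_fderiv_ei (hn : 2 ≤ n) (i : ℕ) :
    ∫ y, ‖fderiv ℝ (K.ei i) y‖ = (∫ y, ‖fderiv ℝ K.e y‖) * (1/2) ^ i := by
  have h1 : ∀ y, ‖fderiv ℝ (K.ei i) y‖ = 2 ^ (i * (n - 2)) * 2 ^ i * ‖fderiv ℝ K.e ((2:ℝ) ^ i • y)‖ := by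
    intro y
    unfold ei
    have e1 : fderiv ℝ (fun x => (2:ℝ) ^ (i * (n - 2)) * K.e ((2:ℝ) ^ i • x)) y
        = (2:ℝ) ^ (i * (n - 2)) • fderiv ℝ (fun x => K.e ((2:ℝ) ^ i • x)) y := by
      change fderiv ℝ ((2:ℝ) ^ (i * (n - 2)) • fun x => K.e ((2:ℝ) ^ i • x)) y = _
      rw [fderiv_const_smul_field]; rfl
    rw [e1, fderiv_comp_smul, smul_smul, norm_smul, norm_mul]
    simp
  simp_rw [h1]
  rw [integral_const_mul, Measure.integral_comp_smul_of_nonneg (hR := by positivity) _ (fun y => ‖fderiv ℝ K.e y‖)]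
  simp only [finrank_euclideanSpace, Fintype.card_fin, smul_eq_mul]
  obtain ⟨m, rfl⟩ : ∃ m, n = m + 2 := ⟨n - 2, by omega⟩
  simp only [Nat.add_sub_cancel]
  rw [one_div, inv_pow]
  have : (2:ℝ) ^ (i * m) = (2 ^ i) ^ m := by rw [pow_mul]
  rw [this]
  field_simp
  ring

lemma int_ei (hn : 2 ≤ n) (i : ℕ) :
    ∫ y, ‖K.ei i y‖ ≤ (∫ y, ‖K.e y‖) * (1/2) ^ i := by
  have h1 : ∀ y, ‖(K.ei i) y‖ = 2 ^ (i * (n - 2)) * ‖K.e ((2:ℝ) ^ i • y)‖ := by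
    intro y
    unfold ei
    rw [norm_mul]; simp
  simp_rw [h1]
  rw [integral_const_mul, Measure.integral_comp_smul_of_nonneg (hR := by positivity) _ (fun y => ‖K.e y‖)]
  simp only [finrank_euclideanSpace, Fintype.card_fin, smul_eq_mul]
  obtain ⟨m, rfl⟩ : ∃ m, n = m + 2 := ⟨n - 2, by omega⟩
  simp only [Nat.add_sub_cancel]
  have h0 : 0 ≤ ∫ y, ‖K.e y‖ := integral_nonneg fun y => norm_nonneg _
  have : (2:ℝ) ^ (i * m) * (((2 ^ i) ^ (m+2))⁻¹ * (∫ y, ‖K.e y‖)) = (∫ y, ‖K.e y‖) * ((1/2) ^ i * (1/2) ^ i) := by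
    rw [one_div, inv_pow, pow_mul]
    field_simp
    ring
  rw [this]
  have h3 : (1/2 : ℝ) ^ i ≤ 1 := pow_le_one₀ (by norm_num) (by norm_num)
  have h4 : 0 ≤ (1/2 : ℝ) ^ i := by positivity
  gcongr
  nlinarith

/-- the basic smoothing series. -/
lemma series_C1 (hn : 2 ≤ n) (i : ℕ) {G : Euc n → ℝ} (hG : Continuous G) (hGc : HasCompactSupport G) :
    ContDiff ℝ 1 (fun x => ∑' j, cv (K.ei (i + j)) G x) ∧
    (ContDiff ℝ 1 G → ContDiff ℝ 2 (fun x => ∑' j, cv (K.ei (i + j)) G x)) := by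
  obtain ⟨C, hC⟩ := hGc.exists_bound_of_continuous hG
  have hC0 : 0 ≤ C := (norm_nonneg _).trans (hC 0)
  have hGl : LocallyIntegrable G := hG.locallyIntegrable
  set L := ContinuousLinearMap.mul ℝ ℝ
  obtain ⟨M0, hM0, hM0b⟩ := conv_bound (n := n) L
  obtain ⟨M1, hM1, hM1b⟩ := conv_bound (n := n) (E₁ := ℝ) (E₂ := Euc n →L[ℝ] ℝ) (E₃ := Euc n →L[ℝ] ℝ) (L.precompR (Euc n))
  obtain ⟨M2, hM2, hM2b⟩ := conv_bound (n := n) (E₁ := Euc n →L[ℝ] ℝ) (E₂ := Euc n →L[ℝ] ℝ) (E₃ := Euc n →L[ℝ] Euc n →L[ℝ] ℝ) ((L.precompL (Euc n)).precompR (Euc n))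
  have hsum : ∀ B : ℝ, Summable fun j => B * (1/2 : ℝ) ^ (i + j) := by
    intro B
    have := (summable_geometric_of_lt_one (r := (1/2:ℝ)) (by norm_num) (by norm_num)).mul_left (B * (1/2) ^ i)
    refine this.congr fun j => by rw [pow_add]; ring
  have hCD : ∀ j, ContDiff ℝ ∞ (cv (K.ei (i + j)) G) := fun j => by
    rw [cv_eq_conv]
    exact (K.ei_compact _).contDiff_convolution_right _ hGl (K.ei_smooth _)
  have hei1 : ∀ j, ContDiff ℝ 1 (K.ei j) := fun j => (K.ei_smooth j).of_le (by norm_cast)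
  have hint0 : ∀ j, Integrable (K.ei j) := fun j =>
    (K.ei_smooth j).continuous.integrable_of_hasCompactSupport (K.ei_compact j)
  have hint1 : ∀ j, Integrable (fderiv ℝ (K.ei j)) := fun j =>
    ((hei1 j).continuous_fderiv one_ne_zero).integrable_of_hasCompactSupport ((K.ei_compact j).fderiv ℝ)
  have b0 : ∀ j x, ‖cv (K.ei (i + j)) G x‖ ≤ M0 * C * (∫ y, ‖K.e y‖) * (1/2) ^ (i + j) := by
    intro j x
    rw [cv_eq_conv]
    refine (hM0b _ _ _ hC0 hC (hint0 _) x).trans ?_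
    rw [mul_assoc (M0 * C)]
    gcongr
    exact K.int_ei hn _
  have b1 : ∀ j x, ‖fderiv ℝ (cv (K.ei (i + j)) G) x‖ ≤
      M1 * C * (∫ y, ‖fderiv ℝ K.e y‖) * (1/2) ^ (i + j) := by
    intro j x
    rw [cv_eq_conv, ((K.ei_compact _).hasFDerivAt_convolution_right L hGl (hei1 _) x).fderiv]
    refine (hM1b _ _ _ hC0 hC (hint1 _) x).trans ?_
    rw [K.int_fderiv_ei hn, mul_assoc (M1 * C)]
  constructor
  · refine contDiff_tsum (N := 1) (v := fun k j => if k = 0 then M0 * C * (∫ y, ‖K.e y‖) * (1/2) ^ (i + j)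
      else M1 * C * (∫ y, ‖fderiv ℝ K.e y‖) * (1/2) ^ (i + j))
      (fun j => (hCD j).of_le (by norm_cast)) ?_ ?_
    · intro k hk
      by_cases hk0 : k = 0
      · simp only [hk0, if_true]; exact hsum _
      · simp only [hk0, if_false]; exact hsum _
    · intro k j x hk
      have : k = 0 ∨ k = 1 := by
        have : k ≤ 1 := by exact_mod_cast hk
        omega
      rcases this with rfl | rfl
      · simp only [norm_iteratedFDeriv_zero, if_true]; exact b0 j x
      · simp only [norm_iteratedFDeriv_one, one_ne_zero, if_false]; exact b1 j x
  · intro hG1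
    obtain ⟨C', hC'⟩ := (hGc.fderiv ℝ).exists_bound_of_continuous (hG1.continuous_fderiv one_ne_zero)
    have hC0' : 0 ≤ C' := (norm_nonneg _).trans (hC' 0)
    have hGl' : LocallyIntegrable (fderiv ℝ G) := (hG1.continuous_fderiv one_ne_zero).locallyIntegrable
    have b2 : ∀ j x, ‖fderiv ℝ (fderiv ℝ (cv (K.ei (i + j)) G)) x‖ ≤
        M2 * C' * (∫ y, ‖fderiv ℝ K.e y‖) * (1/2) ^ (i + j) := by
      intro j x
      have e1 : fderiv ℝ (cv (K.ei (i + j)) G)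
          = convolution (fderiv ℝ G) (K.ei (i + j)) (L.precompL (Euc n)) volume := by
        ext1 x
        rw [cv_eq_conv, (hGc.hasFDerivAt_convolution_left L hG1
          (K.ei_smooth _).continuous.locallyIntegrable x).fderiv]
      rw [e1, ((K.ei_compact _).hasFDerivAt_convolution_right (L.precompL (Euc n)) hGl' (hei1 _) x).fderiv]
      refine (hM2b _ _ _ hC0' hC' (hint1 _) x).trans ?_
      rw [K.int_fderiv_ei hn, mul_assoc (M2 * C')]
    refine contDiff_tsum (N := 2) (v := fun k j => if k = 0 then M0 * C * (∫ y, ‖K.e y‖) * (1/2) ^ (i + j)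
      else if k = 1 then M1 * C * (∫ y, ‖fderiv ℝ K.e y‖) * (1/2) ^ (i + j)
      else M2 * C' * (∫ y, ‖fderiv ℝ K.e y‖) * (1/2) ^ (i + j))
      (fun j => (hCD j).of_le (by norm_cast)) ?_ ?_
    · intro k hk
      by_cases hk0 : k = 0
      · simp only [hk0, if_true]; exact hsum _
      · by_cases hk1 : k = 1
        · simp only [hk1, one_ne_zero, if_true, if_false]; exact hsum _
        · simp only [hk0, hk1, if_false]; exact hsum _
    · intro k j x hk
      have : k = 0 ∨ k = 1 ∨ k = 2 := by
        have : k ≤ 2 := by exact_mod_cast hk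
        omega
      rcases this with rfl | rfl | rfl
      · simp only [norm_iteratedFDeriv_zero, if_true]; exact b0 j x
      · simp only [norm_iteratedFDeriv_one, one_ne_zero, if_true, if_false]; exact b1 j x
      · simp only [← norm_iteratedFDeriv_fderiv (n := 1), norm_iteratedFDeriv_one, OfNat.ofNat_ne_zero,
          OfNat.ofNat_ne_one, if_false]
        exact b2 j x

/-- local representation near a point -/
lemma local_rep (K : Ker n) (hn : 2 ≤ n) {Ω : Set (Euc n)} (hO : IsOpen Ω) {U F : Euc n → ℝ} (hU : Continuous U)
    (hF : Continuous F) (hFc : HasCompactSupport F) (h : WeakEq Ω U F) {x0 : Euc n} (hx0 : x0 ∈ Ω) :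
    ∃ i : ℕ, ∃ χ : Euc n → ℝ, Test Ω χ ∧ 
      ∀ᶠ x in 𝓝 x0, U x = cv (K.ri i) U x + ∑' j, cv (K.ei (i + j)) (fun y => χ y * F y) x := by
  obtain ⟨ε, hε, hb⟩ := Metric.isOpen_iff.1 hO x0 hx0
  let f : ContDiffBump x0 := ⟨ε / 4, ε / 2, by positivity, by linarith⟩
  have hfT : Test Ω f := by
    refine ⟨f.contDiff, f.hasCompactSupport, ?_⟩
    rw [f.tsupport_eq]
    refine (Metric.closedBall_subset_ball ?_).trans hb
    change ε / 2 < ε; linarith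
  obtain ⟨i, hi⟩ := exists_pow_lt_of_lt_one (show 0 < ε / 16 by positivity) (show (1/2:ℝ) < 1 by norm_num)
  refine ⟨i, f, hfT, ?_⟩
  have hG : Continuous fun y => f y * F y := f.continuous.mul hF
  have hae : ∀ᵐ x, x ∈ Metric.ball x0 (ε / 8) →
      U x = cv (K.ri i) U x + ∑' j, cv (K.ei (i + j)) (fun y => f y * F y) x := by
    filter_upwards [K.ae_tendsto hU.locallyIntegrable hn] with x hx hxb
    rw [Metric.mem_ball] at hxb
    have hball : Metric.closedBall x (2 * (1/2) ^ i) ⊆ Metric.closedBall x0 (ε / 4) := by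
      intro z hz
      rw [Metric.mem_closedBall] at hz ⊢
      linarith [dist_triangle z x x0]
    have hsub : Metric.closedBall x (2 * (1/2) ^ i) ⊆ Ω :=
      hball.trans ((Metric.closedBall_subset_ball (by linarith)).trans hb)
    have hcongr : ∀ j, cv (K.ei (i + j)) (fun y => f y * F y) x = cv (K.ei (i + j)) F x := by
      intro j
      unfold cv
      congr 1; ext y
      by_cases hy : 2 * (1/2) ^ (i + j) ≤ ‖x - y‖
      · rw [K.ei_supp hy]; simp
      · have h1 : y ∈ Metric.closedBall x0 (ε / 4) := by
          apply hball
          rw [Metric.mem_closedBall, dist_comm, dist_eq_norm]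
          have : ((1:ℝ) / 2) ^ (i + j) ≤ (1 / 2) ^ i :=
            pow_le_pow_of_le_one (by norm_num) (by norm_num) (by omega)
          linarith [not_le.1 hy]
        simp only [f.one_of_mem_closedBall h1, one_mul]
    simp_rw [hcongr]
    have hx2 : Filter.Tendsto (fun m => cv (K.ri (i + m)) U x) Filter.atTop (𝓝 (U x)) :=
      (Filter.tendsto_add_atTop_iff_nat i (f := fun m => cv (K.ri m) U x)).2 hx |>.congr fun m => by rw [add_comm]
    have hsm : Summable fun j => cv (K.ei (i + j)) F x := by
      obtain ⟨C, hC⟩ := hFc.exists_bound_of_continuous hF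
      have hC0 : 0 ≤ C := (norm_nonneg _).trans (hC 0)
      have hs := (summable_geometric_of_lt_one (r := (1/2:ℝ)) (by norm_num) (by norm_num)).mul_left
        (‖ContinuousLinearMap.mul ℝ ℝ‖ * C * (∫ y, ‖K.e y‖))
      refine Summable.of_norm_bounded hs fun j => ?_
      rw [cv_eq_conv]
      refine (norm_conv_le _ hC0 hC ((K.ei_smooth _).continuous.integrable_of_hasCompactSupport (K.ei_compact _)) x).trans ?_
      rw [mul_assoc (_ * C)]
      have h0 : 0 ≤ ∫ y, ‖K.e y‖ := integral_nonneg fun y => norm_nonneg _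
      gcongr
      refine (K.int_ei hn _).trans ?_
      gcongr ?_ * ?_
      exact pow_le_pow_of_le_one (by norm_num) (by norm_num) (by omega)
    refine tendsto_nhds_unique hx2 ?_
    refine (hsm.hasSum.tendsto_sum_nat.const_add (cv (K.ri i) U x)).congr fun m => ?_
    rw [K.steps hn hU.locallyIntegrable h hsub m]
  have hcont : Continuous fun x => cv (K.ri i) U x + ∑' j, cv (K.ei (i + j)) (fun y => f y * F y) x :=
    (cv_continuous (K.ri_smooth _).continuous (K.ri_compact _) hU.locallyIntegrable).add
      (K.series_C1 hn i hG (hFc.mul_left)).1.continuous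
  have h1 := le_of_ae_le (Metric.isOpen_ball (x := x0) (ε := ε / 8)) (hU.sub hcont).continuousOn (w := 0)
    (by filter_upwards [hae] with x hx hxb; have := hx hxb; simp only [Pi.sub_apply]; linarith)
  have h2 := le_of_ae_le (Metric.isOpen_ball (x := x0) (ε := ε / 8)) (hcont.sub hU).continuousOn (w := 0)
    (by filter_upwards [hae] with x hx hxb; have := hx hxb; simp only [Pi.sub_apply]; linarith)
  filter_upwards [Metric.ball_mem_nhds x0 (show 0 < ε / 8 by positivity)] with x hx
  have := h1 x hx
  have := h2 x hx
  simp only [Pi.sub_apply] at *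
  linarith

end Ker

lemma Test.mul_contDiff {n : ℕ} {Ω : Set (Euc n)} (hO : IsOpen Ω) {χ : Euc n → ℝ} (hχ : Test Ω χ) {F : Euc n → ℝ} {k : ℕ∞}
    (hF : ContDiffOn ℝ k F Ω) : ContDiff ℝ k (fun x => χ x * F x) := by
  rw [contDiff_iff_contDiffAt]
  intro x
  by_cases hx : x ∈ Ω
  · exact (hχ.smooth.contDiffAt.of_le (by norm_cast; exact le_top)).mul (hF.contDiffAt (hO.mem_nhds hx))
  · have : x ∉ tsupport χ := fun h => hx (hχ.supp h)
    refine (contDiffAt_const (c := 0)).congr_of_eventuallyEq ?_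
    filter_upwards [(isClosed_tsupport χ).isOpen_compl.mem_nhds this] with y hy
    rw [image_eq_zero_of_notMem_tsupport hy, zero_mul]

theorem reg_C1 {n : ℕ} (hn : 2 ≤ n) {Ω : Set (Euc n)} (hO : IsOpen Ω) {U F : Euc n → ℝ} (hU : Continuous U)
    (hF : Continuous F) (hFc : HasCompactSupport F) (h : WeakEq Ω U F) :
    ContDiffOn ℝ 1 U Ω ∧ (ContDiffOn ℝ 1 F Ω → ContDiffOn ℝ 2 U Ω) := by
  obtain ⟨K⟩ := Ker.nonempty (n := n) hn
  constructor
  · intro x hx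
    obtain ⟨i, χ, hχ, he⟩ := K.local_rep hn hO hU hF hFc h hx
    refine ContDiffAt.contDiffWithinAt (ContDiffAt.congr_of_eventuallyEq ?_ he)
    refine ContDiffAt.add ?_ (K.series_C1 hn i (hχ.smooth.continuous.mul hF) hFc.mul_left).1.contDiffAt
    rw [cv_eq_conv]
    exact ((K.ri_compact _).contDiff_convolution_right _ hU.locallyIntegrable
      ((K.ri_smooth _).of_le (by norm_cast))).contDiffAt
  · intro hF1 x hx
    obtain ⟨i, χ, hχ, he⟩ := K.local_rep hn hO hU hF hFc h hx
    refine ContDiffAt.contDiffWithinAt (ContDiffAt.congr_of_eventuallyEq ?_ he)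
    refine ContDiffAt.add ?_ ((K.series_C1 hn i (hχ.smooth.continuous.mul hF) hFc.mul_left).2 ?_).contDiffAt
    · rw [cv_eq_conv]
      exact ((K.ri_compact _).contDiff_convolution_right _ hU.locallyIntegrable
        ((K.ri_smooth _).of_le (by norm_cast))).contDiffAt
    · exact hχ.mul_contDiff hO (k := 1) hF1
end

noncomputable section
open Real MeasureTheory Finset
open scoped ContDiff Topology

lemma cont_mul {n : ℕ} {Ω : Set (Euc n)} (hO : IsOpen Ω) {h ψ : Euc n → ℝ} (hh : ContinuousOn h Ω)
    (hψ : Continuous ψ) (hs : tsupport ψ ⊆ Ω) : Continuous (fun x => h x * ψ x) := by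
  rw [continuous_iff_continuousAt]
  intro x
  by_cases hx : x ∈ Ω
  · exact (hh.continuousAt (hO.mem_nhds hx)).mul hψ.continuousAt
  · have : x ∉ tsupport ψ := fun h => hx (hs h)
    refine (continuousAt_const (y := (0:ℝ))).congr ?_
    filter_upwards [(isClosed_tsupport ψ).isOpen_compl.mem_nhds this] with y hy
    rw [image_eq_zero_of_notMem_tsupport hy, mul_zero]

lemma Test.fder {n : ℕ} {Ω : Set (Euc n)} {φ : Euc n → ℝ} (hφ : Test Ω φ) (v : Euc n) :
    Test Ω (fun x => fderiv ℝ φ x v) := by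
  refine ⟨hφ.smooth.fderiv_right (m := ∞) (by norm_cast) |>.clm_apply contDiff_const, hφ.compact.fderiv_apply ℝ v, ?_⟩
  exact (tsupport_fderiv_apply_subset ℝ v).trans hφ.supp

lemma ibp_test {n : ℕ} {Ω : Set (Euc n)} (hO : IsOpen Ω) {f φ : Euc n → ℝ} (hf : ContDiffOn ℝ 1 f Ω)
    (hφ : Test Ω φ) (v : Euc n) :
    ∫ x, f x * fderiv ℝ φ x v = - ∫ x, fderiv ℝ f x v * φ x := by
  have hv := hφ.fder v
  have h1 : ContinuousOn (fun x => fderiv ℝ f x v) Ω :=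
    (hf.continuousOn_fderiv_of_isOpen hO le_rfl).clm_apply continuousOn_const
  refine integral_mul_fderiv_eq_neg_fderiv_mul_of_integrable ?_ ?_ ?_ ?_ ?_
  · exact (cont_mul hO h1 hφ.smooth.continuous hφ.supp).integrable_of_hasCompactSupport hφ.compact.mul_left
  · exact (cont_mul hO hf.continuousOn hv.smooth.continuous hv.supp).integrable_of_hasCompactSupport hv.compact.mul_left
  · exact (cont_mul hO hf.continuousOn hφ.smooth.continuous hφ.supp).integrable_of_hasCompactSupport hφ.compact.mul_left
  · intro x hx
    exact (hf.contDiffAt (hO.mem_nhds (hφ.supp hx))).differentiableAt one_ne_zero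
  · intro x _
    exact (hφ.smooth.differentiable (by simp)).differentiableAt

lemma Test.lap_test {n : ℕ} {Ω : Set (Euc n)} {φ : Euc n → ℝ} (hφ : Test Ω φ) (v : Euc n) :
    Test Ω (fun x => fderiv ℝ (fun y => fderiv ℝ φ y v) x v) := (hφ.fder v).fder v

lemma Test.lap_cont {n : ℕ} {Ω : Set (Euc n)} {φ : Euc n → ℝ} (hφ : Test Ω φ) : Continuous (lap φ) :=
  continuous_finset_sum _ fun _ _ => (hφ.lap_test _).smooth.continuous

lemma Test.lap_compact {n : ℕ} {Ω : Set (Euc n)} {φ : Euc n → ℝ} (hφ : Test Ω φ) :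
    HasCompactSupport (lap φ) := by
  refine HasCompactSupport.intro hφ.compact fun x hx => ?_
  unfold lap
  refine Finset.sum_eq_zero fun i _ => ?_
  have : x ∉ tsupport (fun x => fderiv ℝ (fun y => fderiv ℝ φ y (EuclideanSpace.single i 1)) x
    (EuclideanSpace.single i 1)) := fun h => hx (tsupport_fderiv_apply_subset ℝ _ (tsupport_fderiv_apply_subset ℝ _ h))
  exact image_eq_zero_of_notMem_tsupport (f := fun x => fderiv ℝ (fun y => fderiv ℝ φ y (EuclideanSpace.single i 1)) x
    (EuclideanSpace.single i 1)) this

lemma Test.mono {n : ℕ} {Ω Ω' : Set (Euc n)} {φ : Euc n → ℝ} (hφ : Test Ω φ) (h : Ω ⊆ Ω') : Test Ω' φ :=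
  ⟨hφ.smooth, hφ.compact, hφ.supp.trans h⟩

/-- Pointwise equation from the weak equation. -/
theorem pde_of_weak {n : ℕ} {Ω : Set (Euc n)} (hO : IsOpen Ω) {U F : Euc n → ℝ} (hU : ContDiffOn ℝ 2 U Ω)
    (hF : Continuous F) (h : WeakEq Ω U F) : ∀ x ∈ Ω, -(lap U x) = F x := by
  have hd : ∀ v : Euc n, ContDiffOn ℝ 1 (fun x => fderiv ℝ U x v) Ω := fun v =>
    (hU.fderiv_of_isOpen hO (m := 1) (by norm_num)).clm_apply contDiffOn_const
  have hdd : ∀ v : Euc n, ContinuousOn (fun x => fderiv ℝ (fun y => fderiv ℝ U y v) x v) Ω := fun v =>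
    ((hd v).continuousOn_fderiv_of_isOpen hO le_rfl).clm_apply continuousOn_const
  have hlap : ContinuousOn (fun x => lap U x + F x) Ω :=
    (continuousOn_finset_sum _ fun i _ => hdd _).add hF.continuousOn
  have key : ∀ φ, Test Ω φ → ∫ x, U x * lap φ x = ∫ x, lap U x * φ x := by
    intro φ hφ
    unfold lap
    simp_rw [Finset.mul_sum, Finset.sum_mul]
    rw [integral_finset_sum, integral_finset_sum]
    · refine Finset.sum_congr rfl fun i _ => ?_
      rw [ibp_test hO (hU.of_le (by norm_num)) (hφ.fder _),
        ibp_test hO (hd (EuclideanSpace.single i 1)) hφ (EuclideanSpace.single i 1)]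
      simp
    · intro i _
      exact (cont_mul hO (hdd _) hφ.smooth.continuous hφ.supp).integrable_of_hasCompactSupport hφ.compact.mul_left
    · intro i _
      have := hφ.lap_test (EuclideanSpace.single i 1)
      exact (cont_mul hO hU.continuousOn this.smooth.continuous this.supp).integrable_of_hasCompactSupport this.compact.mul_left
  have hz : ∀ᵐ x, x ∈ Ω → lap U x + F x = 0 := by
    refine hO.ae_eq_zero_of_integral_contDiff_smul_eq_zero (hlap.locallyIntegrableOn hO.measurableSet) ?_
    intro φ h1 h2 h3
    have hφ : Test Ω φ := ⟨h1, h2, h3⟩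
    have e1 := h φ hφ
    rw [key φ hφ] at e1
    simp only [smul_eq_mul, mul_add]
    have hc : Continuous fun x => lap U x * φ x :=
      cont_mul hO (continuousOn_finset_sum _ fun i _ => hdd _) hφ.smooth.continuous hφ.supp
    have e2 : ∫ x, (φ x * lap U x + φ x * F x) = (∫ x, lap U x * φ x) + ∫ x, F x * φ x := by
      rw [← integral_add]
      · congr 1; ext x; ring
      · exact hc.integrable_of_hasCompactSupport hφ.compact.mul_left
      · exact (hF.mul hφ.smooth.continuous).integrable_of_hasCompactSupport hφ.compact.mul_left
    rw [e2, ← e1]; ring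
  intro x hx
  have h1 := le_of_ae_le hO hlap (w := 0) (by filter_upwards [hz] with y hy hy2; exact (hy hy2).le) x hx
  have h2 := le_of_ae_le hO hlap.neg (w := 0) (by filter_upwards [hz] with y hy hy2; simp [hy hy2]) x hx
  simp only [Pi.neg_apply] at h2
  linarith

lemma inner_gradient {n : ℕ} (f : Euc n → ℝ) (x v : Euc n) : inner ℝ (gradient f x) v = fderiv ℝ f x v := by
  unfold gradient; simp

lemma gradient_coord {n : ℕ} (f : Euc n → ℝ) (x : Euc n) (i : Fin n) :
    gradient f x i = fderiv ℝ f x (EuclideanSpace.single i 1) := by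
  rw [← inner_gradient, EuclideanSpace.inner_single_right]; simp

lemma norm_gradient {n : ℕ} (f : Euc n → ℝ) (x : Euc n) : ‖gradient f x‖ = ‖fderiv ℝ f x‖ := by
  unfold gradient; simp

lemma green {n : ℕ} {f φ : Euc n → ℝ} (hf : ContDiff ℝ 1 f) (hφ : Test Set.univ φ) :
    ∫ x, inner ℝ (gradient f x) (gradient φ x) = -∫ x, f x * lap φ x := by
  have e1 : ∀ x, inner ℝ (gradient f x) (gradient φ x) = ∑ i : Fin n,
      fderiv ℝ f x (EuclideanSpace.single i 1) * fderiv ℝ φ x (EuclideanSpace.single i 1) := by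
    intro x
    rw [PiLp.inner_apply]
    refine Finset.sum_congr rfl fun i _ => ?_
    rw [gradient_coord, gradient_coord]; simp [mul_comm]
  have hc : ∀ v : Euc n, Continuous fun x => fderiv ℝ f x v := fun v =>
    (hf.continuous_fderiv one_ne_zero).clm_apply continuous_const
  simp_rw [e1]
  unfold lap
  simp_rw [Finset.mul_sum]
  rw [integral_finset_sum, integral_finset_sum, ← Finset.sum_neg_distrib]
  · refine Finset.sum_congr rfl fun i _ => ?_
    rw [ibp_test isOpen_univ hf.contDiffOn (hφ.fder _)]; simp
  · intro i _
    have := hφ.lap_test (EuclideanSpace.single i 1)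
    exact (hf.continuous.mul this.smooth.continuous).integrable_of_hasCompactSupport this.compact.mul_left
  · intro i _
    have := hφ.fder (EuclideanSpace.single i 1)
    exact ((hc _).mul this.smooth.continuous).integrable_of_hasCompactSupport this.compact.mul_left

lemma gradient_contDiff {n : ℕ} {f : Euc n → ℝ} (hf : ContDiff ℝ 1 f) : Continuous (gradient f) := by
  unfold gradient
  exact (InnerProductSpace.toDual ℝ (Euc n)).symm.continuous.comp (hf.continuous_fderiv one_ne_zero)

lemma gradient_compact {n : ℕ} {f : Euc n → ℝ} (hf : HasCompactSupport f) : HasCompactSupport (gradient f) := by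
  unfold gradient
  exact (hf.fderiv ℝ).comp_left (g := (InnerProductSpace.toDual ℝ (Euc n)).symm) (by simp)

lemma Test.cd1 {n : ℕ} {Ω : Set (Euc n)} {φ : Euc n → ℝ} (hφ : Test Ω φ) : ContDiff ℝ 1 φ :=
  hφ.smooth.of_le (by norm_cast)

lemma Test.memLp {n : ℕ} {Ω : Set (Euc n)} {φ : Euc n → ℝ} (hφ : Test Ω φ) (p : ENNReal) : MemLp φ p :=
  hφ.smooth.continuous.memLp_of_hasCompactSupport hφ.compact

lemma Test.memLp_grad {n : ℕ} {Ω : Set (Euc n)} {φ : Euc n → ℝ} (hφ : Test Ω φ) (p : ENNReal) :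
    MemLp (gradient φ) p :=
  (gradient_contDiff hφ.cd1).memLp_of_hasCompactSupport (gradient_compact hφ.compact)

end

noncomputable section
open Real MeasureTheory Finset
open scoped ContDiff Topology

section cs
variable {α : Type*} [MeasurableSpace α] {μ : Measure α} {E : Type*} [NormedAddCommGroup E] [InnerProductSpace ℝ E]

lemma int_inner_integrable {f g : α → E} (hf : MemLp f 2 μ) (hg : MemLp g 2 μ) :
    Integrable (fun x => (inner ℝ (f x) (g x) : ℝ)) μ := by
  have h := hf.norm.integrable_mul hg.norm
  refine h.mono (hf.1.inner hg.1) ?_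
  filter_upwards with x
  simpa using abs_real_inner_le_norm (f x) (g x)

lemma cs_inner {f g : α → E} (hf : MemLp f 2 μ) (hg : MemLp g 2 μ) :
    |∫ x, (inner ℝ (f x) (g x) : ℝ) ∂μ| ≤ √(∫ x, ‖f x‖ ^ 2 ∂μ) * √(∫ x, ‖g x‖ ^ 2 ∂μ) := by
  have h := hf.norm.integrable_mul hg.norm
  calc |∫ x, (inner ℝ (f x) (g x) : ℝ) ∂μ| ≤ ∫ x, |(inner ℝ (f x) (g x) : ℝ)| ∂μ := abs_integral_le_integral_abs
    _ ≤ ∫ x, ‖f x‖ * ‖g x‖ ∂μ := integral_mono (int_inner_integrable hf hg).abs h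
        fun x => abs_real_inner_le_norm (f x) (g x)
    _ ≤ |∫ x, ‖f x‖ * ‖g x‖ ∂μ| := le_abs_self _
    _ ≤ _ := cs_int hf.norm hg.norm

lemma tendsto_inner {f g : α → E} {fk : ℕ → α → E} (hf : MemLp f 2 μ) (hfk : ∀ k, MemLp (fk k) 2 μ)
    (hg : MemLp g 2 μ) (h : Filter.Tendsto (fun k => ∫ x, ‖f x - fk k x‖ ^ 2 ∂μ) Filter.atTop (𝓝 0)) :
    Filter.Tendsto (fun k => ∫ x, (inner ℝ (fk k x) (g x) : ℝ) ∂μ) Filter.atTop (𝓝 (∫ x, (inner ℝ (f x) (g x) : ℝ) ∂μ)) := by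
  rw [tendsto_iff_norm_sub_tendsto_zero]
  have h2 : Filter.Tendsto (fun k => √(∫ x, ‖f x - fk k x‖ ^ 2 ∂μ) * √(∫ x, ‖g x‖ ^ 2 ∂μ)) Filter.atTop (𝓝 0) := by
    have := (h.sqrt).mul_const (√(∫ x, ‖g x‖ ^ 2 ∂μ))
    simpa using this
  refine squeeze_zero (fun _ => norm_nonneg _) (fun k => ?_) h2
  rw [← integral_sub (int_inner_integrable (hfk k) hg) (int_inner_integrable hf hg), norm_eq_abs]
  have := cs_inner (hf.sub (hfk k)) hg
  simp only [Pi.sub_apply] at this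
  refine le_trans (le_of_eq ?_) this
  rw [← abs_neg, ← integral_neg]
  congr 2; ext x; rw [inner_sub_left]; ring

end cs

theorem weak_of_limit {n : ℕ} {Ω : Set (Euc n)} {u F : Euc n → ℝ} {g : Euc n → Euc n} (hu : MemLp u 2) (hg : MemLp g 2)
    {uk : ℕ → Euc n → ℝ} (huk : ∀ k, Test Ω (uk k))
    (h1 : Filter.Tendsto (fun k => ∫ x, ‖u x - uk k x‖ ^ 2) Filter.atTop (𝓝 0))
    (h2 : Filter.Tendsto (fun k => ∫ x, ‖g x - gradient (uk k) x‖ ^ 2) Filter.atTop (𝓝 0)) {φ : Euc n → ℝ}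
    (hφ : Test Set.univ φ) : ∫ x, inner ℝ (g x) (gradient φ x) = - ∫ x, u x * lap φ x := by
  have hl : MemLp (lap φ) 2 := hφ.lap_cont.memLp_of_hasCompactSupport hφ.lap_compact
  have e1 := tendsto_inner hu (fun k => (huk k).memLp 2) hl h1
  have e2 := tendsto_inner hg (fun k => (huk k).memLp_grad 2) (hφ.memLp_grad 2) h2
  refine tendsto_nhds_unique e2 ?_
  simp only [green (huk _).cd1 hφ]
  have := e1.neg
  simpa [mul_comm] using this

/-- regularised absolute value -/
def Sreg (ε t : ℝ) : ℝ := √(t ^ 2 + ε ^ 2) - ε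
def Greg (ε t : ℝ) : ℝ := t / √(t ^ 2 + ε ^ 2)
def Greg' (ε t : ℝ) : ℝ := (√(t ^ 2 + ε ^ 2) - t * Greg ε t) / √(t ^ 2 + ε ^ 2) ^ 2

section reg

lemma reg_pos {ε : ℝ} (hε : 0 < ε) (t : ℝ) : 0 < √(t ^ 2 + ε ^ 2) := Real.sqrt_pos.2 (by positivity)
lemma reg_ge {ε : ℝ} (hε : 0 < ε) (t : ℝ) : ε ≤ √(t ^ 2 + ε ^ 2) := Real.le_sqrt_of_sq_le (by nlinarith [sq_nonneg t])
lemma reg_abs {ε : ℝ} (hε : 0 < ε) (t : ℝ) : |t| ≤ √(t ^ 2 + ε ^ 2) := Real.abs_le_sqrt (by nlinarith [sq_nonneg ε])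
lemma reg_sq {ε : ℝ} (hε : 0 < ε) (t : ℝ) : √(t ^ 2 + ε ^ 2) ^ 2 = t ^ 2 + ε ^ 2 := Real.sq_sqrt (by positivity)
lemma reg_le {ε : ℝ} (hε : 0 < ε) (t : ℝ) : √(t ^ 2 + ε ^ 2) ≤ |t| + ε := by
  rw [Real.sqrt_le_left (by positivity)]
  nlinarith [sq_abs t, abs_nonneg t]

lemma reg_hasDeriv0 {ε : ℝ} (hε : 0 < ε) (t : ℝ) : HasDerivAt (fun t : ℝ => √(t ^ 2 + ε ^ 2)) (Greg ε t) t := by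
  have h : HasDerivAt (fun t : ℝ => t ^ 2 + ε ^ 2) (2 * t) t := by
    simpa using (hasDerivAt_pow 2 t).add_const (ε ^ 2)
  have := h.sqrt (by positivity)
  convert this using 1
  unfold Greg
  have := reg_pos hε t
  field_simp

lemma Sreg_deriv {ε : ℝ} (hε : 0 < ε) (t : ℝ) : HasDerivAt (Sreg ε) (Greg ε t) t := (reg_hasDeriv0 hε t).sub_const ε

lemma Greg_deriv {ε : ℝ} (hε : 0 < ε) (t : ℝ) : HasDerivAt (Greg ε) (Greg' ε t) t := by
  have := (hasDerivAt_id t).div (reg_hasDeriv0 hε t) (reg_pos hε t).ne'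
  have e : Greg' ε t = (1 * √(t ^ 2 + ε ^ 2) - id t * Greg ε t) / √(t ^ 2 + ε ^ 2) ^ 2 := by
    unfold Greg'; rw [one_mul]; rfl
  rw [e]
  exact this

lemma Greg_smooth {ε : ℝ} (hε : 0 < ε) : ContDiff ℝ ∞ (Greg ε) := by
  unfold Greg
  refine contDiff_id.div (ContDiff.sqrt (by fun_prop) fun t => by positivity) fun t => (reg_pos hε t).ne'

lemma Sreg_smooth {ε : ℝ} (hε : 0 < ε) : ContDiff ℝ ∞ (Sreg ε) := by
  unfold Sreg
  exact (ContDiff.sqrt (by fun_prop) fun t => by positivity).sub contDiff_const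

lemma Greg_abs {ε : ℝ} (hε : 0 < ε) (t : ℝ) : |Greg ε t| ≤ 1 := by
  unfold Greg
  rw [abs_div, abs_of_pos (reg_pos hε t)]
  exact div_le_one_of_le₀ (reg_abs hε t) (reg_pos hε t).le

lemma Greg'_nonneg {ε : ℝ} (hε : 0 < ε) (t : ℝ) : 0 ≤ Greg' ε t := by
  unfold Greg'
  refine div_nonneg ?_ (by positivity)
  have h1 := Greg_abs hε t
  have h2 := reg_abs hε t
  have : t * Greg ε t ≤ |t| * 1 := (le_abs_self _).trans (by rw [abs_mul]; gcongr)
  linarith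

lemma Greg'_le {ε : ℝ} (hε : 0 < ε) (t : ℝ) : Greg' ε t ≤ 1 / ε := by
  unfold Greg'
  have h0 := reg_pos hε t
  have h1 := reg_ge hε t
  have h2 : 0 ≤ t * Greg ε t := by unfold Greg; rw [← mul_div_assoc, ← sq]; positivity
  calc _ ≤ √(t ^ 2 + ε ^ 2) / √(t ^ 2 + ε ^ 2) ^ 2 := by gcongr; linarith
    _ = 1 / √(t ^ 2 + ε ^ 2) := by field_simp
    _ ≤ _ := by gcongr

lemma Sreg_close {ε : ℝ} (hε : 0 < ε) (t s : ℝ) : |(|t| - Sreg ε s)| ≤ |t - s| + ε := by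
  have h1 := reg_le hε s
  have h2 := reg_abs hε s
  have h3 := abs_abs_sub_abs_le_abs_sub t s
  unfold Sreg
  have h4 := abs_le.1 h3
  rw [abs_le]
  constructor <;> linarith [h4.1, h4.2]

end reg

set_option maxHeartbeats 1000000 in
theorem kato {n : ℕ} {Ω : Set (Euc n)} {u F : Euc n → ℝ} {g : Euc n → Euc n} (hu : MemLp u 2) (hg : MemLp g 2)
    (hF : MemLp F 2) {uk : ℕ → Euc n → ℝ} (huk : ∀ k, Test Ω (uk k))
    (h1 : Filter.Tendsto (fun k => ∫ x, ‖u x - uk k x‖ ^ 2) Filter.atTop (𝓝 0))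
    (h2 : Filter.Tendsto (fun k => ∫ x, ‖g x - gradient (uk k) x‖ ^ 2) Filter.atTop (𝓝 0))
    (hEL : ∀ ψ, Test Ω ψ → ∫ x, inner ℝ (g x) (gradient ψ x) = ∫ x, F x * ψ x) :
    SubEq (fun x => |u x|) (fun x => |F x|) := by
  intro φ hφ hφ0
  have hl : MemLp (lap φ) 2 := hφ.lap_cont.memLp_of_hasCompactSupport hφ.lap_compact
  obtain ⟨M, hM⟩ : ∃ M, ∀ x, φ x ≤ M := by
    obtain ⟨M, hM⟩ := hφ.smooth.continuous.bounded_above_of_compact_support hφ.compact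
    exact ⟨M, fun x => (le_abs_self _).trans (hM x)⟩
  have hM0 : 0 ≤ M := (hφ0 0).trans (hM 0)
  set a : ℕ → ℝ := fun k => ∫ x, ‖u x - uk k x‖ ^ 2 with ha
  set b : ℕ → ℝ := fun k => ∫ x, ‖g x - gradient (uk k) x‖ ^ 2 with hb
  set A := √(∫ x, ‖lap φ x‖ ^ 2)
  set Bc := ∫ x, |lap φ x|
  have main : ∀ ε : ℝ, 0 < ε → ∀ k, -∫ x, |u x| * lap φ x ≤ (∫ x, |F x| * φ x) + ε * Bc + √(a k) * A +
      √(b k) * √(2 * (∫ x, ‖gradient φ x‖ ^ 2) + 2 * (M / ε) ^ 2 * (2 * (∫ x, ‖g x‖ ^ 2) + 2 * b k)) := by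
    intro ε hε k
    have hk := huk k
    have hgk := hk.memLp_grad 2
    have hgφ := hφ.memLp_grad 2
    -- the function f
    set f := fun x => Sreg ε (uk k x) with hf
    have hf1 : ContDiff ℝ 1 f := ((Sreg_smooth hε).comp hk.smooth).of_le (by norm_cast)
    set ψ := fun x => φ x * Greg ε (uk k x) with hψ
    have hψT : Test Ω ψ := by
      refine ⟨hφ.smooth.mul ((Greg_smooth hε).comp hk.smooth), hφ.compact.mul_right, ?_⟩
      refine (closure_mono ?_).trans hk.supp
      intro x hx hx0
      exact hx (by simp [hψ, hx0, Greg])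
    have hdk : ∀ x, DifferentiableAt ℝ (uk k) x := fun x => (hk.smooth.differentiable (by simp)) x
    have hdφ : ∀ x, DifferentiableAt ℝ φ x := fun x => (hφ.smooth.differentiable (by simp)) x
    have gf : ∀ x, gradient f x = Greg ε (uk k x) • gradient (uk k) x := by
      intro x
      have : HasFDerivAt f (Greg ε (uk k x) • fderiv ℝ (uk k) x) x :=
        (Sreg_deriv hε (uk k x)).comp_hasFDerivAt x (hdk x).hasFDerivAt
      unfold gradient; rw [this.fderiv]; simp
    have gψ : ∀ x, gradient ψ x = Greg ε (uk k x) • gradient φ x + (φ x * Greg' ε (uk k x)) • gradient (uk k) x := by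
      intro x
      have h0 : HasFDerivAt (fun x => Greg ε (uk k x)) (Greg' ε (uk k x) • fderiv ℝ (uk k) x) x :=
        (Greg_deriv hε (uk k x)).comp_hasFDerivAt x (hdk x).hasFDerivAt
      have : HasFDerivAt ψ _ x := (hdφ x).hasFDerivAt.mul h0
      unfold gradient; rw [this.fderiv, map_add, map_smul, map_smul, map_smul, smul_smul, add_comm]
    have p1 : ∀ x, inner ℝ (gradient f x) (gradient φ x) ≤ inner ℝ (gradient (uk k) x) (gradient ψ x) := by
      intro x
      rw [gf, gψ, inner_add_right, inner_smul_left, inner_smul_right, inner_smul_right, real_inner_self_eq_norm_sq]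
      have := mul_nonneg (hφ0 x) (Greg'_nonneg hε (uk k x))
      have := mul_nonneg this (sq_nonneg ‖gradient (uk k) x‖)
      simp only [conj_trivial]; linarith
    have hgψ := hψT.memLp_grad 2
    have hgf : MemLp (gradient f) 2 := by
      have : gradient f = fun x => Greg ε (uk k x) • gradient (uk k) x := funext gf
      rw [this]
      have hc : HasCompactSupport ((fun x => Greg ε (uk k x)) • gradient (uk k)) := (gradient_compact hk.compact).smul_left
      have hc2 : Continuous ((fun x => Greg ε (uk k x)) • gradient (uk k)) :=
        ((Greg_smooth hε).continuous.comp hk.smooth.continuous).smul (gradient_contDiff hk.cd1)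
      exact hc2.memLp_of_hasCompactSupport hc
    have e1 : -∫ x, f x * lap φ x ≤ ∫ x, inner ℝ (gradient (uk k) x) (gradient ψ x) := by
      rw [← green hf1 hφ]
      exact integral_mono (int_inner_integrable hgf hgφ) (int_inner_integrable hgk hgψ) p1
    have e2 : ∫ x, inner ℝ (gradient (uk k) x) (gradient ψ x) =
        (∫ x, F x * ψ x) - ∫ x, inner ℝ (g x - gradient (uk k) x) (gradient ψ x) := by
      rw [← hEL ψ hψT]
      simp_rw [inner_sub_left]
      rw [integral_sub (int_inner_integrable hg hgψ) (int_inner_integrable hgk hgψ)]; ring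
    have e3 : ∫ x, F x * ψ x ≤ ∫ x, |F x| * φ x := by
      refine integral_mono (hF.integrable_mul (hψT.memLp 2)) (hF.abs.integrable_mul (hφ.memLp 2)) fun x => ?_
      refine (le_abs_self _).trans ?_
      simp only [hψ, abs_mul, abs_of_nonneg (hφ0 x)]
      have := Greg_abs hε (uk k x)
      have h5 := hφ0 x
      calc |F x| * (φ x * |Greg ε (uk k x)|) ≤ |F x| * (φ x * 1) := by gcongr
        _ = _ := by ring
    have i1 : Integrable (fun x => ‖gradient φ x‖ ^ 2) := hgφ.integrable_norm_pow (p := 2) (by norm_num)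
    have i2 : Integrable (fun x => ‖gradient (uk k) x‖ ^ 2) := hgk.integrable_norm_pow (p := 2) (by norm_num)
    have i3 : Integrable (fun x => ‖g x‖ ^ 2) := hg.integrable_norm_pow (p := 2) (by norm_num)
    have i4 : Integrable (fun x => ‖g x - gradient (uk k) x‖ ^ 2) := (hg.sub hgk).integrable_norm_pow (p := 2) (by norm_num)
    have i5 : Integrable (fun x => ‖gradient ψ x‖ ^ 2) := hgψ.integrable_norm_pow (p := 2) (by norm_num)
    have e4 : ∫ x, ‖gradient (uk k) x‖ ^ 2 ≤ 2 * (∫ x, ‖g x‖ ^ 2) + 2 * b k := by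
      rw [hb, ← integral_const_mul, ← integral_const_mul, ← integral_add (i3.const_mul _) (i4.const_mul _)]
      refine integral_mono i2 ((i3.const_mul _).add (i4.const_mul _)) fun x => ?_
      have : ‖gradient (uk k) x‖ ≤ ‖g x‖ + ‖g x - gradient (uk k) x‖ := by
        have := norm_sub_le (g x) (g x - gradient (uk k) x); simpa using this
      simp only
      nlinarith [norm_nonneg (gradient (uk k) x), sq_nonneg (‖g x‖ - ‖g x - gradient (uk k) x‖), norm_nonneg (g x), norm_nonneg (g x - gradient (uk k) x)]
    have e5 : ∫ x, ‖gradient ψ x‖ ^ 2 ≤ 2 * (∫ x, ‖gradient φ x‖ ^ 2) + 2 * (M / ε) ^ 2 * ∫ x, ‖gradient (uk k) x‖ ^ 2 := by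
      rw [← integral_const_mul, ← integral_const_mul, ← integral_add (i1.const_mul _) (i2.const_mul _)]
      refine integral_mono i5 ((i1.const_mul _).add (i2.const_mul _)) fun x => ?_
      have q1 : ‖gradient ψ x‖ ≤ ‖gradient φ x‖ + M / ε * ‖gradient (uk k) x‖ := by
        rw [gψ]
        refine (norm_add_le _ _).trans ?_
        rw [norm_smul, norm_smul, norm_eq_abs, norm_eq_abs]
        refine add_le_add (mul_le_of_le_one_left (norm_nonneg _) (Greg_abs hε _)) ?_
        refine mul_le_mul_of_nonneg_right ?_ (norm_nonneg _)
        rw [abs_of_nonneg (mul_nonneg (hφ0 x) (Greg'_nonneg hε _))]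
        calc _ ≤ M * (1 / ε) := mul_le_mul (hM x) (Greg'_le hε _) (Greg'_nonneg hε _) hM0
          _ = _ := by ring
      simp only
      nlinarith [norm_nonneg (gradient ψ x), sq_nonneg (‖gradient φ x‖ - M / ε * ‖gradient (uk k) x‖), norm_nonneg (gradient φ x), mul_nonneg (div_nonneg hM0 hε.le) (norm_nonneg (gradient (uk k) x))]
    have e6 := cs_inner (hg.sub hgk) hgψ
    simp only [Pi.sub_apply] at e6
    have e7 : √(∫ x, ‖gradient ψ x‖ ^ 2) ≤ √(2 * (∫ x, ‖gradient φ x‖ ^ 2) + 2 * (M / ε) ^ 2 * (2 * (∫ x, ‖g x‖ ^ 2) + 2 * b k)) := by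
      apply Real.sqrt_le_sqrt
      refine e5.trans ?_
      gcongr
    have e8 : √(b k) * √(∫ x, ‖gradient ψ x‖ ^ 2) ≤ √(b k) * √(2 * (∫ x, ‖gradient φ x‖ ^ 2) + 2 * (M / ε) ^ 2 * (2 * (∫ x, ‖g x‖ ^ 2) + 2 * b k)) := by gcongr
    -- comparison of |u| and f
    have j1 : Integrable (fun x => |u x| * lap φ x) := hu.abs.integrable_mul hl
    have j1' : Integrable (fun x => -(|u x| * lap φ x)) := j1.neg
    have j2 : Integrable (fun x => f x * lap φ x) :=
      (hf1.continuous.mul hφ.lap_cont).integrable_of_hasCompactSupport hφ.lap_compact.mul_left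
    have j3 : Integrable (fun x => |lap φ x|) := (hφ.lap_cont.integrable_of_hasCompactSupport hφ.lap_compact).abs
    have j4 : Integrable (fun x => |u x - uk k x| * |lap φ x|) := (hu.sub (hk.memLp 2)).abs.integrable_mul hl.abs
    have e9 : -(∫ x, |u x| * lap φ x) + ∫ x, f x * lap φ x ≤ ε * Bc + √(a k) * A := by
      have c1 := cs_int (hu.sub (hk.memLp 2)).abs hl.abs
      have c2 : ∫ x, |u x - uk k x| * |lap φ x| ≤ √(a k) * A := by
        exact (le_abs_self _).trans c1
      have c3 : -(∫ x, |u x| * lap φ x) + ∫ x, f x * lap φ x ≤ (∫ x, |u x - uk k x| * |lap φ x|) + ε * Bc := by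
        rw [← integral_const_mul, ← integral_neg, ← integral_add j1' j2, ← integral_add j4 (j3.const_mul _)]
        refine integral_mono (j1'.add j2) (j4.add (j3.const_mul _)) fun x => ?_
        have := Sreg_close hε (u x) (uk k x)
        calc _ = -((|u x| - f x) * lap φ x) := by ring
          _ ≤ |(|u x| - f x)| * |lap φ x| := by rw [← abs_mul]; exact neg_le_abs _
          _ ≤ (|u x - uk k x| + ε) * |lap φ x| := by gcongr
          _ = _ := by ring
      linarith
    have e10 := abs_le.1 e6
    simp only [hb] at e8 ⊢
    linarith [e10.1]
  have lim1 : ∀ ε : ℝ, 0 < ε → -∫ x, |u x| * lap φ x ≤ (∫ x, |F x| * φ x) + ε * Bc := by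
    intro ε hε
    refine ge_of_tendsto' (f := fun k => (∫ x, |F x| * φ x) + ε * Bc + √(a k) * A +
      √(b k) * √(2 * (∫ x, ‖gradient φ x‖ ^ 2) + 2 * (M / ε) ^ 2 * (2 * (∫ x, ‖g x‖ ^ 2) + 2 * b k))) (x := Filter.atTop) ?_ (main ε hε)
    have t1 := h1.sqrt.mul_const A
    have t2 := h2.sqrt.mul (((((h2.const_mul 2).const_add (2 * (∫ x, ‖g x‖ ^ 2))).const_mul (2 * (M / ε) ^ 2)).const_add
      (2 * (∫ x, ‖gradient φ x‖ ^ 2))).sqrt)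
    have t3 := (t1.const_add ((∫ x, |F x| * φ x) + ε * Bc)).add t2
    simpa using t3
  have lim2 : Filter.Tendsto (fun ε : ℝ => (∫ x, |F x| * φ x) + ε * Bc) (𝓝[>] 0) (𝓝 (∫ x, |F x| * φ x)) := by
    have : Filter.Tendsto (fun ε : ℝ => (∫ x, |F x| * φ x) + ε * Bc) (𝓝 0) (𝓝 ((∫ x, |F x| * φ x) + 0 * Bc)) :=
      (Continuous.tendsto (by fun_prop) 0)
    simp only [zero_mul, add_zero] at this
    exact this.mono_left nhdsWithin_le_nhds
  exact ge_of_tendsto lim2 (by filter_upwards [self_mem_nhdsWithin] with ε hε; exact lim1 ε hε)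

end

noncomputable section
open Real MeasureTheory Finset
open scoped ContDiff Topology

lemma ev_pos {f : ℝ → ℝ} {d : ℝ} (h : HasDerivAt f d 0) (h0 : 0 ≤ f 0) (hd : 0 < d) :
    ∀ᶠ t in 𝓝[>] (0:ℝ), 0 < f t := by
  have := (hasDerivAt_iff_tendsto_slope_zero.1 h)
  have h2 : Filter.Tendsto (fun t => t⁻¹ • (f (0 + t) - f 0)) (𝓝[>] 0) (𝓝 d) :=
    this.mono_left (nhdsWithin_mono _ (fun x hx => ne_of_gt hx))
  filter_upwards [h2.eventually (lt_mem_nhds hd), self_mem_nhdsWithin] with t ht ht0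
  have ht0' : (0:ℝ) < t := ht0
  simp only [zero_add, smul_eq_mul] at ht
  have := (mul_pos_iff_of_pos_left (inv_pos.2 ht0')).1 ht
  linarith

/-- abstract data for the variational problem -/
structure VData (ι H L : Type*) [Fintype ι] [NormedAddCommGroup H] [NormedSpace ℝ H]
    [NormedAddCommGroup L] [InnerProductSpace ℝ L] where
  A : ι → H →L[ℝ] H →L[ℝ] ℝ
  A_symm : ∀ i x y, A i x y = A i y x
  κ : ℝ
  κ_pos : 0 < κ
  A_coer : ∀ i x, κ * ‖x‖ ^ 2 ≤ A i x x
  m : H →ₗ[ℝ] H →ₗ[ℝ] L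
  m_symm : ∀ x y, m x y = m y x
  m_swap : ∀ x y z w, (inner ℝ (m x y) (m z w) : ℝ) = inner ℝ (m x z) (m y w)
  C : ℝ
  C_pos : 0 < C
  m_le : ∀ x, ‖m x x‖ ≤ C * ‖x‖ ^ 2
  b : ι → ι → ℝ
  b_symm : ∀ i j, b i j = b j i
  b_diag : ∀ i, 0 < b i i
  b_off : ∀ i j, i ≠ j → b i j ≤ 0
  comp : ∀ x : ℕ → H, (∃ R, ∀ k, ‖x k‖ ≤ R) → ∃ y, ∃ s : ℕ → ℕ, StrictMono s ∧
    ∀ f : H →L[ℝ] ℝ, Filter.Tendsto (fun k => f (x (s k))) Filter.atTop (𝓝 (f y))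
  weak : ∀ (x : ℕ → H) y, (∃ R, ∀ k, ‖x k‖ ≤ R) →
    (∀ f : H →L[ℝ] ℝ, Filter.Tendsto (fun k => f (x k)) Filter.atTop (𝓝 (f y))) →
    Filter.Tendsto (fun k => m (x k) (x k)) Filter.atTop (𝓝 (m y y))

namespace VData
variable {ι H L : Type*} [Fintype ι] [DecidableEq ι] [NormedAddCommGroup H] [NormedSpace ℝ H]
    [NormedAddCommGroup L] [InnerProductSpace ℝ L] (D : VData ι H L)

def q (x y : H) : ℝ := inner ℝ (D.m x x) (D.m y y)

lemma q_eq (x y : H) : D.q x y = ‖D.m x y‖ ^ 2 := by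
  unfold q; rw [D.m_swap, real_inner_self_eq_norm_sq]
lemma q_nonneg (x y : H) : 0 ≤ D.q x y := by rw [q_eq]; positivity
lemma q_symm (x y : H) : D.q x y = D.q y x := by rw [q_eq, q_eq, D.m_symm]
lemma q_self (x : H) : D.q x x = ‖D.m x x‖ ^ 2 := D.q_eq x x

lemma A_pos (i : ι) {x : H} (hx : x ≠ 0) : 0 < D.A i x x :=
  lt_of_lt_of_le (mul_pos D.κ_pos (pow_pos (norm_pos_iff.2 hx) 2)) (D.A_coer i x)
lemma A_nonneg (i : ι) (x : H) : 0 ≤ D.A i x x :=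
  le_trans (mul_nonneg D.κ_pos.le (sq_nonneg _)) (D.A_coer i x)

def rhs (x : ι → H) (i : ι) : ℝ := ∑ k, D.b i k * D.q (x i) (x k)
def Feas (x : ι → H) : Prop := ∀ i, x i ≠ 0 ∧ D.A i (x i) (x i) ≤ D.rhs x i
def En (x : ι → H) : ℝ := ∑ i, D.A i (x i) (x i)

lemma En_nonneg (x : ι → H) : 0 ≤ D.En x := Finset.sum_nonneg fun i _ => D.A_nonneg i _

lemma rhs_le (x : ι → H) (i : ι) : D.rhs x i ≤ D.b i i * ‖D.m (x i) (x i)‖ ^ 2 := by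
  unfold rhs
  rw [← Finset.add_sum_erase _ _ (Finset.mem_univ i), q_self]
  have : ∑ k ∈ univ.erase i, D.b i k * D.q (x i) (x k) ≤ 0 := Finset.sum_nonpos fun k hk =>
    mul_nonpos_of_nonpos_of_nonneg (D.b_off i k (Finset.ne_of_mem_erase hk).symm) (D.q_nonneg _ _)
  linarith

lemma lower {x : ι → H} (hx : D.Feas x) (i : ι) : D.κ / (D.b i i * D.C) ≤ ‖D.m (x i) (x i)‖ := by
  have h1 := (hx i).2.trans (D.rhs_le x i)
  have h2 := (D.A_coer i (x i)).trans h1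
  have h3 := D.m_le (x i)
  have h4 : 0 < ‖x i‖ ^ 2 := pow_pos (norm_pos_iff.2 (hx i).1) 2
  have h5 := D.b_diag i
  have h6 := D.C_pos
  have h7 : D.κ * ‖x i‖ ^ 2 ≤ (D.b i i * D.C * ‖D.m (x i) (x i)‖) * ‖x i‖ ^ 2 := by
    calc _ ≤ D.b i i * ‖D.m (x i) (x i)‖ ^ 2 := h2
      _ = D.b i i * (‖D.m (x i) (x i)‖ * ‖D.m (x i) (x i)‖) := by ring
      _ ≤ D.b i i * (‖D.m (x i) (x i)‖ * (D.C * ‖x i‖ ^ 2)) := by gcongr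
      _ = _ := by ring
  have h8 := le_of_mul_le_mul_right h7 h4
  rw [div_le_iff₀ (by positivity)]
  linarith

lemma comp_all (D : VData ι H L) (x : ℕ → ι → H) (R : ℝ) (hR : ∀ k i, ‖x k i‖ ≤ R) : ∃ y : ι → H, ∃ s : ℕ → ℕ, StrictMono s ∧
    ∀ i, ∀ f : H →L[ℝ] ℝ, Filter.Tendsto (fun k => f (x (s k) i)) Filter.atTop (𝓝 (f (y i))) := by
  have : ∀ T : Finset ι, ∃ y : ι → H, ∃ s : ℕ → ℕ, StrictMono s ∧
    ∀ i ∈ T, ∀ f : H →L[ℝ] ℝ, Filter.Tendsto (fun k => f (x (s k) i)) Filter.atTop (𝓝 (f (y i))) := by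
    intro T
    induction T using Finset.induction_on with
    | empty => exact ⟨0, id, strictMono_id, by simp⟩
    | insert a T ha ih =>
      obtain ⟨y, s, hs, h⟩ := ih
      obtain ⟨z, s', hs', h'⟩ := D.comp (fun k => x (s k) a) ⟨R, fun k => hR _ _⟩
      refine ⟨Function.update y a z, s ∘ s', hs.comp hs', fun i hi f => ?_⟩
      by_cases hia : i = a
      · subst hia; simpa using h' f
      · have hiT : i ∈ T := by simpa [hia] using hi
        rw [Function.update_of_ne hia]
        exact (h i hiT f).comp hs'.tendsto_atTop
  obtain ⟨y, s, hs, h⟩ := this Finset.univ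
  exact ⟨y, s, hs, fun i => h i (Finset.mem_univ i)⟩

lemma A_low (i : ι) (x y : H) : 2 * D.A i x y - D.A i y y ≤ D.A i x x := by
  have := D.A_nonneg i (x - y)
  simp only [map_sub, ContinuousLinearMap.sub_apply] at this
  rw [D.A_symm i y x] at this
  linarith

theorem exists_min (hne : ∃ x, D.Feas x) : ∃ x, D.Feas x ∧ ∀ y, D.Feas y → D.En x ≤ D.En y := by
  set I := sInf (D.En '' {x | D.Feas x}) with hI
  have hbdd : BddBelow (D.En '' {x | D.Feas x}) := ⟨0, by rintro _ ⟨x, _, rfl⟩; exact D.En_nonneg x⟩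
  have hn : (D.En '' {x | D.Feas x}).Nonempty := by
    obtain ⟨x, hx⟩ := hne; exact ⟨_, x, hx, rfl⟩
  have hex : ∀ k : ℕ, ∃ x, D.Feas x ∧ D.En x < I + 1 / ((k:ℝ) + 1) := by
    intro k
    obtain ⟨_, ⟨x, hx, rfl⟩, h⟩ := exists_lt_of_csInf_lt hn (lt_add_of_pos_right I (by positivity : (0:ℝ) < 1 / ((k:ℝ) + 1)))
    exact ⟨x, hx, h⟩
  choose x hx hxE using hex
  have hbd : ∀ k i, ‖x k i‖ ≤ √((I + 1) / D.κ) := by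
    intro k i
    apply Real.le_sqrt_of_sq_le
    rw [le_div_iff₀ D.κ_pos]
    have h1 : D.A i (x k i) (x k i) ≤ D.En (x k) :=
      Finset.single_le_sum (f := fun i => D.A i (x k i) (x k i)) (fun j _ => D.A_nonneg j _) (Finset.mem_univ i)
    have h2 := D.A_coer i (x k i)
    have h3 := hxE k
    have h4 : 1 / ((k:ℝ) + 1) ≤ 1 := by
      rw [div_le_one (by positivity)]; linarith [(Nat.cast_nonneg k : (0:ℝ) ≤ k)]
    linarith
  obtain ⟨y, s, hs, hy⟩ := D.comp_all x _ hbd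
  have hm : ∀ i, Filter.Tendsto (fun k => D.m (x (s k) i) (x (s k) i)) Filter.atTop (𝓝 (D.m (y i) (y i))) := fun i =>
    D.weak _ _ ⟨_, fun k => hbd _ i⟩ (hy i)
  have hA : ∀ i, Filter.Tendsto (fun k => 2 * D.A i (x (s k) i) (y i) - D.A i (y i) (y i)) Filter.atTop
      (𝓝 (D.A i (y i) (y i))) := by
    intro i
    have := ((hy i (D.A i (y i))).const_mul 2).sub_const (D.A i (y i) (y i))
    simp only [D.A_symm i (y i) (x _ i)] at this
    convert this using 2; ring
  have hyF : D.Feas y := by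
    intro i
    constructor
    · intro h0
      have h1 : Filter.Tendsto (fun k => ‖D.m (x (s k) i) (x (s k) i)‖) Filter.atTop (𝓝 ‖D.m (y i) (y i)‖) := (hm i).norm
      have h2 := ge_of_tendsto' h1 fun k => D.lower (hx (s k)) i
      have h3 : 0 < D.κ / (D.b i i * D.C) := div_pos D.κ_pos (mul_pos (D.b_diag i) D.C_pos)
      rw [h0] at h2; simp at h2; linarith
    · have h1 : Filter.Tendsto (fun k => D.rhs (x (s k)) i) Filter.atTop (𝓝 (D.rhs y i)) :=
        tendsto_finset_sum _ fun k _ => ((hm i).inner (hm k)).const_mul _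
      exact le_of_tendsto_of_tendsto' (hA i) h1 fun k => (D.A_low i _ _).trans (hx (s k) i).2
  refine ⟨y, hyF, fun z hz => ?_⟩
  have h1 : I ≤ D.En z := csInf_le hbdd ⟨z, hz, rfl⟩
  refine le_trans ?_ h1
  have h2 : Filter.Tendsto (fun k => ∑ i, (2 * D.A i (x (s k) i) (y i) - D.A i (y i) (y i))) Filter.atTop (𝓝 (D.En y)) :=
    tendsto_finset_sum _ fun i _ => hA i
  have h3 : Filter.Tendsto (fun k => I + 1 / (((s k : ℕ):ℝ) + 1)) Filter.atTop (𝓝 (I + 0)) :=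
    (tendsto_one_div_add_atTop_nhds_zero_nat.comp hs.tendsto_atTop).const_add I
  rw [add_zero] at h3
  refine le_of_tendsto_of_tendsto' h2 h3 fun k => ?_
  exact (Finset.sum_le_sum fun i _ => D.A_low i _ _).trans (hxE (s k)).le

lemma q_smul_left (c : ℝ) (x y : H) : D.q (c • x) y = c ^ 2 * D.q x y := by
  unfold q; simp only [map_smul, LinearMap.smul_apply, inner_smul_left]; simp; ring
lemma q_smul_right (c : ℝ) (x y : H) : D.q x (c • y) = c ^ 2 * D.q x y := by
  rw [q_symm, q_smul_left, q_symm]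
lemma A_smul (i : ι) (c : ℝ) (x : H) : D.A i (c • x) (c • x) = c ^ 2 * D.A i x x := by
  simp; ring

lemma min_eq {x : ι → H} (hx : D.Feas x) (hmin : ∀ y, D.Feas y → D.En x ≤ D.En y) (i : ι) :
    D.A i (x i) (x i) = D.rhs x i := by
  by_contra hne
  have hlt := lt_of_le_of_ne (hx i).2 hne
  have hcont : Continuous fun s : ℝ => s * D.rhs x i - 0 + (s ^ 2 - s) * (D.b i i * D.q (x i) (x i)) + (1 - s) * D.rhs x i := by fun_prop
  -- choose s < 1 close to 1
  obtain ⟨s, hs0, hs1, hs⟩ : ∃ s : ℝ, 0 < s ∧ s < 1 ∧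
      D.A i (x i) (x i) ≤ D.rhs x i + (s ^ 2 - 1) * (D.b i i * D.q (x i) (x i)) := by
    have hc : Continuous fun s : ℝ => D.rhs x i + (s ^ 2 - 1) * (D.b i i * D.q (x i) (x i)) := by fun_prop
    have h1 := (hc.tendsto 1).eventually (lt_mem_nhds (a := D.A i (x i) (x i)) (by simpa using hlt))
    have h2 := h1.filter_mono (nhdsWithin_le_nhds (s := Set.Iio 1))
    have h3 : ∀ᶠ s in 𝓝[<] (1:ℝ), 0 < s := (lt_mem_nhds (by norm_num : (0:ℝ) < 1)).filter_mono nhdsWithin_le_nhds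
    obtain ⟨s, hs1, hs2, hs3⟩ := (h2.and (h3.and self_mem_nhdsWithin)).exists
    exact ⟨s, hs2, hs3, hs1.le⟩
  set y := Function.update x i (s • x i) with hy
  have hyi : y i = s • x i := by simp [hy]
  have hyk : ∀ k, k ≠ i → y k = x k := fun k hk => by simp [hy, hk]
  have hyF : D.Feas y := by
    intro k
    by_cases hk : k = i
    · subst hk
      refine ⟨by rw [hyi]; exact smul_ne_zero hs0.ne' (hx k).1, ?_⟩
      have : D.rhs y k = s ^ 2 * (D.rhs x k + (s ^ 2 - 1) * (D.b k k * D.q (x k) (x k))) := by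
        unfold rhs
        rw [← Finset.add_sum_erase _ _ (Finset.mem_univ k), ← Finset.add_sum_erase _ (fun j => D.b k j * D.q (x k) (x j)) (Finset.mem_univ k)]
        have : ∑ j ∈ univ.erase k, D.b k j * D.q (y k) (y j) = s ^ 2 * ∑ j ∈ univ.erase k, D.b k j * D.q (x k) (x j) := by
          rw [Finset.mul_sum]
          refine Finset.sum_congr rfl fun j hj => ?_
          rw [hyk j (Finset.ne_of_mem_erase hj), hyi, q_smul_left]; ring
        rw [this, hyi, q_smul_left, q_smul_right]; ring
      rw [this, hyi, A_smul]
      gcongr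
    · rw [hyk k hk]
      refine ⟨(hx k).1, (hx k).2.trans ?_⟩
      unfold rhs
      refine Finset.sum_le_sum fun j _ => ?_
      rw [hyk k hk]
      by_cases hj : j = i
      · subst hj
        rw [hyi, q_smul_right]
        have h1 := D.b_off k j hk
        have h2 := D.q_nonneg (x k) (x j)
        have h3 : s ^ 2 ≤ 1 := by nlinarith
        nlinarith [mul_nonneg (mul_nonneg (neg_nonneg.2 h1) h2) (sub_nonneg.2 h3)]
      · rw [hyk j hj]
  have h1 := hmin y hyF
  have h2 : D.En y < D.En x := by
    unfold En
    refine Finset.sum_lt_sum (fun k _ => ?_) ⟨i, Finset.mem_univ i, ?_⟩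
    · by_cases hk : k = i
      · subst hk; rw [hyi, A_smul]
        have := D.A_nonneg k (x k)
        exact mul_le_of_le_one_left this (by nlinarith)
      · rw [hyk k hk]
    · rw [hyi, A_smul]
      have := D.A_pos i (hx i).1
      exact mul_lt_of_lt_one_left this (by nlinarith)
  linarith

lemma q_deriv (x φ y ψ : H) : HasDerivAt (fun t : ℝ => D.q (x + t • φ) (y + t • ψ))
    (2 * inner ℝ (D.m x φ) (D.m y y) + 2 * inner ℝ (D.m y ψ) (D.m x x)) 0 := by
  have e : ∀ (x φ : H) (t : ℝ), D.m (x + t • φ) (x + t • φ) = D.m x x + t • ((2:ℝ) • D.m x φ) + t ^ 2 • D.m φ φ := by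
    intro x φ t
    simp only [map_add, map_smul, LinearMap.add_apply, LinearMap.smul_apply]
    rw [D.m_symm φ x]; module
  have d : ∀ (x φ : H), HasDerivAt (fun t : ℝ => D.m (x + t • φ) (x + t • φ)) ((2:ℝ) • D.m x φ) 0 := by
    intro x φ
    simp only [e]
    have h1 := (hasDerivAt_id (0:ℝ)).smul_const ((2:ℝ) • D.m x φ)
    have h2 := (hasDerivAt_pow 2 (0:ℝ)).smul_const (D.m φ φ)
    have h3 := (h1.const_add (D.m x x)).fun_add h2
    refine h3.congr_deriv ?_
    simp
  have := (d x φ).inner ℝ (d y ψ)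
  unfold q
  refine this.congr_deriv ?_
  simp [inner_smul_left, inner_smul_right, real_inner_comm, add_comm]

lemma A_deriv (i : ι) (x φ : H) : HasDerivAt (fun t : ℝ => D.A i (x + t • φ) (x + t • φ)) (2 * D.A i x φ) 0 := by
  have e : ∀ t : ℝ, D.A i (x + t • φ) (x + t • φ) = D.A i x x + t * (2 * D.A i x φ) + t ^ 2 * D.A i φ φ := by
    intro t
    simp only [map_add, map_smul, ContinuousLinearMap.add_apply, ContinuousLinearMap.smul_apply, smul_eq_mul]
    rw [D.A_symm i φ x]; ring
  simp only [e]
  have h1 := (hasDerivAt_id (0:ℝ)).mul_const (2 * D.A i x φ)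
  have h2 := (hasDerivAt_pow 2 (0:ℝ)).mul_const (D.A i φ φ)
  have h3 := (h1.const_add (D.A i x x)).fun_add h2
  refine h3.congr_deriv ?_
  simp

lemma min_crit {x : ι → H} (hx : D.Feas x) (hmin : ∀ y, D.Feas y → D.En x ≤ D.En y) (φ : ι → H) :
    0 ≤ ∑ i, (D.A i (x i) (φ i) - ∑ k, D.b i k * inner ℝ (D.m (x i) (φ i)) (D.m (x k) (x k))) := by
  by_contra hneg
  push Not at hneg
  set J := ∑ i, (D.A i (x i) (φ i) - ∑ k, D.b i k * inner ℝ (D.m (x i) (φ i)) (D.m (x k) (x k))) with hJ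
  set M : Matrix ι ι ℝ := fun i k => D.b i k * D.q (x i) (x k) with hM
  have hrow : ∀ i, ∑ k, M i k = D.A i (x i) (x i) := fun i => (D.min_eq hx hmin i).symm
  have hMs : ∀ i k, M i k = M k i := fun i k => by simp only [hM]; rw [D.b_symm, D.q_symm]
  have hdet : M.det ≠ 0 := by
    apply det_ne_zero_of_sum_row_lt_diag
    intro k
    have h1 : ∑ j ∈ univ.erase k, ‖M k j‖ = -∑ j ∈ univ.erase k, M k j := by
      rw [← Finset.sum_neg_distrib]
      refine Finset.sum_congr rfl fun j hj => ?_
      rw [norm_eq_abs, abs_of_nonpos]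
      exact mul_nonpos_of_nonpos_of_nonneg (D.b_off k j (Finset.ne_of_mem_erase hj).symm) (D.q_nonneg _ _)
    have h2 := hrow k
    rw [← Finset.add_sum_erase _ _ (Finset.mem_univ k)] at h2
    have h3 := D.A_pos k (hx k).1
    rw [h1, norm_eq_abs]
    exact lt_of_lt_of_le (by linarith) (le_abs_self _)
  set a' : ι → ℝ := fun i => 2 * D.A i (x i) (φ i)
  set q' : ι → ι → ℝ := fun i k => 2 * inner ℝ (D.m (x i) (φ i)) (D.m (x k) (x k)) + 2 * inner ℝ (D.m (x k) (φ k)) (D.m (x i) (x i))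
  obtain ⟨ε, hε, hεJ⟩ : ∃ ε : ℝ, 0 < ε ∧ 4 * J + Fintype.card ι * ε < 0 := by
    refine ⟨-J / (Fintype.card ι + 1), by apply div_pos <;> [linarith; positivity], ?_⟩
    have : (Fintype.card ι : ℝ) * (-J / (Fintype.card ι + 1)) ≤ -J := by
      rw [← mul_div_assoc, div_le_iff₀ (by positivity)]
      nlinarith
    linarith
  set r : ι → ℝ := fun i => a' i - (∑ k, D.b i k * q' i k) + ε
  obtain ⟨σ, hσ⟩ : ∃ σ : ι → ℝ, M.mulVec σ = r := by
    refine ⟨M⁻¹.mulVec r, ?_⟩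
    rw [Matrix.mulVec_mulVec, Matrix.mul_nonsing_inv _ (isUnit_iff_ne_zero.2 hdet), Matrix.one_mulVec]
  have hσi : ∀ i, ∑ k, M i k * σ k = r i := fun i => congrFun hσ i
  -- perturbed point
  set w : ℝ → ι → H := fun t i => x i + t • φ i
  set z : ℝ → ι → H := fun t i => √(1 + t * σ i) • w t i
  have hqd : ∀ i k, HasDerivAt (fun t => D.q (w t i) (w t k)) (q' i k) 0 := fun i k => D.q_deriv _ _ _ _
  have had : ∀ i, HasDerivAt (fun t => D.A i (w t i) (w t i)) (a' i) 0 := fun i => D.A_deriv i _ _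
  have hsd : ∀ i, HasDerivAt (fun t => 1 + t * σ i) (σ i) 0 := fun i => by
    simpa using ((hasDerivAt_id (0:ℝ)).mul_const (σ i)).const_add 1
  have hw0 : ∀ i, w 0 i = x i := fun i => by simp [w]
  have hc1 : ∀ i, HasDerivAt (fun t => (∑ k, D.b i k * ((1 + t * σ k) * D.q (w t i) (w t k))) - D.A i (w t i) (w t i)) ε 0 := by
    intro i
    have h1 := (HasDerivAt.fun_sum (u := Finset.univ) fun k _ => (((hsd k).mul (hqd i k)).const_mul (D.b i k))).sub (had i)
    refine h1.congr_deriv ?_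
    simp only [hw0, zero_mul, add_zero, one_mul]
    have : ∑ k, D.b i k * (σ k * D.q (x i) (x k) + q' i k) = r i + ∑ k, D.b i k * q' i k := by
      rw [← hσi i, ← Finset.sum_add_distrib]
      refine Finset.sum_congr rfl fun k _ => ?_
      simp only [hM]; ring
    rw [this]; simp only [r]; ring
  have hc2 : HasDerivAt (fun t => D.En x - ∑ i, (1 + t * σ i) * D.A i (w t i) (w t i)) (-(4 * J + Fintype.card ι * ε)) 0 := by
    have h1 := (HasDerivAt.fun_sum (u := Finset.univ) fun i _ => ((hsd i).mul (had i))).const_sub (D.En x)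
    refine h1.congr_deriv ?_
    simp only [hw0, zero_mul, add_zero, one_mul]
    congr 1
    have s1 : ∑ i, σ i * D.A i (x i) (x i) = ∑ i, r i := by
      simp_rw [← hrow, ← hσi, Finset.mul_sum]
      rw [Finset.sum_comm]
      refine Finset.sum_congr rfl fun i _ => Finset.sum_congr rfl fun k _ => ?_
      rw [hMs k i]; ring
    rw [Finset.sum_add_distrib, s1]
    have s2 : ∑ i, ∑ k, D.b i k * q' i k = 4 * ∑ i, ∑ k, D.b i k * inner ℝ (D.m (x i) (φ i)) (D.m (x k) (x k)) := by
      have e1 : ∑ i, ∑ k, D.b i k * q' i k = 2 * (∑ i, ∑ k, D.b i k * inner ℝ (D.m (x i) (φ i)) (D.m (x k) (x k))) +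
          2 * ∑ i, ∑ k, D.b i k * inner ℝ (D.m (x k) (φ k)) (D.m (x i) (x i)) := by
        simp_rw [Finset.mul_sum, ← Finset.sum_add_distrib]
        refine Finset.sum_congr rfl fun i _ => Finset.sum_congr rfl fun k _ => ?_
        simp only [q']; ring
      have e2 : ∑ i, ∑ k, D.b i k * inner ℝ (D.m (x k) (φ k)) (D.m (x i) (x i)) =
          ∑ i, ∑ k, D.b i k * inner ℝ (D.m (x i) (φ i)) (D.m (x k) (x k)) := by
        rw [Finset.sum_comm]
        refine Finset.sum_congr rfl fun i _ => Finset.sum_congr rfl fun k _ => ?_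
        rw [D.b_symm]
      rw [e1, e2]; ring
    simp only [r, Finset.sum_add_distrib, Finset.sum_sub_distrib, hJ]
    rw [s2]
    simp only [a', ← Finset.mul_sum, Finset.sum_const, Finset.card_univ, nsmul_eq_mul]
    ring
  have v1 : ∀ᶠ t in 𝓝[>] (0:ℝ), ∀ i, 0 < (∑ k, D.b i k * ((1 + t * σ k) * D.q (w t i) (w t k))) - D.A i (w t i) (w t i) := by
    rw [Filter.eventually_all]
    intro i
    refine ev_pos (hc1 i) ?_ hε
    simp only [hw0, zero_mul, add_zero, one_mul]
    have := (hx i).2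
    unfold rhs at this; linarith
  have v2 : ∀ᶠ t in 𝓝[>] (0:ℝ), 0 < D.En x - ∑ i, (1 + t * σ i) * D.A i (w t i) (w t i) := by
    refine ev_pos hc2 ?_ (by linarith)
    simp [hw0, En]
  have v3 : ∀ᶠ t in 𝓝[>] (0:ℝ), ∀ i, 0 < 1 + t * σ i := by
    rw [Filter.eventually_all]
    intro i
    exact ((hsd i).continuousAt.eventually (lt_mem_nhds (by simp))).filter_mono nhdsWithin_le_nhds
  have v4 : ∀ᶠ t in 𝓝[>] (0:ℝ), ∀ i, 0 < D.A i (w t i) (w t i) := by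
    rw [Filter.eventually_all]
    intro i
    exact ((had i).continuousAt.eventually (lt_mem_nhds (by simpa [hw0] using D.A_pos i (hx i).1))).filter_mono nhdsWithin_le_nhds
  obtain ⟨t, h1, h2, h3, h4⟩ := (v1.and (v2.and (v3.and v4))).exists
  have hsq : ∀ i, √(1 + t * σ i) ^ 2 = 1 + t * σ i := fun i => Real.sq_sqrt (h3 i).le
  have hzF : D.Feas (z t) := by
    intro i
    constructor
    · refine smul_ne_zero (Real.sqrt_pos.2 (h3 i)).ne' ?_
      intro h0
      have := h4 i
      rw [h0] at this; simp at this
    · simp only [z, rhs, A_smul, hsq, q_smul_left, q_smul_right]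
      have e : ∑ k, D.b i k * ((1 + t * σ i) * ((1 + t * σ k) * D.q (w t i) (w t k))) =
          (1 + t * σ i) * ∑ k, D.b i k * ((1 + t * σ k) * D.q (w t i) (w t k)) := by
        rw [Finset.mul_sum]; exact Finset.sum_congr rfl fun k _ => by ring
      have e' : ∀ k, (1 + t * σ k) * ((1 + t * σ i) * D.q (w t i) (w t k)) = (1 + t * σ i) * ((1 + t * σ k) * D.q (w t i) (w t k)) := fun k => by ring
      simp only [e']
      rw [e]
      have := h1 i
      have h5 := (h3 i).le
      gcongr
      linarith
  have h5 := hmin _ hzF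
  have h6 : D.En (z t) = ∑ i, (1 + t * σ i) * D.A i (w t i) (w t i) := by
    simp only [En, z, A_smul, hsq]
  linarith

theorem main (hne : ∃ x, D.Feas x) : ∃ x : ι → H, (∀ i, D.κ / (D.b i i * D.C) ≤ ‖D.m (x i) (x i)‖) ∧
    ∀ i φ, D.A i (x i) φ = ∑ k, D.b i k * inner ℝ (D.m (x i) φ) (D.m (x k) (x k)) := by
  obtain ⟨x, hx, hmin⟩ := D.exists_min hne
  refine ⟨x, D.lower hx, fun i φ => ?_⟩
  have key : ∀ φ : H, 0 ≤ D.A i (x i) φ - ∑ k, D.b i k * inner ℝ (D.m (x i) φ) (D.m (x k) (x k)) := by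
    intro φ
    have := D.min_crit hx hmin (Pi.single i φ)
    rw [Finset.sum_eq_single i] at this
    · simpa using this
    · intro j _ hj
      simp [Pi.single_eq_of_ne hj]
    · simp
  have h1 := key φ
  have h2 := key (-φ)
  simp only [map_neg, inner_neg_left, mul_neg, Finset.sum_neg_distrib] at h2
  linarith

end VData
end

noncomputable section
open Real MeasureTheory Finset
open scoped ContDiff Topology

lemma var_sq {α : Type*} [MeasurableSpace α] {μ : Measure α} {w h : α → ℝ} (hw0 : ∀ x, 0 ≤ w x) (hw : Integrable w μ)
    (hw1 : ∫ x, w x ∂μ = 1) (h1 : Integrable (fun x => w x * h x) μ) (h2 : Integrable (fun x => w x * h x ^ 2) μ) :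
    (∫ x, w x * h x ∂μ) ^ 2 ≤ ∫ x, w x * h x ^ 2 ∂μ := by
  set c := ∫ x, w x * h x ∂μ with hc
  have h0 : 0 ≤ ∫ x, w x * (h x - c) ^ 2 ∂μ := integral_nonneg fun x => mul_nonneg (hw0 x) (sq_nonneg _)
  have e : ∫ x, w x * (h x - c) ^ 2 ∂μ = (∫ x, w x * h x ^ 2 ∂μ) - 2 * c * c + c ^ 2 * 1 := by
    have : ∀ x, w x * (h x - c) ^ 2 = w x * h x ^ 2 - 2 * c * (w x * h x) + c ^ 2 * w x := fun x => by ring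
    simp_rw [this]
    have h3 : Integrable (fun x => w x * h x ^ 2 - 2 * c * (w x * h x)) μ := h2.sub (h1.const_mul _)
    rw [integral_add h3 (hw.const_mul _), integral_sub h2 (h1.const_mul _), integral_const_mul,
      integral_const_mul, hw1]
  rw [e] at h0
  nlinarith

set_option maxHeartbeats 800000 in
lemma transl {n : ℕ} {φ : Euc n → ℝ} (hφ : Test Set.univ φ) (y : Euc n) :
    ∫ x, (φ x - φ (x - y)) ^ 2 ≤ ‖y‖ ^ 2 * ∫ x, ‖gradient φ x‖ ^ 2 := by
  have hg := gradient_contDiff hφ.cd1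
  have hgi : Integrable (fun x => ‖gradient φ x‖ ^ 2) := (hφ.memLp_grad 2).integrable_norm_pow (p := 2) (by norm_num)
  have hgt : ∀ t : ℝ, Integrable (fun x => ‖gradient φ (x - t • y)‖ ^ 2) := fun t => hgi.comp_sub_right (t • y)
  let ν : Measure ℝ := volume.restrict (Set.Icc 0 1)
  have hcu : Continuous (Function.uncurry fun (x : Euc n) (t : ℝ) => ‖gradient φ (x - t • y)‖ ^ 2) := by
    have : Continuous fun p : Euc n × ℝ => p.1 - p.2 • y := by fun_prop
    exact (hg.comp this).norm.pow 2
  have hprod : Integrable (Function.uncurry fun (x : Euc n) (t : ℝ) => ‖gradient φ (x - t • y)‖ ^ 2) (volume.prod ν) := by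
    rw [integrable_prod_iff' hcu.aestronglyMeasurable]
    refine ⟨Filter.Eventually.of_forall fun t => hgt t, ?_⟩
    have : (fun t : ℝ => ∫ x : Euc n, ‖Function.uncurry (fun (x : Euc n) (t : ℝ) => ‖gradient φ (x - t • y)‖ ^ 2) (x, t)‖) =
        fun _ => ∫ x, ‖gradient φ x‖ ^ 2 := by
      ext t
      simp only [Function.uncurry, norm_pow, norm_norm]
      exact integral_sub_right_eq_self (fun x => ‖gradient φ x‖ ^ 2) (t • y)
    rw [this]
    exact integrable_const _
  have hpt : ∀ x, (φ x - φ (x - y)) ^ 2 ≤ ‖y‖ ^ 2 * ∫ t, ‖gradient φ (x - t • y)‖ ^ 2 ∂ν := by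
    intro x
    have hd : ∀ t : ℝ, HasDerivAt (fun t : ℝ => φ (x - t • y)) (-(inner ℝ (gradient φ (x - t • y)) y)) t := by
      intro t
      have h1 : HasDerivAt (fun t : ℝ => x - t • y) (-y) t := by
        simpa using ((hasDerivAt_id t).smul_const y).const_sub x
      have h2 := ((hφ.smooth.differentiable (by simp)) (x - t • y)).hasFDerivAt.comp_hasDerivAt t h1
      rw [inner_gradient]
      refine h2.congr_deriv (by simp)
    have hcont : Continuous fun t : ℝ => inner ℝ (gradient φ (x - t • y)) y :=
      (hg.comp (by fun_prop : Continuous fun t : ℝ => x - t • y)).inner continuous_const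
    have e1 : φ x - φ (x - y) = ∫ t, (1:ℝ) * inner ℝ (gradient φ (x - t • y)) y ∂ν := by
      have := intervalIntegral.integral_eq_sub_of_hasDerivAt (a := 0) (b := 1) (fun t _ => hd t) (hcont.neg.intervalIntegrable _ _)
      simp only [one_smul, zero_smul, sub_zero] at this
      rw [intervalIntegral.integral_neg, intervalIntegral.integral_of_le zero_le_one, ← integral_Icc_eq_integral_Ioc] at this
      simp only [one_mul, ν]
      linarith
    rw [e1]
    have hi1 : Integrable (fun t : ℝ => (1:ℝ) * inner ℝ (gradient φ (x - t • y)) y) ν :=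
      ((continuous_const.mul hcont).continuousOn.integrableOn_compact isCompact_Icc)
    have hi2 : Integrable (fun t : ℝ => (1:ℝ) * (inner ℝ (gradient φ (x - t • y)) y) ^ 2) ν :=
      ((continuous_const.mul (hcont.pow 2)).continuousOn.integrableOn_compact isCompact_Icc)
    have hi3 : Integrable (fun t : ℝ => ‖y‖ ^ 2 * ‖gradient φ (x - t • y)‖ ^ 2) ν := by
      have : Continuous fun t : ℝ => ‖gradient φ (x - t • y)‖ ^ 2 := 
        (hg.comp (by fun_prop : Continuous fun t : ℝ => x - t • y)).norm.pow 2
      exact ((continuous_const.mul this).continuousOn.integrableOn_compact isCompact_Icc)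
    refine (var_sq (fun _ => zero_le_one) (integrable_const _) ?_ hi1 hi2).trans ?_
    · simp [ν]
    · rw [← integral_const_mul]
      refine integral_mono hi2 hi3 fun t => ?_
      have := abs_real_inner_le_norm (gradient φ (x - t • y)) y
      have h3 := sq_le_sq' (by linarith [neg_abs_le (inner ℝ (gradient φ (x - t • y)) y), abs_le.1 this]) (abs_le.1 this).2
      simp only [one_mul]
      calc _ ≤ _ := h3
        _ = _ := by ring
  have hL : Integrable (fun x => (φ x - φ (x - y)) ^ 2) := by
    have h1 : MemLp (fun x => φ x - φ (x - y)) 2 := by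
      refine (hφ.memLp 2).sub ?_
      exact (hφ.memLp 2).comp_measurePreserving (measurePreserving_sub_right volume y)
    exact h1.integrable_sq
  calc _ ≤ ∫ x, ‖y‖ ^ 2 * ∫ t, ‖gradient φ (x - t • y)‖ ^ 2 ∂ν := by
        refine integral_mono hL ?_ hpt
        exact hprod.integral_prod_left.const_mul _
    _ = ‖y‖ ^ 2 * ∫ t, (∫ x : Euc n, ‖gradient φ (x - t • y)‖ ^ 2) ∂ν := by
        rw [integral_const_mul, integral_integral_swap hprod]
    _ = _ := by
        congr 1
        have : ∀ t : ℝ, ∫ x : Euc n, ‖gradient φ (x - t • y)‖ ^ 2 = ∫ x, ‖gradient φ x‖ ^ 2 := fun t =>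
          integral_sub_right_eq_self (fun x => ‖gradient φ x‖ ^ 2) (t • y)
        simp_rw [this]
        simp [ν]

lemma cv_comm {n : ℕ} (k u : Euc n → ℝ) (x : Euc n) : cv k u x = ∫ y, k y * u (x - y) := by
  unfold cv
  rw [← integral_sub_left_eq_self (fun y => k y * u (x - y)) volume x]
  simp

lemma moll {n : ℕ} (K : Ker n) {φ : Euc n → ℝ} (hφ : Test Set.univ φ) (i : ℕ) :
    ∫ x, (φ x - cv (K.ri i) φ x) ^ 2 ≤ (2 * (1 / 2) ^ i) ^ 2 * ∫ x, ‖gradient φ x‖ ^ 2 := by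
  have hr := (K.ri_smooth i).continuous
  have hrc := K.ri_compact i
  have hc := hφ.smooth.continuous
  have hri : Integrable (K.ri i) := hr.integrable_of_hasCompactSupport hrc
  obtain ⟨R, hR⟩ := hφ.compact.isCompact.isBounded.subset_closedBall 0
  have hz : ∀ x, R < ‖x‖ → φ x = 0 := fun x hx => by
    by_contra h
    have := hR (subset_tsupport _ h)
    simp at this; linarith
  set r : ℝ := 2 * (1 / 2) ^ i with hrdef
  have hr0 : 0 < r := by positivity
  have hcu : Continuous (Function.uncurry fun (x y : Euc n) => K.ri i y * (φ x - φ (x - y)) ^ 2) := by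
    have h1 : Continuous fun p : Euc n × Euc n => φ p.1 := hc.comp continuous_fst
    have h2 : Continuous fun p : Euc n × Euc n => φ (p.1 - p.2) := hc.comp (by fun_prop)
    exact (hr.comp continuous_snd).mul ((h1.sub h2).pow 2)
  have hcs : HasCompactSupport (Function.uncurry fun (x y : Euc n) => K.ri i y * (φ x - φ (x - y)) ^ 2) := by
    refine HasCompactSupport.intro ((isCompact_closedBall (0 : Euc n) (R + r)).prod (isCompact_closedBall (0 : Euc n) r)) ?_
    rintro ⟨x, y⟩ hxy
    simp only [Function.uncurry]
    by_cases hy : r ≤ ‖y‖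
    · rw [K.ri_supp hy, zero_mul]
    · push Not at hy
      have hx : R + r < ‖x‖ := by
        by_contra h
        push Not at h
        exact hxy ⟨by simpa using h, by simpa using hy.le⟩
      rw [hz x (by linarith), hz (x - y) (by have := norm_sub_norm_le x y; linarith)]; simp
  have hpt : ∀ x, (φ x - cv (K.ri i) φ x) ^ 2 ≤ ∫ y, K.ri i y * (φ x - φ (x - y)) ^ 2 := by
    intro x
    have c1 : Continuous fun y => φ x - φ (x - y) := continuous_const.sub (hc.comp (by fun_prop))
    have i1 : Integrable fun y => K.ri i y * (φ x - φ (x - y)) :=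
      (hr.mul c1).integrable_of_hasCompactSupport hrc.mul_right
    have i2 : Integrable fun y => K.ri i y * (φ x - φ (x - y)) ^ 2 :=
      (hr.mul (c1.pow 2)).integrable_of_hasCompactSupport hrc.mul_right
    have i3 : Integrable fun y => K.ri i y * φ (x - y) :=
      (hr.mul (hc.comp (by fun_prop))).integrable_of_hasCompactSupport hrc.mul_right
    have e : φ x - cv (K.ri i) φ x = ∫ y, K.ri i y * (φ x - φ (x - y)) := by
      simp_rw [mul_sub]
      rw [integral_sub (hri.mul_const _) i3, integral_mul_const, K.ri_int, one_mul, cv_comm]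
    rw [e]
    exact var_sq (K.ri_nonneg i) hri (K.ri_int i) i1 i2
  have hcvc : Continuous (cv (K.ri i) φ) := cv_continuous hr hrc (hc.locallyIntegrable)
  have hcvs : HasCompactSupport (cv (K.ri i) φ) := by
    refine HasCompactSupport.intro (isCompact_closedBall (0 : Euc n) (R + r)) fun x hx => ?_
    simp only [Metric.mem_closedBall, dist_zero_right, not_le] at hx
    rw [cv_comm]
    refine integral_eq_zero_of_ae (Filter.Eventually.of_forall fun y => ?_)
    by_cases hy : r ≤ ‖y‖
    · simp [K.ri_supp hy]
    · push Not at hy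
      simp [hz (x - y) (by have := norm_sub_norm_le x y; linarith)]
  have hI : Integrable (Function.uncurry fun (x y : Euc n) => K.ri i y * (φ x - φ (x - y)) ^ 2) (volume.prod volume) :=
    hcu.integrable_of_hasCompactSupport hcs
  calc _ ≤ ∫ x, ∫ y, K.ri i y * (φ x - φ (x - y)) ^ 2 := by
        refine integral_mono ?_ hI.integral_prod_left hpt
        exact (((hφ.memLp 2).sub (hcvc.memLp_of_hasCompactSupport hcvs)).integrable_sq)
    _ = ∫ y, ∫ x, K.ri i y * (φ x - φ (x - y)) ^ 2 := integral_integral_swap hI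
    _ ≤ ∫ y, K.ri i y * (r ^ 2 * ∫ x, ‖gradient φ x‖ ^ 2) := by
        refine integral_mono hI.integral_prod_right (hri.mul_const _) fun y => ?_
        simp only [integral_const_mul]
        by_cases hy : r ≤ ‖y‖
        · simp [K.ri_supp hy]
        · push Not at hy
          refine mul_le_mul_of_nonneg_left ((transl hφ y).trans ?_) (K.ri_nonneg i y)
          have : 0 ≤ ∫ x, ‖gradient φ x‖ ^ 2 := integral_nonneg fun x => by positivity
          gcongr
    _ = _ := by rw [integral_mul_const, K.ri_int, one_mul]

/-- Rellich for test functions -/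
theorem rellich {n : ℕ} (hn : 2 ≤ n) {Ω : Set (Euc n)} (hΩ : Bornology.IsBounded Ω) {φ : ℕ → Euc n → ℝ}
    (hφ : ∀ k, Test Ω (φ k)) {C : ℝ} (hC : ∀ k, ∫ x, ‖gradient (φ k) x‖ ^ 2 ≤ C) (hC2 : ∀ k, ∫ x, φ k x ^ 2 ≤ C)
    (hw : ∀ h : Euc n → ℝ, MemLp h 2 → Filter.Tendsto (fun k => ∫ x, h x * φ k x) Filter.atTop (𝓝 0)) :
    Filter.Tendsto (fun k => ∫ x, φ k x ^ 2) Filter.atTop (𝓝 0) := by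
  obtain ⟨K⟩ := Ker.nonempty hn
  obtain ⟨R, hR⟩ := hΩ.subset_closedBall 0
  have hz : ∀ k x, R < ‖x‖ → φ k x = 0 := fun k x hx => by
    by_contra h
    have := hR ((hφ k).supp (subset_tsupport _ h))
    simp at this; linarith
  have hC0 : 0 ≤ C := (integral_nonneg fun x => by positivity).trans (hC 0)
  have hU : ∀ k, Test Set.univ (φ k) := fun k => (hφ k).mono (Set.subset_univ _)
  -- mollified sequence tends to zero
  have hm : ∀ i, Filter.Tendsto (fun k => ∫ x, cv (K.ri i) (φ k) x ^ 2) Filter.atTop (𝓝 0) := by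
    intro i
    set r : ℝ := 2 * (1 / 2) ^ i with hrdef
    have hr0 : 0 < r := by positivity
    have h0 : ∀ k x, R + r < ‖x‖ → cv (K.ri i) (φ k) x = 0 := by
      intro k x hx
      rw [cv_comm]
      refine integral_eq_zero_of_ae (Filter.Eventually.of_forall fun y => ?_)
      by_cases hy : r ≤ ‖y‖
      · simp [K.ri_supp hy]
      · push Not at hy
        simp [hz k (x - y) (by have := norm_sub_norm_le x y; linarith)]
    set Bd : ℝ := (√(∫ y, K.ri i y ^ 2) * √C) ^ 2
    have key : Filter.Tendsto (fun k => ∫ x, cv (K.ri i) (φ k) x ^ 2) Filter.atTop (𝓝 (∫ _ : Euc n, (0:ℝ))) := by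
      refine tendsto_integral_of_dominated_convergence ((Metric.closedBall (0 : Euc n) (R + r)).indicator fun _ => Bd) ?_ ?_ ?_ ?_
      · intro k
        exact ((cv_continuous (K.ri_smooth i).continuous (K.ri_compact i) ((hφ k).smooth.continuous.locallyIntegrable)).pow 2).aestronglyMeasurable
      · exact (integrable_indicator_iff measurableSet_closedBall).2 (integrableOn_const (measure_closedBall_lt_top.ne))
      · intro k
        refine Filter.Eventually.of_forall fun x => ?_
        by_cases hx : x ∈ Metric.closedBall (0 : Euc n) (R + r)
        · rw [Set.indicator_of_mem hx, norm_pow]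
          have := cv_le_L2 (K.memLp_ri i) ((hφ k).memLp 2) x
          refine pow_le_pow_left₀ (norm_nonneg _) (this.trans ?_) 2
          gcongr
          exact hC2 k
        · rw [Set.indicator_of_notMem hx, h0 k x (by simpa using hx)]; simp
      · refine Filter.Eventually.of_forall fun x => ?_
        have h1 : MemLp (fun y => K.ri i (x - y)) 2 := by
          refine Continuous.memLp_of_hasCompactSupport ((K.ri_smooth i).continuous.comp (by fun_prop)) ?_
          exact (K.ri_compact i).comp_homeomorph (Homeomorph.subLeft x)
        have := (hw _ h1).pow 2
        simpa [cv] using this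
    simpa using key
  rw [Metric.tendsto_atTop]
  intro ε hε
  obtain ⟨i, hi⟩ : ∃ i : ℕ, 2 * ((2 * (1 / 2) ^ i) ^ 2 * C) < ε / 2 := by
    have : Filter.Tendsto (fun i : ℕ => 2 * ((2 * ((1:ℝ) / 2) ^ i) ^ 2 * C)) Filter.atTop (𝓝 (2 * ((2 * 0) ^ 2 * C))) :=
      ((((tendsto_pow_atTop_nhds_zero_of_lt_one (by norm_num) (by norm_num)).const_mul 2).pow 2).mul_const C).const_mul 2
    exact (this.eventually (gt_mem_nhds (by simpa using half_pos hε))).exists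
  obtain ⟨k0, hk0⟩ := (Metric.tendsto_atTop.1 (hm i)) (ε / 4) (by positivity)
  refine ⟨k0, fun k hk => ?_⟩
  have h1 := hk0 k hk
  rw [dist_zero_right, norm_eq_abs] at h1 ⊢
  rw [abs_of_nonneg (integral_nonneg fun x => by positivity)] at h1 ⊢
  have hcvm : MemLp (cv (K.ri i) (φ k)) 2 := by
    refine Continuous.memLp_of_hasCompactSupport (cv_continuous (K.ri_smooth i).continuous (K.ri_compact i) ((hφ k).smooth.continuous.locallyIntegrable)) ?_
    refine HasCompactSupport.intro (isCompact_closedBall (0 : Euc n) (R + 2 * (1 / 2) ^ i)) fun x hx => ?_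
    simp only [Metric.mem_closedBall, dist_zero_right, not_le] at hx
    rw [cv_comm]
    refine integral_eq_zero_of_ae (Filter.Eventually.of_forall fun y => ?_)
    by_cases hy : 2 * (1 / 2) ^ i ≤ ‖y‖
    · simp [K.ri_supp hy]
    · push Not at hy
      simp [hz k (x - y) (by have := norm_sub_norm_le x y; linarith)]
  have i1 : Integrable fun x => φ k x ^ 2 := ((hφ k).memLp 2).integrable_sq
  have i2 : Integrable fun x => (φ k x - cv (K.ri i) (φ k) x) ^ 2 := (((hφ k).memLp 2).sub hcvm).integrable_sq
  have i3 : Integrable fun x => (cv (K.ri i) (φ k) x) ^ 2 := hcvm.integrable_sq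
  have h2 : ∫ x, φ k x ^ 2 ≤ 2 * (∫ x, (φ k x - cv (K.ri i) (φ k) x) ^ 2) + 2 * ∫ x, (cv (K.ri i) (φ k) x) ^ 2 := by
    rw [← integral_const_mul, ← integral_const_mul, ← integral_add (i2.const_mul _) (i3.const_mul _)]
    refine integral_mono i1 ((i2.const_mul _).add (i3.const_mul _)) fun x => ?_
    simp only
    nlinarith [sq_nonneg (φ k x - 2 * cv (K.ri i) (φ k) x)]
  have h3 := moll K (hU k) i
  have h4 : (2 * (1 / 2) ^ i) ^ 2 * ∫ x, ‖gradient (φ k) x‖ ^ 2 ≤ (2 * (1 / 2) ^ i) ^ 2 * C := by gcongr; exact hC k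
  linarith

end

noncomputable section
open Real MeasureTheory Finset
open scoped ContDiff Topology

lemma sobolev_test {n : ℕ} (hn : n = 2 ∨ n = 3) {Ω : Set (Euc n)} (hO : IsOpen Ω) (hΩ : Bornology.IsBounded Ω) :
    ∃ C : ℝ, 0 < C ∧ ∀ φ : Euc n → ℝ, Test Ω φ →
      eLpNorm φ 6 volume ≤ ENNReal.ofReal C * eLpNorm (gradient φ) 2 volume := by
  obtain ⟨p, hp1, hp2, hp⟩ : ∃ p : NNReal, 1 ≤ p ∧ p ≤ 2 ∧ ((6 : NNReal) : ℝ)⁻¹ = (p : ℝ)⁻¹ - (n : ℝ)⁻¹ := by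
    rcases hn with rfl | rfl
    · refine ⟨3/2, ?_, ?_, ?_⟩
      · rw [← NNReal.coe_le_coe]; norm_num
      · rw [← NNReal.coe_le_coe]; norm_num
      · norm_num
    · refine ⟨2, ?_, ?_, ?_⟩
      · norm_num
      · norm_num
      · norm_num
  have hv : volume Ω ≠ ⊤ := hΩ.measure_lt_top.ne
  have he : 0 ≤ 1 / ((p : ENNReal)).toReal - 1 / (2 : ENNReal).toReal := by
    simp only [ENNReal.coe_toReal, ENNReal.toReal_ofNat, sub_nonneg]
    exact one_div_le_one_div_of_le (by positivity) (by exact_mod_cast hp2)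
  set K : ENNReal := (SNormLESNormFDerivOfEqConst ℝ (volume : Measure (Euc n)) p : ENNReal) *
    (volume Ω) ^ (1 / ((p : ENNReal)).toReal - 1 / (2 : ENNReal).toReal) with hK
  have hKt : K ≠ ⊤ := ENNReal.mul_ne_top ENNReal.coe_ne_top (ENNReal.rpow_ne_top_of_nonneg he hv)
  refine ⟨K.toReal + 1, by positivity, fun φ hφ => ?_⟩
  have h1 := eLpNorm_le_eLpNorm_fderiv_of_eq (F := ℝ) (volume : Measure (Euc n)) (u := φ) hφ.cd1 hφ.compact
    (p := p) (p' := 6) hp1 (by rw [finrank_euclideanSpace_fin]; rcases hn with rfl | rfl <;> norm_num)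
    (by rw [finrank_euclideanSpace_fin]; simpa using hp)
  have e1 : eLpNorm (fderiv ℝ φ) p volume = eLpNorm (gradient φ) p volume :=
    eLpNorm_congr_norm_ae (Filter.Eventually.of_forall fun x => (norm_gradient φ x).symm)
  have hs : Function.support (gradient φ) ⊆ Ω := by
    refine subset_trans ?_ hφ.supp
    intro x hx
    by_contra h
    apply hx
    have : fderiv ℝ φ x = 0 := fderiv_of_notMem_tsupport (𝕜 := ℝ) h
    rw [← norm_eq_zero, norm_gradient, this, norm_zero]
  have h2 := eLpNorm_le_eLpNorm_mul_rpow_measure_univ (μ := volume.restrict Ω) (f := gradient φ) (p := p) (q := 2)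
    (by exact_mod_cast hp2) (gradient_contDiff hφ.cd1).aestronglyMeasurable
  rw [eLpNorm_restrict_eq_of_support_subset hs, eLpNorm_restrict_eq_of_support_subset hs,
    Measure.restrict_apply_univ] at h2
  rw [e1] at h1
  calc eLpNorm φ 6 volume ≤ _ := h1
    _ ≤ (SNormLESNormFDerivOfEqConst ℝ (volume : Measure (Euc n)) p : ENNReal) * _ := mul_le_mul_right h2 _
    _ = K * eLpNorm (gradient φ) 2 volume := by rw [hK]; ring
    _ ≤ _ := by
      gcongr
      rw [← ENNReal.ofReal_toReal hKt]
      exact ENNReal.ofReal_le_ofReal (by rw [ENNReal.toReal_ofReal (by positivity)]; linarith)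

/-- ambient Hilbert space -/
abbrev VV (n : ℕ) := WithLp 2 (Lp ℝ 2 (volume : Measure (Euc n)) × Lp (Euc n) 2 (volume : Measure (Euc n)))

instance factTwo : Fact ((2:ENNReal) ≠ ⊤) := ⟨by simp⟩

instance vvSep (n : ℕ) : TopologicalSpace.SeparableSpace (VV n) := by
  have : SecondCountableTopology (Lp ℝ 2 (volume : Measure (Euc n))) := inferInstance
  have : SecondCountableTopology (Lp (Euc n) 2 (volume : Measure (Euc n))) := inferInstance
  have : TopologicalSpace.SeparableSpace (Lp ℝ 2 (volume : Measure (Euc n)) × Lp (Euc n) 2 (volume : Measure (Euc n))) :=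
    inferInstance
  exact (WithLp.prodContinuousLinearEquiv 2 ℝ (Lp ℝ 2 (volume : Measure (Euc n)))
    (Lp (Euc n) 2 (volume : Measure (Euc n)))).symm.surjective.denseRange.separableSpace
    (ContinuousLinearEquiv.continuous _)

def IsJet {n : ℕ} (φ : Euc n → ℝ) (x : VV n) : Prop :=
  (x.fst : Euc n → ℝ) =ᵐ[volume] φ ∧ (x.snd : Euc n → Euc n) =ᵐ[volume] gradient φ

def jet {n : ℕ} {Ω : Set (Euc n)} {φ : Euc n → ℝ} (hφ : Test Ω φ) : VV n :=
  WithLp.toLp 2 ((hφ.memLp 2).toLp φ, (hφ.memLp_grad 2).toLp (gradient φ))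

lemma jet_isJet {n : ℕ} {Ω : Set (Euc n)} {φ : Euc n → ℝ} (hφ : Test Ω φ) : IsJet φ (jet hφ) :=
  ⟨MemLp.coeFn_toLp (hφ.memLp 2), MemLp.coeFn_toLp (hφ.memLp_grad 2)⟩

lemma gradient_add' {n : ℕ} {f g : Euc n → ℝ} {x : Euc n} (hf : DifferentiableAt ℝ f x) (hg : DifferentiableAt ℝ g x) :
    gradient (fun y => f y + g y) x = gradient f x + gradient g x := by
  unfold gradient; rw [fderiv_fun_add hf hg, map_add]

lemma gradient_smul' {n : ℕ} {f : Euc n → ℝ} {x : Euc n} (c : ℝ) (hf : DifferentiableAt ℝ f x) :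
    gradient (fun y => c * f y) x = c • gradient f x := by
  unfold gradient; rw [fderiv_const_mul hf, map_smul]

lemma Test.diff {n : ℕ} {Ω : Set (Euc n)} {φ : Euc n → ℝ} (h : Test Ω φ) (x : Euc n) : DifferentiableAt ℝ φ x :=
  (h.cd1.differentiable (by norm_num)) x

lemma Test.add {n : ℕ} {Ω : Set (Euc n)} {φ ψ : Euc n → ℝ} (h : Test Ω φ) (h' : Test Ω ψ) :
    Test Ω (fun x => φ x + ψ x) :=
  ⟨h.smooth.add h'.smooth, h.compact.add h'.compact, (tsupport_add φ ψ).trans (Set.union_subset h.supp h'.supp)⟩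

lemma Test.cmul {n : ℕ} {Ω : Set (Euc n)} {φ : Euc n → ℝ} (h : Test Ω φ) (c : ℝ) :
    Test Ω (fun x => c * φ x) :=
  ⟨contDiff_const.mul h.smooth, h.compact.mul_left (f := fun _ => c),
    (tsupport_mul_subset_right (f := fun _ => c)).trans h.supp⟩

lemma Test.zero {n : ℕ} (Ω : Set (Euc n)) : Test Ω (fun _ => (0:ℝ)) :=
  ⟨contDiff_const, HasCompactSupport.zero, by simp⟩

/-- jets of antisymmetric test functions -/
def SubJ {n : ℕ} (Ω : Set (Euc n)) (σ : Euc n → Euc n) : Submodule ℝ (VV n) where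
  carrier := {x | ∃ φ, Test Ω φ ∧ (∀ y, φ (σ y) = - φ y) ∧ IsJet φ x}
  zero_mem' := ⟨fun _ => 0, Test.zero Ω, by simp, by
    constructor
    · exact Lp.coeFn_zero _ _ _
    · refine (Lp.coeFn_zero _ _ _).trans ?_
      filter_upwards with x
      exact (norm_eq_zero.1 ((norm_gradient (fun _ => (0:ℝ)) x).trans (by simp))).symm⟩
  add_mem' := by
    rintro x y ⟨φ, h1, h2, h3⟩ ⟨ψ, g1, g2, g3⟩
    refine ⟨_, h1.add g1, fun y => by rw [h2, g2]; ring, ?_, ?_⟩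
    · filter_upwards [Lp.coeFn_add x.fst y.fst, h3.1, g3.1] with z a b c
      rw [WithLp.add_fst, a, Pi.add_apply, b, c]
    · filter_upwards [Lp.coeFn_add x.snd y.snd, h3.2, g3.2] with z a b c
      rw [WithLp.add_snd, a, Pi.add_apply, b, c, gradient_add' (h1.diff z) (g1.diff z)]
  smul_mem' := by
    rintro c x ⟨φ, h1, h2, h3⟩
    refine ⟨_, h1.cmul c, fun y => by rw [h2]; ring, ?_, ?_⟩
    · filter_upwards [Lp.coeFn_smul c x.fst, h3.1] with z a b
      rw [WithLp.smul_fst, a, Pi.smul_apply, b, smul_eq_mul]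
    · filter_upwards [Lp.coeFn_smul c x.snd, h3.2] with z a b
      rw [WithLp.smul_snd, a, Pi.smul_apply, b, gradient_smul' c (h1.diff z)]

/-- the antisymmetric Sobolev space -/
abbrev KK {n : ℕ} (Ω : Set (Euc n)) (σ : Euc n → Euc n) : Submodule ℝ (VV n) := (SubJ Ω σ).topologicalClosure

lemma norm_sq_L2 {n : ℕ} {E : Type*} [NormedAddCommGroup E] [InnerProductSpace ℝ E]
    (f : Lp E 2 (volume : Measure (Euc n))) : ‖f‖ ^ 2 = ∫ x, ‖f x‖ ^ 2 := by
  rw [← real_inner_self_eq_norm_sq, L2.inner_def]; simp only [real_inner_self_eq_norm_sq]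

lemma norm_sq_VV {n : ℕ} (x : VV n) : ‖x‖ ^ 2 = (∫ y, ‖x.fst y‖ ^ 2) + ∫ y, ‖x.snd y‖ ^ 2 := by
  rw [WithLp.prod_norm_sq_eq_of_L2, norm_sq_L2, norm_sq_L2]

lemma VV_fst_le {n : ℕ} (x : VV n) : ‖x.fst‖ ≤ ‖x‖ := by
  have := WithLp.prod_norm_sq_eq_of_L2 x
  exact abs_le_of_sq_le_sq' (by nlinarith [sq_nonneg ‖x.snd‖]) (norm_nonneg _) |>.2
lemma VV_snd_le {n : ℕ} (x : VV n) : ‖x.snd‖ ≤ ‖x‖ := by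
  have := WithLp.prod_norm_sq_eq_of_L2 x
  exact abs_le_of_sq_le_sq' (by nlinarith [sq_nonneg ‖x.fst‖]) (norm_nonneg _) |>.2

/-- approximating sequences -/
lemma KK.seq {n : ℕ} {Ω : Set (Euc n)} {σ : Euc n → Euc n} {x : VV n} (hx : x ∈ KK Ω σ) :
    ∃ (φ : ℕ → Euc n → ℝ) (z : ℕ → VV n), (∀ k, Test Ω (φ k)) ∧ (∀ k y, φ k (σ y) = - φ k y) ∧
      (∀ k, IsJet (φ k) (z k)) ∧ Filter.Tendsto z Filter.atTop (𝓝 x) := by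
  have : x ∈ closure (SubJ Ω σ : Set (VV n)) := hx
  obtain ⟨z, hz, hl⟩ := mem_closure_iff_seq_limit.1 this
  choose φ h1 h2 h3 using hz
  exact ⟨φ, z, h1, h2, h3, hl⟩

lemma KK.seq_int {n : ℕ} {x : VV n} {φ : ℕ → Euc n → ℝ} {z : ℕ → VV n} (h : ∀ k, IsJet (φ k) (z k))
    (hl : Filter.Tendsto z Filter.atTop (𝓝 x)) :
    Filter.Tendsto (fun k => ∫ y, ‖x.fst y - φ k y‖ ^ 2) Filter.atTop (𝓝 0) ∧
    Filter.Tendsto (fun k => ∫ y, ‖x.snd y - gradient (φ k) y‖ ^ 2) Filter.atTop (𝓝 0) := by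
  have h0 : Filter.Tendsto (fun k => ‖x - z k‖ ^ 2) Filter.atTop (𝓝 0) := by
    have := (tendsto_const_nhds (x := x)).sub hl
    rw [sub_self] at this
    simpa using this.norm.pow 2
  have e1 : ∀ k, ∫ y, ‖x.fst y - φ k y‖ ^ 2 = ‖(x - z k).fst‖ ^ 2 := fun k => by
    rw [norm_sq_L2]
    refine integral_congr_ae ?_
    filter_upwards [Lp.coeFn_sub x.fst (z k).fst, (h k).1] with y a b
    rw [WithLp.sub_fst, a, Pi.sub_apply, b]
  have e2 : ∀ k, ∫ y, ‖x.snd y - gradient (φ k) y‖ ^ 2 = ‖(x - z k).snd‖ ^ 2 := fun k => by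
    rw [norm_sq_L2]
    refine integral_congr_ae ?_
    filter_upwards [Lp.coeFn_sub x.snd (z k).snd, (h k).2] with y a b
    rw [WithLp.sub_snd, a, Pi.sub_apply, b]
  constructor
  · refine squeeze_zero (fun k => by positivity) (fun k => ?_) h0
    rw [e1]; gcongr; exact VV_fst_le _
  · refine squeeze_zero (fun k => by positivity) (fun k => ?_) h0
    rw [e2]; gcongr; exact VV_snd_le _

lemma KK.ae_seq {n : ℕ} {x : VV n} {φ : ℕ → Euc n → ℝ} {z : ℕ → VV n} (h : ∀ k, IsJet (φ k) (z k))
    (hl : Filter.Tendsto z Filter.atTop (𝓝 x)) :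
    ∃ s : ℕ → ℕ, StrictMono s ∧ (∀ᵐ y, Filter.Tendsto (fun k => φ (s k) y) Filter.atTop (𝓝 (x.fst y))) ∧
      (∀ᵐ y, Filter.Tendsto (fun k => gradient (φ (s k)) y) Filter.atTop (𝓝 (x.snd y))) := by
  have l1 : Filter.Tendsto (fun k => (z k).fst) Filter.atTop (𝓝 x.fst) :=
    ((WithLp.fstL 2 ℝ _ _).continuous.tendsto x).comp hl
  have l2 : Filter.Tendsto (fun k => (z k).snd) Filter.atTop (𝓝 x.snd) :=
    ((WithLp.sndL 2 ℝ _ _).continuous.tendsto x).comp hl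
  obtain ⟨s, hs, h1⟩ := (tendstoInMeasure_of_tendsto_Lp l1).exists_seq_tendsto_ae
  obtain ⟨t, ht, h2⟩ := (tendstoInMeasure_of_tendsto_Lp (l2.comp hs.tendsto_atTop)).exists_seq_tendsto_ae
  refine ⟨s ∘ t, hs.comp ht, ?_, ?_⟩
  · filter_upwards [h1, ae_all_iff.2 fun k => (h k).1] with y a b
    simp only [b] at a
    exact a.comp ht.tendsto_atTop
  · filter_upwards [h2, ae_all_iff.2 fun k => (h k).2] with y a b
    simp only [Function.comp, b] at a
    exact a

lemma KK.ae_zero {n : ℕ} {Ω : Set (Euc n)} {σ : Euc n → Euc n} {x : VV n} (hx : x ∈ KK Ω σ) :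
    ∀ᵐ y, y ∉ Ω → x.fst y = 0 ∧ x.snd y = 0 := by
  obtain ⟨φ, z, h1, h2, h3, h4⟩ := KK.seq hx
  obtain ⟨s, hs, e1, e2⟩ := KK.ae_seq h3 h4
  filter_upwards [e1, e2] with y a b hy
  have hy' : ∀ k, y ∉ tsupport (φ k) := fun k h => hy ((h1 k).supp h)
  constructor
  · refine tendsto_nhds_unique a ?_
    simp only [fun k => image_eq_zero_of_notMem_tsupport (hy' k)]
    exact tendsto_const_nhds
  · refine tendsto_nhds_unique b ?_
    have : ∀ k, gradient (φ k) y = 0 := fun k => by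
      rw [← norm_eq_zero, norm_gradient, fderiv_of_notMem_tsupport (𝕜 := ℝ) (hy' k), norm_zero]
    simp only [this]
    exact tendsto_const_nhds

lemma KK.L6 {n : ℕ} {Ω : Set (Euc n)} {σ : Euc n → Euc n} {C : ℝ}
    (hC : ∀ φ : Euc n → ℝ, Test Ω φ → eLpNorm φ 6 volume ≤ ENNReal.ofReal C * eLpNorm (gradient φ) 2 volume)
    {x : VV n} (hx : x ∈ KK Ω σ) : eLpNorm x.fst 6 volume ≤ ENNReal.ofReal C * ENNReal.ofReal ‖x‖ := by
  obtain ⟨φ, z, h1, h2, h3, h4⟩ := KK.seq hx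
  obtain ⟨s, hs, e1, e2⟩ := KK.ae_seq h3 h4
  have := Lp.eLpNorm_lim_le_liminf_eLpNorm (p := 6)
    (fun k => (h1 (s k)).cd1.continuous.aestronglyMeasurable (μ := volume)) _ e1
  refine this.trans ?_
  have hl : Filter.Tendsto (fun k => ENNReal.ofReal C * ENNReal.ofReal ‖z (s k)‖) Filter.atTop
      (𝓝 (ENNReal.ofReal C * ENNReal.ofReal ‖x‖)) := by
    refine ENNReal.Tendsto.const_mul ?_ (Or.inr ENNReal.ofReal_ne_top)
    exact ENNReal.tendsto_ofReal ((h4.comp hs.tendsto_atTop).norm)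
  rw [← hl.liminf_eq]
  refine Filter.liminf_le_liminf (Filter.Eventually.of_forall fun k => ?_)
  refine (hC _ (h1 (s k))).trans ?_
  gcongr
  rw [← eLpNorm_congr_ae (h3 (s k)).2]
  refine le_trans (le_of_eq ?_) (ENNReal.ofReal_le_ofReal (VV_snd_le (z (s k))))
  rw [Lp.norm_def, ENNReal.ofReal_toReal (Lp.eLpNorm_ne_top _)]

lemma KK.memLp6 {n : ℕ} {Ω : Set (Euc n)} {σ : Euc n → Euc n} {C : ℝ}
    (hC : ∀ φ : Euc n → ℝ, Test Ω φ → eLpNorm φ 6 volume ≤ ENNReal.ofReal C * eLpNorm (gradient φ) 2 volume)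
    {x : VV n} (hx : x ∈ KK Ω σ) : MemLp x.fst 6 volume :=
  ⟨(Lp.memLp x.fst).1, (KK.L6 hC hx).trans_lt (ENNReal.mul_lt_top ENNReal.ofReal_lt_top ENNReal.ofReal_lt_top)⟩

section prod
variable {α : Type*} [MeasurableSpace α] {μ : Measure α}

lemma cube_memLp {u : α → ℝ} (h6 : MemLp u 6 μ) : MemLp (fun x => u x ^ 3) 2 μ := by
  have hm : AEStronglyMeasurable (fun x => u x ^ 3) μ := h6.1.pow 3
  rw [memLp_two_iff_integrable_sq hm]
  have := h6.integrable_norm_pow (p := 6) (by norm_num)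
  refine this.congr (Filter.Eventually.of_forall fun x => ?_)
  simp only [norm_eq_abs]
  rw [← pow_mul]
  exact Even.pow_abs (by decide) _

lemma four_int {u : α → ℝ} (h2 : MemLp u 2 μ) (h6 : MemLp u 6 μ) : Integrable (fun x => u x ^ 4) μ := by
  have := h2.integrable_mul (cube_memLp h6)
  refine this.congr (Filter.Eventually.of_forall fun x => ?_)
  simp only [Pi.mul_apply]; ring

lemma mul_memLp2 {u v : α → ℝ} (h2 : MemLp u 2 μ) (h6 : MemLp u 6 μ) (g2 : MemLp v 2 μ) (g6 : MemLp v 6 μ) :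
    MemLp (fun x => u x * v x) 2 μ := by
  have hm : AEStronglyMeasurable (fun x => u x * v x) μ := h2.1.mul g2.1
  rw [memLp_two_iff_integrable_sq hm]
  refine ((four_int h2 h6).add (four_int g2 g6)).mono (hm.pow 2) (Filter.Eventually.of_forall fun x => ?_)
  simp only [Pi.add_apply, norm_eq_abs]
  rw [abs_of_nonneg (by positivity), abs_of_nonneg (by positivity)]
  nlinarith [sq_nonneg (u x ^ 2 - v x ^ 2), sq_nonneg (u x ^ 2), sq_nonneg (v x ^ 2)]

lemma int_six {u : α → ℝ} (h6 : MemLp u 6 μ) : √(∫ x, (u x ^ 3) ^ 2 ∂μ) = (eLpNorm u 6 μ).toReal ^ 3 := by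
  have h := h6.eLpNorm_eq_integral_rpow_norm (by norm_num) (by norm_num)
  have e : ∫ x, (u x ^ 3) ^ 2 ∂μ = ∫ x, ‖u x‖ ^ (6:ENNReal).toReal ∂μ := by
    refine integral_congr_ae (Filter.Eventually.of_forall fun x => ?_)
    simp only [ENNReal.toReal_ofNat, norm_eq_abs]
    rw [← pow_mul, show (6:ℝ) = ((6:ℕ):ℝ) by norm_num, rpow_natCast]
    exact (Even.pow_abs (by decide) _).symm
  have hp : 0 ≤ ∫ x, ‖u x‖ ^ (6:ENNReal).toReal ∂μ := integral_nonneg fun x => by positivity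
  rw [e, h, ENNReal.toReal_ofReal (by positivity), sqrt_eq_iff_eq_sq hp (by positivity), ← pow_mul,
    ← rpow_natCast, ← rpow_mul hp]
  norm_num

end prod
end

noncomputable section
open Real MeasureTheory Finset
open scoped ContDiff Topology

lemma weak_comp {H : Type*} [NormedAddCommGroup H] [InnerProductSpace ℝ H] [CompleteSpace H]
    [TopologicalSpace.SeparableSpace H] (x : ℕ → H) (hR : ∃ R, ∀ k, ‖x k‖ ≤ R) : ∃ y, ∃ s : ℕ → ℕ, StrictMono s ∧
    ∀ f : H →L[ℝ] ℝ, Filter.Tendsto (fun k => f (x (s k))) Filter.atTop (𝓝 (f y)) := by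
  obtain ⟨R, hR⟩ := hR
  have hc := WeakDual.isSeqCompact_closedBall ℝ H (0 : StrongDual ℝ H) R
  obtain ⟨l, -, s, hs, hl⟩ := hc (x := fun k => StrongDual.toWeakDual (InnerProductSpace.toDual ℝ H (x k)))
    (fun k => by simpa using hR k)
  refine ⟨(InnerProductSpace.toDual ℝ H).symm (WeakDual.toStrongDual l), s, hs, fun f => ?_⟩
  obtain ⟨w, rfl⟩ := (InnerProductSpace.toDual ℝ H).surjective f
  have h := ((WeakBilin.eval_continuous _ w).tendsto l).comp hl
  have e2 : (InnerProductSpace.toDual ℝ H w) ((InnerProductSpace.toDual ℝ H).symm (WeakDual.toStrongDual l)) = l w := by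
    rw [InnerProductSpace.toDual_apply_apply, real_inner_comm, InnerProductSpace.toDual_symm_apply]; rfl
  rw [e2]
  refine h.congr fun k => ?_
  simp only [Function.comp]
  rw [InnerProductSpace.toDual_apply_apply, real_inner_comm]
  rfl

structure SobC {n : ℕ} (Ω : Set (Euc n)) (C : ℝ) : Prop where
  pos : 0 < C
  le : ∀ φ : Euc n → ℝ, Test Ω φ → eLpNorm φ 6 volume ≤ ENNReal.ofReal C * eLpNorm (gradient φ) 2 volume

section mm
variable {n : ℕ} {Ω : Set (Euc n)} {σ : Euc n → Euc n} {C : ℝ}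

/-- product map -/
def mm (hC : SobC Ω C) (x y : KK Ω σ) : Lp ℝ 2 (volume : Measure (Euc n)) :=
  (mul_memLp2 (Lp.memLp x.1.fst) (KK.memLp6 hC.le x.2) (Lp.memLp y.1.fst) (KK.memLp6 hC.le y.2)).toLp _

lemma mm_ae (hC : SobC Ω C) (x y : KK Ω σ) : mm hC x y =ᵐ[volume] fun z => x.1.fst z * y.1.fst z :=
  MemLp.coeFn_toLp _

lemma mm_symm (hC : SobC Ω C) (x y : KK Ω σ) : mm hC x y = mm hC y x := by
  apply Lp.ext
  filter_upwards [mm_ae hC x y, mm_ae hC y x] with z a b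
  rw [a, b, mul_comm]

lemma mm_add (hC : SobC Ω C) (x x' y : KK Ω σ) : mm hC (x + x') y = mm hC x y + mm hC x' y := by
  apply Lp.ext
  filter_upwards [mm_ae hC (x + x') y, mm_ae hC x y, mm_ae hC x' y, Lp.coeFn_add (mm hC x y) (mm hC x' y),
    Lp.coeFn_add x.1.fst x'.1.fst] with z a b c d e
  rw [a, d, Pi.add_apply, b, c, Submodule.coe_add, WithLp.add_fst, e, Pi.add_apply]; ring

lemma mm_smul (hC : SobC Ω C) (c : ℝ) (x y : KK Ω σ) : mm hC (c • x) y = c • mm hC x y := by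
  apply Lp.ext
  filter_upwards [mm_ae hC (c • x) y, mm_ae hC x y, Lp.coeFn_smul c (mm hC x y),
    Lp.coeFn_smul c x.1.fst] with z a b d e
  rw [a, d, Pi.smul_apply, b, Submodule.coe_smul, WithLp.smul_fst, e, Pi.smul_apply, smul_eq_mul, smul_eq_mul]; ring

def mB (hC : SobC Ω C) : KK Ω σ →ₗ[ℝ] KK Ω σ →ₗ[ℝ] Lp ℝ 2 (volume : Measure (Euc n)) :=
  LinearMap.mk₂ ℝ (mm hC) (mm_add hC) (mm_smul hC)
    (fun x y z => by rw [mm_symm, mm_add, mm_symm, mm_symm hC z]) (fun c x y => by rw [mm_symm, mm_smul, mm_symm])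

lemma mB_apply (hC : SobC Ω C) (x y : KK Ω σ) : mB hC x y = mm hC x y := rfl

lemma mm_inner (hC : SobC Ω C) (x y z w : KK Ω σ) :
    (inner ℝ (mm hC x y) (mm hC z w) : ℝ) = ∫ t, x.1.fst t * y.1.fst t * (z.1.fst t * w.1.fst t) := by
  rw [L2.inner_def]
  refine integral_congr_ae ?_
  filter_upwards [mm_ae hC x y, mm_ae hC z w] with t a b
  rw [a, b, real_inner_eq_re_inner, RCLike.inner_apply]
  simp; ring

lemma mm_swap (hC : SobC Ω C) (x y z w : KK Ω σ) :
    (inner ℝ (mm hC x y) (mm hC z w) : ℝ) = inner ℝ (mm hC x z) (mm hC y w) := by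
  rw [mm_inner, mm_inner]; congr 1; ext t; ring

lemma mm_sq_le (hC : SobC Ω C) (x : KK Ω σ) : ‖mm hC x x‖ ^ 2 ≤ ‖x.1.fst‖ * (C * ‖x‖) ^ 3 := by
  have h6 := KK.memLp6 hC.le x.2
  have h2 := Lp.memLp x.1.fst
  have h := cs_int h2 (cube_memLp h6)
  rw [int_six h6] at h
  rw [← real_inner_self_eq_norm_sq, mm_inner]
  have e : ∫ t, x.1.fst t * x.1.fst t * (x.1.fst t * x.1.fst t) = ∫ t, x.1.fst t * x.1.fst t ^ 3 := by
    congr 1; ext t; ring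
  rw [e]
  refine (le_abs_self _).trans (h.trans ?_)
  have e2 : √(∫ t, x.1.fst t ^ 2) = ‖x.1.fst‖ := by
    rw [← sqrt_sq (norm_nonneg x.1.fst), norm_sq_L2]; simp
  rw [e2]
  gcongr
  have := ENNReal.toReal_mono (ENNReal.mul_ne_top ENNReal.ofReal_ne_top ENNReal.ofReal_ne_top) (KK.L6 hC.le x.2)
  rw [ENNReal.toReal_mul, ENNReal.toReal_ofReal hC.pos.le, ENNReal.toReal_ofReal (norm_nonneg _)] at this
  exact this

lemma mm_le (hC : SobC Ω C) (x : KK Ω σ) : ‖mm hC x x‖ ≤ (C ^ 3 + 1) * ‖x‖ ^ 2 := by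
  have h := mm_sq_le hC x
  have h1 : ‖x.1.fst‖ ≤ ‖x‖ := VV_fst_le x.1
  have h0 := hC.pos
  have hp : 0 < C ^ 3 := by positivity
  have h2 : ‖mm hC x x‖ ^ 2 ≤ ((C ^ 3 + 1) * ‖x‖ ^ 2) ^ 2 := by
    calc _ ≤ ‖x.1.fst‖ * (C * ‖x‖) ^ 3 := h
      _ ≤ ‖x‖ * (C * ‖x‖) ^ 3 := by gcongr
      _ = C ^ 3 * ‖x‖ ^ 4 := by ring
      _ ≤ (C ^ 3 + 1) ^ 2 * ‖x‖ ^ 4 := by gcongr; nlinarith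
      _ = _ := by ring
  exact (abs_le_of_sq_le_sq' h2 (by positivity)).2

lemma mm_cs (hC : SobC Ω C) (x y : KK Ω σ) : ‖mm hC x y‖ ^ 2 ≤ ‖mm hC x x‖ * ‖mm hC y y‖ := by
  rw [← real_inner_self_eq_norm_sq, mm_swap]
  exact real_inner_le_norm _ _

end mm

lemma KK.rellich {n : ℕ} (hn : 2 ≤ n) {Ω : Set (Euc n)} (hΩ : Bornology.IsBounded Ω) {σ : ℕ → Euc n → Euc n}
    {x : ℕ → VV n} (hx : ∀ k, x k ∈ KK Ω (σ k)) {R : ℝ} (hR : ∀ k, ‖x k‖ ≤ R)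
    (hw : ∀ h : Lp ℝ 2 (volume : Measure (Euc n)), Filter.Tendsto (fun k => (inner ℝ h (x k).fst : ℝ)) Filter.atTop (𝓝 0)) :
    Filter.Tendsto (fun k => ‖(x k).fst‖) Filter.atTop (𝓝 0) := by
  have h : ∀ k : ℕ, ∃ φ z, Test Ω φ ∧ IsJet φ z ∧ ‖x k - z‖ ≤ 1 / ((k:ℝ) + 1) := fun k => by
    obtain ⟨φ, z, h1, h2, h3, h4⟩ := KK.seq (hx k)
    have h0 : Filter.Tendsto (fun j => ‖x k - z j‖) Filter.atTop (𝓝 0) := by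
      have := (tendsto_const_nhds (x := x k)).sub h4
      rw [sub_self] at this
      simpa using this.norm
    obtain ⟨j, hj⟩ := (h0.eventually (Iio_mem_nhds (show (0:ℝ) < 1 / ((k:ℝ) + 1) by positivity))).exists
    exact ⟨φ j, z j, h1 j, h3 j, le_of_lt hj⟩
  choose φ z h1 h2 h3 using h
  have ht : Filter.Tendsto (fun k : ℕ => 1 / ((k:ℝ) + 1)) Filter.atTop (𝓝 0) := tendsto_one_div_add_atTop_nhds_zero_nat
  have hz : ∀ k, ‖z k‖ ≤ R + 1 := fun k => by
    have e : z k = x k - (x k - z k) := by abel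
    have : 1 / ((k:ℝ) + 1) ≤ 1 := by rw [div_le_one (by positivity)]; linarith [Nat.cast_nonneg (α := ℝ) k]
    rw [e]
    calc _ ≤ ‖x k‖ + ‖x k - z k‖ := norm_sub_le _ _
      _ ≤ _ := add_le_add (hR k) ((h3 k).trans this)
  have hz1 : ∀ k, ∫ y, φ k y ^ 2 = ‖(z k).fst‖ ^ 2 := fun k => by
    rw [norm_sq_L2]
    refine integral_congr_ae ?_
    filter_upwards [(h2 k).1] with y a
    rw [a, norm_eq_abs, sq_abs]
  have hz2 : ∀ k, ∫ y, ‖gradient (φ k) y‖ ^ 2 = ‖(z k).snd‖ ^ 2 := fun k => by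
    rw [norm_sq_L2]
    refine integral_congr_ae ?_
    filter_upwards [(h2 k).2] with y a
    rw [a]
  have hsmall : Filter.Tendsto (fun k => ‖(x k - z k).fst‖) Filter.atTop (𝓝 0) :=
    squeeze_zero (fun _ => norm_nonneg _) (fun k => (VV_fst_le _).trans (h3 k)) ht
  have key := _root_.rellich hn hΩ h1 (C := (R+1)^2)
    (fun k => by rw [hz2]; gcongr; exact (VV_snd_le _).trans (hz k))
    (fun k => by rw [hz1]; gcongr; exact (VV_fst_le _).trans (hz k))
    (fun h hh => by
      have e : ∀ k, ∫ y, h y * φ k y = inner ℝ (hh.toLp h) (x k).fst - inner ℝ (hh.toLp h) (x k - z k).fst := fun k => by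
        rw [← inner_sub_right, WithLp.sub_fst, sub_sub_cancel, L2.inner_def]
        refine integral_congr_ae ?_
        filter_upwards [hh.coeFn_toLp, (h2 k).1] with y a b
        rw [a, b]; simp [mul_comm]
      simp only [e]
      have t2 : Filter.Tendsto (fun k => (inner ℝ (hh.toLp h) (x k - z k).fst : ℝ)) Filter.atTop (𝓝 0) := by
        rw [tendsto_zero_iff_norm_tendsto_zero]
        refine squeeze_zero (fun _ => norm_nonneg _) (fun k => norm_inner_le_norm _ _) ?_
        simpa using hsmall.const_mul ‖hh.toLp h‖
      simpa using (hw (hh.toLp h)).sub t2)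
  simp only [hz1] at key
  have key2 : Filter.Tendsto (fun k => ‖(z k).fst‖) Filter.atTop (𝓝 0) := by
    have := key.sqrt
    simpa [sqrt_sq] using this
  refine squeeze_zero (fun _ => norm_nonneg _) (fun k => ?_) (by simpa using key2.add hsmall)
  have e : (x k).fst = (z k).fst + (x k - z k).fst := by rw [WithLp.sub_fst]; abel
  exact (le_of_eq (congrArg norm e)).trans (norm_add_le (z k).fst (x k - z k).fst)

section vd
variable {n : ℕ} {Ω : Set (Euc n)} {σ : Euc n → Euc n} {C : ℝ}

def AA (lam : ℝ) : KK Ω σ →L[ℝ] KK Ω σ →L[ℝ] ℝ :=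
  let S : KK Ω σ →L[ℝ] Lp (Euc n) 2 (volume : Measure (Euc n)) := (WithLp.sndL 2 ℝ _ _).comp (KK Ω σ).subtypeL
  let F : KK Ω σ →L[ℝ] Lp ℝ 2 (volume : Measure (Euc n)) := (WithLp.fstL 2 ℝ _ _).comp (KK Ω σ).subtypeL
  (innerSL ℝ).bilinearComp S S + lam • (innerSL ℝ).bilinearComp F F

lemma AA_apply (lam : ℝ) (x y : KK Ω σ) :
    AA lam x y = inner ℝ x.1.snd y.1.snd + lam * inner ℝ x.1.fst y.1.fst := rfl

lemma mm_weak (hn : 2 ≤ n) (hΩ : Bornology.IsBounded Ω) (hC : SobC Ω C) (x : ℕ → KK Ω σ) (y : KK Ω σ)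
    (hR : ∃ R, ∀ k, ‖x k‖ ≤ R)
    (hw : ∀ f : KK Ω σ →L[ℝ] ℝ, Filter.Tendsto (fun k => f (x k)) Filter.atTop (𝓝 (f y))) :
    Filter.Tendsto (fun k => mm hC (x k) (x k)) Filter.atTop (𝓝 (mm hC y y)) := by
  obtain ⟨R, hR⟩ := hR
  have hR0 : 0 ≤ R := (norm_nonneg _).trans (hR 0)
  have hb : ∀ k, ‖x k - y‖ ≤ R + ‖y‖ := fun k => (norm_sub_le _ _).trans (add_le_add_left (hR k) _)
  have hb2 : ∀ k, ‖x k + y‖ ≤ R + ‖y‖ := fun k => (norm_add_le _ _).trans (add_le_add_left (hR k) _)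
  have hs := KK.rellich hn hΩ (σ := fun _ => σ) (x := fun k => ((x k - y : KK Ω σ) : VV n)) (fun k => (x k - y).2)
    (R := R + ‖y‖) hb (fun h => by
      let f : KK Ω σ →L[ℝ] ℝ := (innerSL ℝ h).comp ((WithLp.fstL 2 ℝ _ _).comp (KK Ω σ).subtypeL)
      have := (hw f).sub_const (f y)
      rw [sub_self] at this
      refine this.congr fun k => ?_
      rw [← map_sub]; rfl)
  rw [tendsto_iff_norm_sub_tendsto_zero]
  have e : ∀ k, mm hC (x k) (x k) - mm hC y y = mm hC (x k - y) (x k + y) := fun k => by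
    simp only [← mB_apply, map_sub, map_add, LinearMap.sub_apply]
    rw [show mB hC y (x k) = mB hC (x k) y from mm_symm hC _ _]; abel
  have hle : ∀ k, ‖mm hC (x k) (x k) - mm hC y y‖ ≤
      √(√(‖((x k - y : KK Ω σ) : VV n).fst‖ * (C * (R + ‖y‖)) ^ 3) * ((C ^ 3 + 1) * (R + ‖y‖) ^ 2)) := fun k => by
    rw [e]
    apply le_sqrt_of_sq_le
    refine (mm_cs hC _ _).trans ?_
    have h0 := hC.pos
    refine mul_le_mul ?_ ?_ (norm_nonneg _) (sqrt_nonneg _)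
    · apply le_sqrt_of_sq_le
      refine (mm_sq_le hC _).trans ?_
      gcongr
      exact hb k
    · refine (mm_le hC _).trans ?_
      gcongr
      exact hb2 k
  refine squeeze_zero (fun _ => norm_nonneg _) hle ?_
  have := (((hs.mul_const ((C * (R + ‖y‖)) ^ 3)).sqrt).mul_const ((C ^ 3 + 1) * (R + ‖y‖) ^ 2)).sqrt
  simpa using this

/-- the variational data -/
def vdata {ι : Type*} [Fintype ι] (hn : 2 ≤ n) (hΩ : Bornology.IsBounded Ω) (hC : SobC Ω C) (σ : Euc n → Euc n)
    (lam : ι → ℝ) (κ : ℝ) (hκ : 0 < κ) (hκ1 : κ ≤ 1) (hlam : ∀ i, κ ≤ lam i) (b : ι → ι → ℝ)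
    (b_symm : ∀ i j, b i j = b j i) (b_diag : ∀ i, 0 < b i i) (b_off : ∀ i j, i ≠ j → b i j ≤ 0) :
    VData ι (KK Ω σ) (Lp ℝ 2 (volume : Measure (Euc n))) where
  A i := AA (lam i)
  A_symm i x y := by
    rw [AA_apply, AA_apply, real_inner_comm, real_inner_comm x.1.fst]
  κ := κ
  κ_pos := hκ
  A_coer i x := by
    have := WithLp.prod_norm_sq_eq_of_L2 x.1
    have e : ‖x‖ = ‖x.1‖ := rfl
    rw [AA_apply, e, this, real_inner_self_eq_norm_sq, real_inner_self_eq_norm_sq]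
    have h1 := mul_le_mul_of_nonneg_right hκ1 (sq_nonneg ‖x.1.snd‖)
    have h2 := mul_le_mul_of_nonneg_right (hlam i) (sq_nonneg ‖x.1.fst‖)
    linarith
  m := mB hC
  m_symm := mm_symm hC
  m_swap := mm_swap hC
  C := C ^ 3 + 1
  C_pos := by have := hC.pos; positivity
  m_le := mm_le hC
  b := b
  b_symm := b_symm
  b_diag := b_diag
  b_off := b_off
  comp := by
    have : TopologicalSpace.SeparableSpace (KK Ω σ) := by
      have : SecondCountableTopology (VV n) := UniformSpace.secondCountable_of_separable _
      infer_instance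
    have : CompleteSpace (KK Ω σ) := (Submodule.isClosed_topologicalClosure _).completeSpace_coe
    exact fun x h => weak_comp x h
  weak := mm_weak hn hΩ hC

end vd
end

noncomputable section
open Real MeasureTheory Finset
open scoped ContDiff Topology

lemma VData.feas_of_disjoint {ι H L : Type*} [Fintype ι] [DecidableEq ι] [NormedAddCommGroup H] [NormedSpace ℝ H]
    [NormedAddCommGroup L] [InnerProductSpace ℝ L] (D : VData ι H L) (y : ι → H)
    (h : ∀ i, D.m (y i) (y i) ≠ 0) (h0 : ∀ i k, i ≠ k → D.m (y i) (y k) = 0) : ∃ x, D.Feas x := by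
  set a : ι → ℝ := fun i => D.A i (y i) (y i) / (D.b i i * ‖D.m (y i) (y i)‖ ^ 2) with ha
  have hpos : ∀ i, 0 < D.b i i * ‖D.m (y i) (y i)‖ ^ 2 := fun i =>
    mul_pos (D.b_diag i) (pow_pos (norm_pos_iff.2 (h i)) 2)
  have ha0 : ∀ i, 0 ≤ a i := fun i => div_nonneg (D.A_nonneg i _) (hpos i).le
  set T : ℝ := ∑ i, a i + 1 with hT
  have hT0 : 0 < T := by have := Finset.sum_nonneg (s := univ) (fun i _ => ha0 i); linarith
  have hTa : ∀ i, a i ≤ T := fun i => by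
    have := Finset.single_le_sum (f := a) (fun i _ => ha0 i) (mem_univ i); linarith
  set t := √T with ht
  have ht2 : t ^ 2 = T := sq_sqrt hT0.le
  have ht0 : 0 < t := sqrt_pos.2 hT0
  refine ⟨fun i => t • y i, fun i => ⟨?_, ?_⟩⟩
  · intro hz
    have : y i = 0 := (smul_eq_zero.1 hz).resolve_left ht0.ne'
    exact h i (by rw [this]; simp)
  · unfold VData.rhs
    rw [Finset.sum_eq_single i]
    · rw [D.q_self]
      simp only [map_smul, LinearMap.smul_apply, ContinuousLinearMap.smul_apply, norm_smul, norm_eq_abs, abs_of_pos ht0,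
        smul_eq_mul]
      have := hTa i
      rw [ha, div_le_iff₀ (hpos i), ← ht2] at this
      nlinarith [sq_nonneg t]
    · intro k _ hk
      rw [D.q_eq]
      simp [h0 i k hk.symm]
    · simp

section rot
variable {n : ℕ}

lemma rotPt_comp (hn : n = 2 ∨ n = 3) (a b : ℝ) (x : Euc n) : rotPt a (rotPt b x) = rotPt (a + b) x := by
  rcases hn with rfl | rfl
  · ext i; fin_cases i <;> simp [rotPt, cos_add, sin_add] <;> ring
  · ext i; fin_cases i <;> simp [rotPt, cos_add, sin_add] <;> ring

lemma rotPt_zero (hn : n = 2 ∨ n = 3) (x : Euc n) : rotPt 0 x = x := by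
  rcases hn with rfl | rfl
  · ext i; fin_cases i <;> simp [rotPt]
  · ext i; fin_cases i <;> simp [rotPt]

lemma rotPt_add (θ : ℝ) (x y : Euc n) : rotPt θ (x + y) = rotPt θ x + rotPt θ y := by
  ext i; simp only [rotPt, PiLp.add_apply]; split_ifs <;> ring
lemma rotPt_smul (θ c : ℝ) (x : Euc n) : rotPt θ (c • x) = c • rotPt θ x := by
  ext i; simp only [rotPt, PiLp.smul_apply, smul_eq_mul]; split_ifs <;> ring

lemma rotPt_norm (hn : n = 2 ∨ n = 3) (θ : ℝ) (x : Euc n) : ‖rotPt θ x‖ = ‖x‖ := by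
  have h := sin_sq_add_cos_sq θ
  rcases hn with rfl | rfl
  · rw [EuclideanSpace.norm_eq, EuclideanSpace.norm_eq]
    congr 1
    simp [rotPt, Fin.sum_univ_two]
    linear_combination (x 0 ^ 2 + x 1 ^ 2) * h
  · rw [EuclideanSpace.norm_eq, EuclideanSpace.norm_eq]
    congr 1
    simp [rotPt, Fin.sum_univ_three]
    linear_combination (x 0 ^ 2 + x 1 ^ 2) * h

lemma rotPt_two_pi (hn : n = 2 ∨ n = 3) (x : Euc n) : rotPt (2 * π) x = x := by
  rcases hn with rfl | rfl
  · ext i; fin_cases i <;> simp [rotPt]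
  · ext i; fin_cases i <;> simp [rotPt]

/-- rotation as a linear isometry -/
def rotL (hn : n = 2 ∨ n = 3) (θ : ℝ) : Euc n ≃ₗᵢ[ℝ] Euc n where
  toFun := rotPt θ
  map_add' := rotPt_add θ
  map_smul' := rotPt_smul θ
  invFun := rotPt (-θ)
  left_inv x := by rw [rotPt_comp hn, neg_add_cancel, rotPt_zero hn]
  right_inv x := by rw [rotPt_comp hn, add_neg_cancel, rotPt_zero hn]
  norm_map' := rotPt_norm hn θ

lemma rotL_apply (hn : n = 2 ∨ n = 3) (θ : ℝ) (x : Euc n) : rotL hn θ x = rotPt θ x := rfl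

lemma rot_iter (hn : n = 2 ∨ n = 3) (θ : ℝ) (i : ℕ) (x : Euc n) : (rotPt θ)^[i] x = rotPt (i * θ) x := by
  induction i generalizing x with
  | zero => simp [rotPt_zero hn]
  | succ i ih =>
    rw [Function.iterate_succ_apply, ih, rotPt_comp hn]; congr 1; push_cast; ring

/-- the domain is invariant under norm preserving maps -/
lemma RadialDomain.mem_iff {Ω : Set (Euc n)} (h : RadialDomain Ω) {x y : Euc n} (hxy : ‖x‖ = ‖y‖) : x ∈ Ω ↔ y ∈ Ω := by
  rcases h with ⟨R, hR, rfl⟩ | ⟨r, R, hr, hR, rfl⟩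
  · simp [hxy]
  · show (r < ‖x‖ ∧ ‖x‖ < R) ↔ (r < ‖y‖ ∧ ‖y‖ < R)
    rw [hxy]

lemma RadialDomain.isOpen {Ω : Set (Euc n)} (h : RadialDomain Ω) : IsOpen Ω := by
  rcases h with ⟨R, hR, rfl⟩ | ⟨r, R, hr, hR, rfl⟩
  · exact Metric.isOpen_ball
  · exact (isOpen_lt continuous_const continuous_norm).inter (isOpen_lt continuous_norm continuous_const)

lemma RadialDomain.isBounded {Ω : Set (Euc n)} (h : RadialDomain Ω) : Bornology.IsBounded Ω := by
  rcases h with ⟨R, hR, rfl⟩ | ⟨r, R, hr, hR, rfl⟩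
  · exact Metric.isBounded_ball
  · refine Metric.isBounded_ball (x := (0 : Euc n)) (r := R) |>.subset fun x hx => ?_
    simpa using hx.2

lemma RadialDomain.shell {Ω : Set (Euc n)} (h : RadialDomain Ω) : ∃ a b : ℝ, 0 < a ∧ a < b ∧
    ∀ x : Euc n, a < ‖x‖ ^ 2 → ‖x‖ ^ 2 < b → x ∈ Ω := by
  rcases h with ⟨R, hR, rfl⟩ | ⟨r, R, hr, hR, rfl⟩
  · refine ⟨R ^ 2 / 2, R ^ 2, by positivity, by nlinarith [sq_pos_of_pos hR], fun x _ hx => ?_⟩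
    simpa using lt_of_pow_lt_pow_left₀ 2 hR.le hx
  · refine ⟨r ^ 2, R ^ 2, by positivity, by nlinarith, fun x hx1 hx2 => ?_⟩
    exact ⟨lt_of_pow_lt_pow_left₀ 2 (norm_nonneg x) hx1, lt_of_pow_lt_pow_left₀ 2 (hr.trans hR).le hx2⟩

lemma Test.comp_rot (hn : n = 2 ∨ n = 3) {Ω : Set (Euc n)} (hΩ : RadialDomain Ω) {φ : Euc n → ℝ} (hφ : Test Ω φ) (θ : ℝ) :
    Test Ω (fun x => φ (rotPt θ x)) := by
  have hs : tsupport (fun x => φ (rotPt θ x)) = (rotL hn θ).toHomeomorph ⁻¹' tsupport φ :=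
    tsupport_comp_eq_preimage φ (rotL hn θ).toHomeomorph
  refine ⟨hφ.smooth.comp (rotL hn θ).contDiff, hφ.compact.comp_homeomorph (rotL hn θ).toHomeomorph, ?_⟩
  rw [hs]
  intro x hx
  exact (hΩ.mem_iff (rotPt_norm hn θ x)).1 (hφ.supp hx)

lemma gradient_rot (hn : n = 2 ∨ n = 3) {φ : Euc n → ℝ} (hφ : Differentiable ℝ φ) (θ : ℝ) (x : Euc n) :
    rotPt θ (gradient (fun y => φ (rotPt θ y)) x) = gradient φ (rotPt θ x) := by
  refine ext_inner_right ℝ fun w => ?_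
  obtain ⟨v, rfl⟩ := (rotL hn θ).surjective w
  rw [rotL_apply, inner_gradient]
  have h1 : inner ℝ (rotPt θ (gradient (fun y => φ (rotPt θ y)) x)) (rotPt θ v) =
      inner ℝ (gradient (fun y => φ (rotPt θ y)) x) v := (rotL hn θ).inner_map_map _ _
  rw [h1, inner_gradient]
  have h2 : HasFDerivAt (fun y => φ (rotPt θ y)) ((fderiv ℝ φ (rotPt θ x)).comp
      ((rotL hn θ).toContinuousLinearEquiv : Euc n →L[ℝ] Euc n)) x :=
    (hφ (rotPt θ x)).hasFDerivAt.comp x (rotL hn θ).toContinuousLinearEquiv.hasFDerivAt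
  rw [h2.fderiv]; rfl

lemma rot_mp (hn : n = 2 ∨ n = 3) (θ : ℝ) : MeasurePreserving (rotPt θ : Euc n → Euc n) volume volume :=
  (rotL hn θ).measurePreserving

lemma rot_int (hn : n = 2 ∨ n = 3) (θ : ℝ) (f : Euc n → ℝ) : ∫ x, f (rotPt θ x) = ∫ x, f x :=
  (rot_mp hn θ).integral_comp (rotL hn θ).toHomeomorph.measurableEmbedding f

/-- elements of the space are antisymmetric -/
lemma KK.anti (hn : n = 2 ∨ n = 3) {Ω : Set (Euc n)} {θ : ℝ} {x : VV n} (hx : x ∈ KK Ω (rotPt θ)) :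
    (∀ᵐ y, x.fst (rotPt θ y) = - x.fst y) ∧ (∀ᵐ y, x.snd (rotPt θ y) = - rotPt θ (x.snd y)) := by
  obtain ⟨φ, z, h1, h2, h3, h4⟩ := KK.seq hx
  obtain ⟨s, hs, e1, e2⟩ := KK.ae_seq h3 h4
  have q := (rot_mp (n := n) hn θ).quasiMeasurePreserving
  constructor
  · filter_upwards [e1, q.ae e1] with y a b
    simp only [h2] at b
    exact tendsto_nhds_unique b a.neg
  · filter_upwards [e2, q.ae e2] with y a b
    have e : ∀ k, gradient (φ k) (rotPt θ y) = - rotPt θ (gradient (φ k) y) := fun k => by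
      rw [← gradient_rot hn ((h1 k).cd1.differentiable (by norm_num)) θ y]
      simp only [h2]
      have : gradient (fun y => - φ k y) y = - gradient (φ k) y := by
        unfold gradient; rw [fderiv_fun_neg, map_neg]
      rw [this]
      exact map_neg (rotL hn θ) _
    simp only [e] at b
    exact tendsto_nhds_unique b ((((rotL hn θ).continuous.tendsto _).comp a).neg)

lemma anti_zero (hn : n = 2 ∨ n = 3) {Ω : Set (Euc n)} (hΩ : RadialDomain Ω) {k : ℕ} (hk : 0 < k)
    {T : (Euc n → ℝ) → ℝ} (hadd : ∀ φ ψ, Test Ω φ → Test Ω ψ → T (fun x => φ x + ψ x) = T φ + T ψ)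
    (hsmul : ∀ (c : ℝ) φ, Test Ω φ → T (fun x => c * φ x) = c * T φ)
    (hR : ∀ φ, Test Ω φ → T (fun x => φ (rotPt (π / k) x)) = - T φ)
    (h0 : ∀ φ, Test Ω φ → (∀ y, φ (rotPt (π / k) y) = - φ y) → T φ = 0) {φ : Euc n → ℝ} (hφ : Test Ω φ) : T φ = 0 := by
  set R : Euc n → Euc n := rotPt (π / k) with hRd
  have hit : ∀ i : ℕ, Test Ω (fun x => φ (R^[i] x)) ∧ T (fun x => φ (R^[i] x)) = (-1) ^ i * T φ := fun i => by
    induction i with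
    | zero => exact ⟨by simpa using hφ, by simp⟩
    | succ i ih =>
      have e : (fun x => φ (R^[i+1] x)) = fun x => (fun x => φ (R^[i] x)) (R x) := by
        ext x; rw [Function.iterate_succ_apply]
      rw [e]
      refine ⟨ih.1.comp_rot hn hΩ _, ?_⟩
      rw [hR _ ih.1, ih.2, pow_succ]; ring
  have hsum : ∀ m : ℕ, Test Ω (fun x => ∑ i ∈ range m, (-1:ℝ) ^ i * φ (R^[i] x)) ∧
      T (fun x => ∑ i ∈ range m, (-1:ℝ) ^ i * φ (R^[i] x)) = m * T φ := fun m => by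
    induction m with
    | zero =>
      refine ⟨by simpa using Test.zero Ω, ?_⟩
      have := hsmul 0 φ hφ
      simpa using this
    | succ m ih =>
      have e : (fun x => ∑ i ∈ range (m+1), (-1:ℝ) ^ i * φ (R^[i] x)) =
        fun x => (fun x => ∑ i ∈ range m, (-1:ℝ) ^ i * φ (R^[i] x)) x + (fun x => (-1:ℝ) ^ m * φ (R^[m] x)) x := by
        ext x; rw [Finset.sum_range_succ]
      rw [e]
      have t := (hit m).1.cmul ((-1:ℝ) ^ m)
      refine ⟨ih.1.add t, ?_⟩
      rw [hadd _ _ ih.1 t, ih.2, hsmul _ _ (hit m).1, (hit m).2, ← mul_assoc, ← mul_pow]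
      push_cast; norm_num; ring
  have hend : ∀ y, R^[2 * k] y = y := fun y => by
    rw [hRd, rot_iter hn]
    have : ((2 * k : ℕ) : ℝ) * (π / k) = 2 * π := by push_cast; field_simp
    rw [this, rotPt_two_pi hn]
  have ha := h0 _ (hsum (2 * k)).1 (fun y => by
    have s1 := Finset.sum_range_succ (fun i => (-1:ℝ) ^ i * φ (R^[i] y)) (2 * k)
    have s2 := Finset.sum_range_succ' (fun i => (-1:ℝ) ^ i * φ (R^[i] y)) (2 * k)
    have s3 : ∑ i ∈ range (2 * k), (-1:ℝ) ^ i * φ (R^[i] (R y)) =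
        - ∑ i ∈ range (2 * k), (-1:ℝ) ^ (i+1) * φ (R^[i+1] y) := by
      rw [← Finset.sum_neg_distrib]
      refine Finset.sum_congr rfl fun i _ => ?_
      rw [Function.iterate_succ_apply, pow_succ]; ring
    rw [s3]
    rw [hend, pow_mul] at s1
    simp [-Function.iterate_succ] at s1 s2
    linarith)
  rw [(hsum (2 * k)).2] at ha
  have : ((2 * k : ℕ) : ℝ) ≠ 0 := by positivity
  exact (mul_eq_zero.1 ha).resolve_left this

/-- antisymmetric harmonic polynomial -/
def hpoly (hn : 2 ≤ n) (k : ℕ) (x : Euc n) : ℝ :=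
  (((x ⟨0, by omega⟩ : ℂ) + (x ⟨1, by omega⟩ : ℂ) * Complex.I) ^ k).re

lemma hpoly_smooth (hn : 2 ≤ n) (k : ℕ) : ContDiff ℝ ∞ (hpoly hn k) := by
  have h0 : ∀ i : Fin n, ContDiff ℝ ∞ (fun x : Euc n => ((x i : ℝ) : ℂ)) := fun i =>
    Complex.ofRealCLM.contDiff.comp (EuclideanSpace.proj i : Euc n →L[ℝ] ℝ).contDiff
  exact Complex.reCLM.contDiff.comp (((h0 _).add ((h0 _).mul contDiff_const)).pow k)

lemma hpoly_rot (hn : n = 2 ∨ n = 3) (hn2 : 2 ≤ n) {k : ℕ} (hk : 0 < k) (x : Euc n) :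
    hpoly hn2 k (rotPt (π / k) x) = - hpoly hn2 k x := by
  have key : ((rotPt (π / k) x ⟨0, by omega⟩ : ℝ) : ℂ) + ((rotPt (π / k) x ⟨1, by omega⟩ : ℝ) : ℂ) * Complex.I =
      Complex.exp ((π / k : ℝ) * Complex.I) *
        ((x ⟨0, by omega⟩ : ℂ) + (x ⟨1, by omega⟩ : ℂ) * Complex.I) := by
    rw [Complex.exp_mul_I, ← Complex.ofReal_cos, ← Complex.ofReal_sin]
    rcases hn with rfl | rfl
    · simp [rotPt, -Complex.ofReal_cos, -Complex.ofReal_sin]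
      linear_combination (-(Real.sin (π / k) : ℂ) * (x 1 : ℂ)) * Complex.I_sq
    · simp [rotPt, -Complex.ofReal_cos, -Complex.ofReal_sin]
      linear_combination (-(Real.sin (π / k) : ℂ) * (x 1 : ℂ)) * Complex.I_sq
  unfold hpoly
  rw [key, mul_pow, ← Complex.exp_nat_mul]
  have : (k : ℂ) * ((π / k : ℝ) * Complex.I) = π * Complex.I := by
    have : (k : ℂ) ≠ 0 := by exact_mod_cast hk.ne'
    push_cast; field_simp
  rw [this, Complex.exp_pi_mul_I]; simp

end rot
end

noncomputable section
open Real MeasureTheory Finset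
open scoped ContDiff Topology

section bumps
variable {n : ℕ}

/-- radial bump times harmonic polynomial -/
def bfun (hn : 2 ≤ n) (k : ℕ) {c : ℝ} (f : ContDiffBump c) (x : Euc n) : ℝ := f (‖x‖ ^ 2) * hpoly hn k x

lemma bfun_test (hn : 2 ≤ n) (k : ℕ) {c : ℝ} (f : ContDiffBump c) {Ω : Set (Euc n)}
    (h : ∀ x : Euc n, ‖x‖ ^ 2 ∈ Metric.closedBall c f.rOut → x ∈ Ω) : Test Ω (bfun hn k f) := by
  have hcl : IsClosed {x : Euc n | ‖x‖ ^ 2 ∈ Metric.closedBall c f.rOut} :=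
    Metric.isClosed_closedBall.preimage (by fun_prop)
  have hs : tsupport (bfun hn k f) ⊆ {x : Euc n | ‖x‖ ^ 2 ∈ Metric.closedBall c f.rOut} := by
    refine closure_minimal (fun x hx => ?_) hcl
    have h1 : f (‖x‖ ^ 2) ≠ 0 := left_ne_zero_of_mul hx
    have h2 : ‖x‖ ^ 2 ∈ Function.support f := h1
    rw [f.support_eq] at h2
    exact Metric.ball_subset_closedBall h2
  refine ⟨?_, ?_, hs.trans fun x hx => h x hx⟩
  · exact (f.contDiff.comp (contDiff_norm_sq ℝ)).mul (hpoly_smooth hn k)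
  · refine HasCompactSupport.of_support_subset_isCompact (K := Metric.closedBall 0 (√(c + f.rOut)))
      (isCompact_closedBall _ _) fun x hx => ?_
    have := hs (subset_tsupport _ hx)
    have h2 : ‖x‖ ^ 2 ∈ Metric.closedBall c f.rOut := this
    rw [Metric.mem_closedBall, Real.dist_eq] at h2
    have h3 := (abs_le.1 h2).2
    rw [mem_closedBall_zero_iff]
    exact le_sqrt_of_sq_le (by linarith)

lemma bfun_rot (hn : n = 2 ∨ n = 3) (hn2 : 2 ≤ n) {k : ℕ} (hk : 0 < k) {c : ℝ} (f : ContDiffBump c) (x : Euc n) :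
    bfun hn2 k f (rotPt (π / k) x) = - bfun hn2 k f x := by
  unfold bfun; rw [rotPt_norm hn, hpoly_rot hn hn2 hk]; ring

lemma bfun_ne (hn : 2 ≤ n) (k : ℕ) {c : ℝ} (hc : 0 < c) (f : ContDiffBump c) : ∃ x : Euc n, bfun hn k f x ≠ 0 := by
  refine ⟨EuclideanSpace.single ⟨0, by omega⟩ (√c), ?_⟩
  unfold bfun hpoly
  have h1 : ‖(EuclideanSpace.single ⟨0, by omega⟩ (√c) : Euc n)‖ ^ 2 = c := by
    rw [EuclideanSpace.norm_single, norm_eq_abs, sq_abs, sq_sqrt hc.le]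
  rw [h1, f.one_of_mem_closedBall (Metric.mem_closedBall_self f.rIn_pos.le)]
  have e : (⟨1, by omega⟩ : Fin n) ≠ ⟨0, by omega⟩ := by simp
  simp only [EuclideanSpace.single_apply, if_true, e, if_false]
  have : 0 < √c ^ k := pow_pos (sqrt_pos.2 hc) k
  rw [one_mul, Complex.ofReal_zero, zero_mul, add_zero, ← Complex.ofReal_pow, Complex.ofReal_re]
  exact this.ne'

/-- disjointly supported antisymmetric test functions -/
lemma exists_tests (hn : n = 2 ∨ n = 3) {Ω : Set (Euc n)} (hΩ : RadialDomain Ω) {k : ℕ} (hk : 0 < k) (N : ℕ) :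
    ∃ φ : Fin N → Euc n → ℝ, (∀ i, Test Ω (φ i)) ∧ (∀ i y, φ i (rotPt (π / k) y) = - φ i y) ∧
      (∀ i, ∃ x, φ i x ≠ 0) ∧ ∀ i j, i ≠ j → ∀ x, φ i x * φ j x = 0 := by
  have hn2 : 2 ≤ n := by omega
  obtain ⟨a, b, ha, hab, h⟩ := hΩ.shell
  rcases Nat.eq_zero_or_pos N with rfl | hN
  · exact ⟨fun i => i.elim0, fun i => i.elim0, fun i => i.elim0, fun i => i.elim0, fun i => i.elim0⟩
  have hN' : (0:ℝ) < N := by exact_mod_cast hN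
  set d : ℝ := (b - a) / N with hd
  have hd0 : 0 < d := div_pos (by linarith) hN'
  have hNd : N * d = b - a := by rw [hd]; field_simp
  let c : Fin N → ℝ := fun i => a + d * ((i:ℕ) + 1/2)
  let f : ∀ i : Fin N, ContDiffBump (c i) := fun i => ⟨d/8, d/4, by linarith, by linarith⟩
  have hc : ∀ i, a + d / 2 ≤ c i ∧ c i ≤ b - d / 2 := fun i => by
    have h1 : (0:ℝ) ≤ (i:ℕ) := Nat.cast_nonneg _
    have h2 : ((i:ℕ):ℝ) + 1 ≤ N := by exact_mod_cast i.2
    constructor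
    · show _ ≤ a + d * ((i:ℕ) + 1/2); nlinarith
    · show a + d * ((i:ℕ) + 1/2) ≤ _; nlinarith
  refine ⟨fun i => bfun hn2 k (f i), fun i => bfun_test hn2 k _ fun x hx => ?_, fun i y => bfun_rot hn hn2 hk _ y,
    fun i => bfun_ne hn2 k (by linarith [(hc i).1]) _, fun i j hij x => ?_⟩
  · rw [Metric.mem_closedBall, Real.dist_eq] at hx
    have hx' : |‖x‖ ^ 2 - c i| ≤ d / 4 := hx
    have := abs_le.1 hx'
    exact h x (by linarith [(hc i).1, this.1]) (by linarith [(hc i).2, this.2])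
  · by_contra hne
    have h1 := left_ne_zero_of_mul (left_ne_zero_of_mul hne)
    have h2 := left_ne_zero_of_mul (right_ne_zero_of_mul hne)
    have g1 : ‖x‖ ^ 2 ∈ Function.support (f i) := h1
    have g2 : ‖x‖ ^ 2 ∈ Function.support (f j) := h2
    rw [ContDiffBump.support_eq, Metric.mem_ball, Real.dist_eq] at g1 g2
    have g1' : |‖x‖ ^ 2 - (a + d * ((i:ℕ) + 1/2))| < d / 4 := g1
    have g2' : |‖x‖ ^ 2 - (a + d * ((j:ℕ) + 1/2))| < d / 4 := g2
    have k1 := abs_lt.1 g1'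
    have k2 := abs_lt.1 g2'
    rcases lt_or_gt_of_ne (fun e => hij (Fin.ext e) : (i:ℕ) ≠ j) with hlt | hlt
    · have : ((i:ℕ):ℝ) + 1 ≤ (j:ℕ) := by exact_mod_cast hlt
      nlinarith
    · have : ((j:ℕ):ℝ) + 1 ≤ (i:ℕ) := by exact_mod_cast hlt
      nlinarith

end bumps

lemma triple_memLp {α : Type*} [MeasurableSpace α] {μ : Measure α} {u v : α → ℝ} (hu : MemLp u 6 μ) (hv : MemLp v 6 μ) :
    MemLp (fun x => u x * v x ^ 2) 2 μ := by
  have hm : AEStronglyMeasurable (fun x => u x * v x ^ 2) μ := hu.1.mul (hv.1.pow 2)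
  have h : MemLp (fun x => |u x ^ 3| + |v x ^ 3|) 2 μ := (cube_memLp hu).abs.add (cube_memLp hv).abs
  refine h.mono hm (Filter.Eventually.of_forall fun x => ?_)
  have a0 := abs_nonneg (u x)
  have b0 := abs_nonneg (v x)
  rw [norm_eq_abs, norm_eq_abs, abs_of_nonneg (by positivity : 0 ≤ |u x ^ 3| + |v x ^ 3|), abs_mul, abs_pow, abs_pow, abs_pow]
  rcases le_total |u x| |v x| with hh | hh
  · have : |u x| * |v x| ^ 2 ≤ |v x| * |v x| ^ 2 := by gcongr
    nlinarith [pow_nonneg a0 3]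
  · have : |u x| * |v x| ^ 2 ≤ |u x| * |u x| ^ 2 := by gcongr
    nlinarith [pow_nonneg b0 3]

section weak
variable {n : ℕ} {Ω : Set (Euc n)} {C : ℝ} {N : ℕ}

/-- right-hand side -/
def FF (lam : Fin N → ℝ) (b : Fin N → Fin N → ℝ) (u : Fin N → Euc n → ℝ) (i : Fin N) (y : Euc n) : ℝ :=
  (∑ m, b i m * (u i y * u m y ^ 2)) - lam i * u i y

lemma FF_memLp {lam : Fin N → ℝ} {b : Fin N → Fin N → ℝ} {u : Fin N → Euc n → ℝ} (h2 : ∀ i, MemLp (u i) 2)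
    (h6 : ∀ i, MemLp (u i) 6) (i : Fin N) : MemLp (FF lam b u i) 2 := by
  have h1 : MemLp (fun y => ∑ m, b i m * (u i y * u m y ^ 2)) 2 :=
    memLp_finset_sum _ fun m _ => (triple_memLp (h6 i) (h6 m)).const_mul (b i m)
  exact h1.sub ((h2 i).const_mul (lam i))

lemma feas_vdata (hn : n = 2 ∨ n = 3) (hΩ : RadialDomain Ω) (hC : SobC Ω C) {k : ℕ} (hk : 0 < k)
    (lam : Fin N → ℝ) (κ : ℝ) (hκ : 0 < κ) (hκ1 : κ ≤ 1) (hlam : ∀ i, κ ≤ lam i) (b : Fin N → Fin N → ℝ)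
    (b_symm : ∀ i j, b i j = b j i) (b_diag : ∀ i, 0 < b i i) (b_off : ∀ i j, i ≠ j → b i j ≤ 0) :
    ∃ x, (vdata (by omega) hΩ.isBounded hC (rotPt (π / k)) lam κ hκ hκ1 hlam b b_symm b_diag b_off).Feas x := by
  obtain ⟨φ, h1, h2, h3, h4⟩ := exists_tests hn hΩ hk N
  refine VData.feas_of_disjoint _ (fun i => ⟨jet (h1 i), subset_closure ⟨φ i, h1 i, h2 i, jet_isJet _⟩⟩) (fun i => ?_)
    (fun i j hij => ?_)
  · show mm hC _ _ ≠ 0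
    intro h0
    obtain ⟨x, hx⟩ := h3 i
    have ae : (fun y => φ i y * φ i y) =ᵐ[volume] fun _ => (0:ℝ) := by
      filter_upwards [mm_ae hC ⟨jet (h1 i), subset_closure ⟨φ i, h1 i, h2 i, jet_isJet _⟩⟩
        ⟨jet (h1 i), subset_closure ⟨φ i, h1 i, h2 i, jet_isJet _⟩⟩, (jet_isJet (h1 i)).1,
        Lp.coeFn_zero ℝ 2 (volume : Measure (Euc n))] with y a b c
      rw [← b, ← a, h0, c]; rfl
    have := (Continuous.ae_eq_iff_eq volume ((h1 i).cd1.continuous.mul (h1 i).cd1.continuous) continuous_const).1 ae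
    exact hx (mul_self_eq_zero.1 (congrFun this x))
  · show mm hC _ _ = 0
    apply Lp.ext
    filter_upwards [mm_ae hC ⟨jet (h1 i), subset_closure ⟨φ i, h1 i, h2 i, jet_isJet _⟩⟩
        ⟨jet (h1 j), subset_closure ⟨φ j, h1 j, h2 j, jet_isJet _⟩⟩, (jet_isJet (h1 i)).1, (jet_isJet (h1 j)).1,
        Lp.coeFn_zero ℝ 2 (volume : Measure (Euc n))] with y a b c d
    rw [a, d]
    show (jet (h1 i)).fst y * (jet (h1 j)).fst y = 0
    rw [b, c, h4 i j hij]

lemma exists_vd (hn : n = 2 ∨ n = 3) (hΩ : RadialDomain Ω) (hC : SobC Ω C) {k : ℕ} (hk : 0 < k)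
    (lam : Fin N → ℝ) (κ : ℝ) (hκ : 0 < κ) (hκ1 : κ ≤ 1) (hlam : ∀ i, κ ≤ lam i) (b : Fin N → Fin N → ℝ)
    (b_symm : ∀ i j, b i j = b j i) (b_diag : ∀ i, 0 < b i i) (b_off : ∀ i j, i ≠ j → b i j ≤ 0) :
    ∃ x : Fin N → KK Ω (rotPt (π / k)), (∀ i, κ / (b i i * (C ^ 3 + 1)) ≤ ‖mm hC (x i) (x i)‖) ∧
      ∀ i J, AA (lam i) (x i) J = ∑ m, b i m * inner ℝ (mm hC (x i) J) (mm hC (x m) (x m)) :=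
  VData.main _ (feas_vdata hn hΩ hC hk lam κ hκ hκ1 hlam b b_symm b_diag b_off)

lemma weak_anti (hC : SobC Ω C) {σ : Euc n → Euc n} {lam : Fin N → ℝ} {b : Fin N → Fin N → ℝ} {x : Fin N → KK Ω σ}
    (hx2 : ∀ i J, AA (lam i) (x i) J = ∑ m, b i m * inner ℝ (mm hC (x i) J) (mm hC (x m) (x m))) (i : Fin N)
    {φ : Euc n → ℝ} (hφ : Test Ω φ) (hanti : ∀ y, φ (σ y) = - φ y) :
    ∫ y, inner ℝ ((x i).1.snd y) (gradient φ y) = ∫ y, FF lam b (fun i => (x i).1.fst) i y * φ y := by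
  have u2 : ∀ i, MemLp (x i).1.fst 2 volume := fun i => Lp.memLp _
  have u6 : ∀ i, MemLp (x i).1.fst 6 volume := fun i => KK.memLp6 hC.le (x i).2
  set J : KK Ω (σ) := ⟨jet hφ, subset_closure ⟨φ, hφ, hanti, jet_isJet _⟩⟩ with hJ
  have hJ1 : J.1.fst =ᵐ[volume] φ := (jet_isJet hφ).1
  have hJ2 : J.1.snd =ᵐ[volume] gradient φ := (jet_isJet hφ).2
  have e := hx2 i J
  have eA : AA (lam i) (x i) J = (∫ y, inner ℝ ((x i).1.snd y) (gradient φ y)) + lam i * ∫ y, (x i).1.fst y * φ y := by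
    rw [AA_apply, L2.inner_def, L2.inner_def]
    congr 1
    · refine integral_congr_ae ?_
      filter_upwards [hJ2] with y a
      rw [a]
    · congr 1
      refine integral_congr_ae ?_
      filter_upwards [hJ1] with y a
      rw [a]; simp [mul_comm]
  have em : ∀ m, (inner ℝ (mm hC (x i) J) (mm hC (x m) (x m)) : ℝ) = ∫ y, ((x i).1.fst y * (x m).1.fst y ^ 2) * φ y := fun m => by
    rw [mm_inner]
    refine integral_congr_ae ?_
    filter_upwards [hJ1] with y a
    rw [a]; ring
  rw [eA] at e
  simp only [em] at e
  have e3 : (∫ y, inner ℝ ((x i).1.snd y) (gradient φ y)) =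
    (∑ m, b i m * ∫ y, ((x i).1.fst y * (x m).1.fst y ^ 2) * φ y) - lam i * ∫ y, (x i).1.fst y * φ y :=
    eq_sub_of_add_eq e
  rw [e3]
  have I3 : ∀ m, Integrable (fun y => b i m * (((x i).1.fst y * (x m).1.fst y ^ 2) * φ y)) := fun m =>
    ((triple_memLp (u6 i) (u6 m)).integrable_mul (hφ.memLp 2)).const_mul _
  have I4 : Integrable (fun y => lam i * ((x i).1.fst y * φ y)) := ((u2 i).integrable_mul (hφ.memLp 2)).const_mul _
  simp only [← integral_const_mul]
  rw [← integral_finset_sum _ (fun m _ => I3 m), ← integral_sub (integrable_finset_sum _ fun m _ => I3 m) I4]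
  congr 1; ext y
  simp only [FF, sub_mul, Finset.sum_mul]
  congr 1
  · exact Finset.sum_congr rfl fun m _ => by ring
  · ring

theorem exists_weak (hn : n = 2 ∨ n = 3) (hΩ : RadialDomain Ω) (hC : SobC Ω C) {k : ℕ} (hk : 0 < k)
    (lam : Fin N → ℝ) (κ : ℝ) (hκ : 0 < κ) (hκ1 : κ ≤ 1) (hlam : ∀ i, κ ≤ lam i) (b : Fin N → Fin N → ℝ)
    (b_symm : ∀ i j, b i j = b j i) (b_diag : ∀ i, 0 < b i i) (b_off : ∀ i j, i ≠ j → b i j ≤ 0) :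
    ∃ x : Fin N → KK Ω (rotPt (π / k)), (∀ i, κ / (b i i * (C ^ 3 + 1)) ≤ ‖mm hC (x i) (x i)‖) ∧
      ∀ i ψ, Test Ω ψ → ∫ y, inner ℝ ((x i).1.snd y) (gradient ψ y) = ∫ y, FF lam b (fun i => (x i).1.fst) i y * ψ y := by
  obtain ⟨x, hx1, hx2⟩ := exists_vd hn hΩ hC hk lam κ hκ hκ1 hlam b b_symm b_diag b_off
  refine ⟨x, hx1, fun i ψ hψ => ?_⟩
  have u2 : ∀ i, MemLp (x i).1.fst 2 volume := fun i => Lp.memLp _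
  have u6 : ∀ i, MemLp (x i).1.fst 6 volume := fun i => KK.memLp6 hC.le (x i).2
  have hF : MemLp (FF lam b (fun i => (x i).1.fst) i) 2 := FF_memLp u2 u6 i
  have hg : MemLp (x i).1.snd 2 volume := Lp.memLp _
  have Ii : ∀ φ, Test Ω φ → Integrable (fun y => (inner ℝ ((x i).1.snd y) (gradient φ y) : ℝ)) := fun φ hφ =>
    int_inner_integrable hg (hφ.memLp_grad 2)
  have IF : ∀ φ, Test Ω φ → Integrable (fun y => FF lam b (fun i => (x i).1.fst) i y * φ y) := fun φ hφ =>
    hF.integrable_mul (hφ.memLp 2)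
  have IG : ∀ φ, Test Ω φ → Integrable (fun y => inner ℝ ((x i).1.snd y) (gradient φ y) -
      FF lam b (fun i => (x i).1.fst) i y * φ y) := fun φ hφ => (Ii φ hφ).sub (IF φ hφ)
  rw [← sub_eq_zero, ← integral_sub (Ii ψ hψ) (IF ψ hψ)]
  refine anti_zero hn hΩ hk (T := fun ψ => ∫ y, inner ℝ ((x i).1.snd y) (gradient ψ y) -
    FF lam b (fun i => (x i).1.fst) i y * ψ y) ?_ ?_ ?_ ?_ hψ
  · intro φ ψ hφ hψ
    rw [← integral_add (IG φ hφ) (IG ψ hψ)]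
    congr 1; ext y
    rw [gradient_add' (hφ.diff y) (hψ.diff y), inner_add_right]; ring
  · intro c φ hφ
    rw [← integral_const_mul]
    congr 1; ext y
    rw [gradient_smul' c (hφ.diff y), inner_smul_right]; ring
  · intro φ hφ
    have anti := fun i => KK.anti hn (x i).2
    rw [← rot_int hn (π / k) (fun y => inner ℝ ((x i).1.snd y) (gradient φ y) -
      FF lam b (fun i => (x i).1.fst) i y * φ y), ← integral_neg]
    refine integral_congr_ae ?_
    filter_upwards [ae_all_iff.2 fun i => (anti i).1, (anti i).2] with y a b
    simp only [FF, a, b]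
    rw [← gradient_rot hn (hφ.cd1.differentiable (by norm_num)) (π / k) y, inner_neg_left]
    have : inner ℝ (rotPt (π / k) ((x i).1.snd y)) (rotPt (π / k) (gradient (fun y => φ (rotPt (π / k) y)) y)) =
      inner ℝ ((x i).1.snd y) (gradient (fun y => φ (rotPt (π / k) y)) y) := (rotL hn (π / k)).inner_map_map _ _
    rw [this]
    simp only [neg_sq, neg_mul, mul_neg, Finset.sum_neg_distrib]
    ring
  · intro φ hφ hanti
    rw [integral_sub (Ii φ hφ) (IF φ hφ), sub_eq_zero]
    exact weak_anti hC hx2 i hφ hanti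

end weak
end

noncomputable section
open Real MeasureTheory Finset
open scoped ContDiff Topology

section assemble
variable {n : ℕ} {Ω : Set (Euc n)}

lemma KK.ibp {σ : Euc n → Euc n} {x : VV n} (hx : x ∈ KK Ω σ) {ψ : Euc n → ℝ} (hψ : Test Ω ψ) (v : Euc n) :
    ∫ y, inner ℝ (x.snd y) v * ψ y = - ∫ y, x.fst y * fderiv ℝ ψ y v := by
  obtain ⟨φ, z, h1, h2, h3, h4⟩ := KK.seq hx
  obtain ⟨l1, l2⟩ := KK.seq_int h3 h4
  have hv : MemLp (fun y => ψ y • v) 2 :=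
    (hψ.cd1.continuous.smul continuous_const).memLp_of_hasCompactSupport (hψ.compact.smul_right (f' := fun _ => v))
  have hd : MemLp (fun y => fderiv ℝ ψ y v) 2 := (hψ.fder v).memLp 2
  have t1 := tendsto_inner (Lp.memLp x.fst) (fun k => (h1 k).memLp 2) hd l1
  have t2 := tendsto_inner (Lp.memLp x.snd) (fun k => (h1 k).memLp_grad 2) hv l2
  have e : ∀ k, ∫ y, (inner ℝ (gradient (φ k) y) (ψ y • v) : ℝ) = - ∫ y, (inner ℝ (φ k y) (fderiv ℝ ψ y v) : ℝ) := fun k => by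
    have := ibp_test isOpen_univ (h1 k).cd1.contDiffOn (hψ.mono (Set.subset_univ _)) v
    have e1 : ∀ y, (inner ℝ (gradient (φ k) y) (ψ y • v) : ℝ) = fderiv ℝ (φ k) y v * ψ y := fun y => by
      rw [inner_smul_right, inner_gradient]; ring
    have e2 : ∀ y, (inner ℝ (φ k y) (fderiv ℝ ψ y v) : ℝ) = φ k y * fderiv ℝ ψ y v := fun y => by
      simp [mul_comm]
    simp only [e1, e2]
    rw [this, neg_neg]
  simp only [e] at t2
  have := tendsto_nhds_unique t2 t1.neg
  calc _ = ∫ y, (inner ℝ (x.snd y) (ψ y • v) : ℝ) := by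
        congr 1; ext y; rw [inner_smul_right]; ring
    _ = _ := this
    _ = _ := by congr 2; ext y; simp [mul_comm]

lemma KK.grad_ae {σ : Euc n → Euc n} {x : VV n} (hx : x ∈ KK Ω σ) (hO : IsOpen Ω) {U : Euc n → ℝ}
    (hU : ContDiffOn ℝ 1 U Ω) (hae : U =ᵐ[volume] x.fst) : ∀ᵐ y, y ∈ Ω → x.snd y = gradient U y := by
  have key : ∀ v : Euc n, ∀ᵐ y, y ∈ Ω → (inner ℝ (x.snd y) v : ℝ) - fderiv ℝ U y v = 0 := fun v => by
    have hg : LocallyIntegrable (fun y => (inner ℝ (x.snd y) v : ℝ)) volume :=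
      ((Lp.memLp x.snd).inner_const v).locallyIntegrable (by norm_num)
    have hc : ContinuousOn (fun y => fderiv ℝ U y v) Ω :=
      (hU.continuousOn_fderiv_of_isOpen hO (by norm_num)).clm_apply continuousOn_const
    have hl : LocallyIntegrableOn (fun y => fderiv ℝ U y v) Ω volume :=
      hc.locallyIntegrableOn hO.measurableSet
    refine hO.ae_eq_zero_of_integral_contDiff_smul_eq_zero ((hg.locallyIntegrableOn Ω).sub hl) fun ψ h1 h2 h3 => ?_
    have hψ : Test Ω ψ := ⟨h1, h2, h3⟩
    have i1 := KK.ibp hx hψ v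
    have i2 := ibp_test hO hU hψ v
    have e1 : ∫ y, x.fst y * fderiv ℝ ψ y v = ∫ y, U y * fderiv ℝ ψ y v :=
      integral_congr_ae (by filter_upwards [hae] with y a; rw [a])
    have I1 : Integrable (fun y => (inner ℝ (x.snd y) v : ℝ) * ψ y) :=
      ((Lp.memLp x.snd).inner_const v).integrable_mul (hψ.memLp 2)
    have I2 : Integrable (fun y => fderiv ℝ U y v * ψ y) :=
      (cont_mul hO hc hψ.cd1.continuous hψ.supp).integrable_of_hasCompactSupport hψ.compact.mul_left
    have : ∀ y, ψ y • ((inner ℝ (x.snd y) v : ℝ) - fderiv ℝ U y v) = (inner ℝ (x.snd y) v : ℝ) * ψ y - fderiv ℝ U y v * ψ y :=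
      fun y => by rw [smul_eq_mul]; ring
    simp only [Pi.sub_apply, this]
    rw [integral_sub I1 I2, i1, e1, i2]; ring
  have key2 : ∀ᵐ y, ∀ i : Fin n, y ∈ Ω → (inner ℝ (x.snd y) (EuclideanSpace.single i 1) : ℝ) -
      fderiv ℝ U y (EuclideanSpace.single i 1) = 0 := ae_all_iff.2 fun i => key _
  filter_upwards [key2] with y hy hyΩ
  ext i
  have h := sub_eq_zero.1 (hy i hyΩ)
  rw [gradient_coord, ← h, EuclideanSpace.inner_single_right]; simp

lemma KK.h1norm {σ : Euc n → Euc n} {x : VV n} (hx : x ∈ KK Ω σ) (hO : IsOpen Ω) {U : Euc n → ℝ}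
    (hU : ContDiffOn ℝ 1 U Ω) (hae : U =ᵐ[volume] x.fst) : H1norm2 Ω U = ‖x‖ ^ 2 := by
  have hz := KK.ae_zero hx
  have hI1 : Integrable (fun y => ‖x.fst y‖ ^ 2) := (Lp.memLp x.fst).integrable_norm_pow (by norm_num)
  have hI2 : Integrable (fun y => ‖x.snd y‖ ^ 2) := (Lp.memLp x.snd).integrable_norm_pow (by norm_num)
  rw [norm_sq_VV, ← integral_add hI1 hI2, H1norm2]
  rw [← integral_indicator hO.measurableSet]
  refine integral_congr_ae ?_
  filter_upwards [hz, hae, KK.grad_ae hx hO hU hae] with y a b c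
  by_cases hy : y ∈ Ω
  · rw [Set.indicator_of_mem hy, ← norm_gradient, ← c hy, b, norm_eq_abs (x.fst y), sq_abs]; ring
  · rw [Set.indicator_of_notMem hy, (a hy).1, (a hy).2]; simp

lemma FF_cont {N : ℕ} {lam : Fin N → ℝ} {b : Fin N → Fin N → ℝ} {U : Fin N → Euc n → ℝ} (h : ∀ i, Continuous (U i))
    (i : Fin N) : Continuous (FF lam b U i) := by
  unfold FF; fun_prop

lemma FF_cd {N : ℕ} {lam : Fin N → ℝ} {b : Fin N → Fin N → ℝ} {U : Fin N → Euc n → ℝ} (h : ∀ i, ContDiffOn ℝ 1 (U i) Ω)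
    (i : Fin N) : ContDiffOn ℝ 1 (FF lam b U i) Ω := by
  unfold FF
  exact (ContDiffOn.sum fun m _ => contDiffOn_const.mul ((h i).mul ((h m).pow 2))).sub (contDiffOn_const.mul (h i))

theorem classical_of_weak (hn : n = 2 ∨ n = 3) (hΩ : RadialDomain Ω) {C : ℝ} (hC : SobC Ω C) {θ : ℝ} {N : ℕ}
    {lam : Fin N → ℝ} {b : Fin N → Fin N → ℝ} {x : Fin N → KK Ω (rotPt θ)}
    (hEL : ∀ i ψ, Test Ω ψ → ∫ y, inner ℝ ((x i).1.snd y) (gradient ψ y) = ∫ y, FF lam b (fun i => (x i).1.fst) i y * ψ y) :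
    ∃ U : Fin N → Euc n → ℝ, ∀ i, Continuous (U i) ∧ (∀ y ∉ Ω, U i y = 0) ∧ U i =ᵐ[volume] (x i).1.fst ∧
      ContDiffOn ℝ 2 (U i) Ω ∧ (∀ y ∈ Ω, -(lap (U i) y) = FF lam b U i y) ∧ H1norm2 Ω (U i) = ‖x i‖ ^ 2 ∧
      ∀ y, U i (rotPt θ y) = - U i y := by
  have hn2 : 2 ≤ n := by omega
  have hO := hΩ.isOpen
  have u2 : ∀ i, MemLp (x i).1.fst 2 volume := fun i => Lp.memLp _
  have u6 : ∀ i, MemLp (x i).1.fst 6 volume := fun i => KK.memLp6 hC.le (x i).2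
  have hF : ∀ i, MemLp (FF lam b (fun i => (x i).1.fst) i) 2 := fun i => FF_memLp u2 u6 i
  have hg : ∀ i, MemLp (x i).1.snd 2 volume := fun i => Lp.memLp _
  have hex : ∀ i, ∃ U, Continuous U ∧ (∀ y ∉ Ω, U y = 0) ∧ U =ᵐ[volume] (x i).1.fst := fun i => by
    obtain ⟨φ, z, h1, h2, h3, h4⟩ := KK.seq (x i).2
    obtain ⟨l1, l2⟩ := KK.seq_int h3 h4
    have hS := kato (u2 i) (hg i) (hF i) h1 l1 l2 (hEL i)
    have hW : WeakEq Ω (x i).1.fst (FF lam b (fun i => (x i).1.fst) i) := fun ψ hψ => by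
      rw [← hEL i ψ hψ]
      exact (weak_of_limit (F := 0) (u2 i) (hg i) h1 l1 l2 (hψ.mono (Set.subset_univ _))).symm
    exact exists_cont_rep hn hO (hΩ.extBall hn2) (u2 i)
      (by filter_upwards [KK.ae_zero (x i).2] with y a hy using (a hy).1) (hF i) hW hS
  choose U hU1 hU2 hU3 using hex
  have hFc : ∀ i, HasCompactSupport (FF lam b U i) := fun i => by
    refine HasCompactSupport.of_support_subset_isCompact (K := closure Ω) hΩ.isBounded.isCompact_closure fun y hy => ?_
    by_contra h
    have h' : y ∉ Ω := fun hh => h (subset_closure hh)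
    apply hy
    simp [FF, hU2 i y h']
  have hW : ∀ i, WeakEq Ω (U i) (FF lam b U i) := fun i ψ hψ => by
    have := hEL i ψ hψ
    obtain ⟨φ, z, h1, h2, h3, h4⟩ := KK.seq (x i).2
    obtain ⟨l1, l2⟩ := KK.seq_int h3 h4
    have w := weak_of_limit (F := 0) (u2 i) (hg i) h1 l1 l2 (hψ.mono (Set.subset_univ _))
    rw [w] at this
    have e1 : ∫ y, U i y * lap ψ y = ∫ y, (x i).1.fst y * lap ψ y :=
      integral_congr_ae (by filter_upwards [hU3 i] with y a; rw [a])
    have e2 : ∫ y, FF lam b U i y * ψ y = ∫ y, FF lam b (fun i => (x i).1.fst) i y * ψ y :=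
      integral_congr_ae (by filter_upwards [ae_all_iff.2 hU3] with y a; simp only [FF, a])
    rw [e1, e2, this]
  have hreg := fun i => reg_C1 hn2 hO (hU1 i) (FF_cont hU1 i) (hFc i) (hW i)
  have hC1 : ∀ i, ContDiffOn ℝ 1 (U i) Ω := fun i => (hreg i).1
  have hC2 : ∀ i, ContDiffOn ℝ 2 (U i) Ω := fun i => (hreg i).2 (FF_cd hC1 i)
  refine ⟨U, fun i => ⟨hU1 i, hU2 i, hU3 i, hC2 i, pde_of_weak hO (hC2 i) (FF_cont hU1 i) (hW i),
    KK.h1norm (x i).2 hO (hC1 i) (hU3 i), ?_⟩⟩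
  have hcr : Continuous (rotPt θ : Euc n → Euc n) := (rotL hn θ).continuous
  have ae : (fun y => U i (rotPt θ y)) =ᵐ[volume] fun y => - U i y := by
    filter_upwards [(KK.anti hn (x i).2).1, hU3 i, (rot_mp hn θ).quasiMeasurePreserving.ae (hU3 i)] with y a b c
    rw [c, b, a]
  exact congrFun ((Continuous.ae_eq_iff_eq volume ((hU1 i).comp hcr) (hU1 i).neg).1 ae)

end assemble
end

noncomputable section
open Real MeasureTheory Finset
open scoped ContDiff Topology

section unb
variable {n : ℕ} {Ω : Set (Euc n)}

lemma rotPt_cont2 (hn : n = 2 ∨ n = 3) : Continuous (fun q : ℝ × Euc n => rotPt q.1 q.2) := by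
  unfold rotPt
  refine (PiLp.continuous_toLp 2 _).comp (continuous_pi fun i => ?_)
  split_ifs <;> fun_prop

def rotC (hn : n = 2 ∨ n = 3) : C(ℝ, C(Euc n, Euc n)) :=
  ContinuousMap.curry ⟨fun q : ℝ × Euc n => rotPt q.1 q.2, rotPt_cont2 hn⟩

lemma rotC_apply (hn : n = 2 ∨ n = 3) (θ : ℝ) : (rotC hn θ : Euc n → Euc n) = rotPt θ := rfl

lemma rotC_mp (hn : n = 2 ∨ n = 3) (θ : ℝ) : MeasurePreserving (rotC hn θ : Euc n → Euc n) volume volume :=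
  rot_mp hn θ

lemma rot_Lp (hn : n = 2 ∨ n = 3) {θ : ℕ → ℝ} (hθ : Filter.Tendsto θ Filter.atTop (𝓝 0))
    (h : Lp ℝ 2 (volume : Measure (Euc n))) :
    Filter.Tendsto (fun l => Lp.compMeasurePreserving _ (rotC_mp hn (θ l)) h) Filter.atTop (𝓝 h) := by
  have := (tendsto_const_nhds (x := h)).compMeasurePreservingLp (((rotC hn).continuous.tendsto 0).comp hθ)
    (fun l => rotC_mp hn (θ l)) (rotC_mp hn 0) (by norm_num)
  have e : Lp.compMeasurePreserving _ (rotC_mp hn 0) h = h := ?_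
  · rw [e] at this; exact this
  apply Lp.ext
  filter_upwards [Lp.coeFn_compMeasurePreserving h (rotC_mp hn 0)] with y hy
  rw [hy, rotC_apply, Function.comp_apply, rotPt_zero hn]

lemma weak_zero (hn : n = 2 ∨ n = 3) {θ : ℕ → ℝ} (hθ : Filter.Tendsto θ Filter.atTop (𝓝 0)) {x : ℕ → VV n}
    (hx : ∀ l, x l ∈ KK Ω (rotPt (θ l))) {R : ℝ} (hR : ∀ l, ‖x l‖ ≤ R) (h : Lp ℝ 2 (volume : Measure (Euc n))) :
    Filter.Tendsto (fun l => (inner ℝ h (x l).fst : ℝ)) Filter.atTop (𝓝 0) := by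
  have e : ∀ l, 2 * (inner ℝ h (x l).fst : ℝ) =
      inner ℝ (h - Lp.compMeasurePreserving _ (rotC_mp hn (θ l)) h) (x l).fst := fun l => by
    have e1 : (inner ℝ (Lp.compMeasurePreserving _ (rotC_mp hn (θ l)) h) (x l).fst : ℝ) = - inner ℝ h (x l).fst := by
      rw [L2.inner_def, L2.inner_def, ← integral_neg, ← rot_int hn (θ l) (fun y => -(inner ℝ (h y) ((x l).fst y) : ℝ))]
      refine integral_congr_ae ?_
      filter_upwards [Lp.coeFn_compMeasurePreserving h (rotC_mp hn (θ l)), (KK.anti hn (hx l)).1] with y a b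
      rw [a, b, inner_neg_right, neg_neg, Function.comp_apply, rotC_apply]
    rw [inner_sub_left, e1]; ring
  have t : Filter.Tendsto (fun l => ‖h - Lp.compMeasurePreserving _ (rotC_mp hn (θ l)) h‖ * R) Filter.atTop (𝓝 0) := by
    have := ((tendsto_const_nhds (x := h)).sub (rot_Lp hn hθ h)).norm.mul_const R
    simpa using this
  refine squeeze_zero_norm (fun l => ?_) t
  have h1 := norm_inner_le_norm (𝕜 := ℝ) (h - Lp.compMeasurePreserving _ (rotC_mp hn (θ l)) h) (x l).fst
  rw [← e l, norm_mul] at h1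
  have h2 : ‖(x l).fst‖ ≤ R := (VV_fst_le _).trans (hR l)
  have h3 := mul_le_mul_of_nonneg_left h2 (norm_nonneg (h - Lp.compMeasurePreserving _ (rotC_mp hn (θ l)) h))
  have h4 := norm_nonneg (inner ℝ h (x l).fst : ℝ)
  have h5 : ‖(2:ℝ)‖ = 2 := by simp
  rw [h5] at h1
  linarith

/-- a lower bound on the quartic mass forces unboundedness as the symmetry gets finer -/
lemma unbounded (hn : n = 2 ∨ n = 3) (hΩ : RadialDomain Ω) {C : ℝ} (hC : SobC Ω C) {θ : ℕ → ℝ}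
    (hθ : Filter.Tendsto θ Filter.atTop (𝓝 0)) (x : ∀ l, KK Ω (rotPt (θ l))) {c : ℝ} (hc : 0 < c)
    (hm : ∀ l, c ≤ ‖mm hC (x l) (x l)‖) (M : ℝ) : ∃ l, M < ‖x l‖ ^ 2 := by
  by_contra hcon
  push Not at hcon
  have hR : ∀ l, ‖(x l).1‖ ≤ √M := fun l => Real.le_sqrt_of_sq_le (hcon l)
  have t := KK.rellich (by omega) hΩ.isBounded (fun l => (x l).2) hR (weak_zero hn hθ (fun l => (x l).2) hR)
  have t2 := t.mul_const ((C * √M) ^ 3)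
  rw [zero_mul] at t2
  have : c ^ 2 ≤ 0 := ge_of_tendsto' t2 fun l => by
    have h1 := mm_sq_le hC (x l)
    have h2 : c ^ 2 ≤ ‖mm hC (x l) (x l)‖ ^ 2 := pow_le_pow_left₀ hc.le (hm l) 2
    have h3 : (C * ‖x l‖) ^ 3 ≤ (C * √M) ^ 3 :=
      pow_le_pow_left₀ (mul_nonneg hC.pos.le (norm_nonneg _)) (mul_le_mul_of_nonneg_left (hR l) hC.pos.le) 3
    exact h2.trans (h1.trans (mul_le_mul_of_nonneg_left h3 (norm_nonneg _)))
  nlinarith [pow_pos hc 2]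

/-- one solution with exact symmetry, with lower bound -/
lemma exists_sol (hn : n = 2 ∨ n = 3) (hΩ : RadialDomain Ω) {C : ℝ} (hC : SobC Ω C) {N : ℕ} {k : ℕ} (hk : 0 < k)
    (lam : Fin N → ℝ) (κ : ℝ) (hκ : 0 < κ) (hκ1 : κ ≤ 1) (hlam : ∀ i, κ ≤ lam i) (b : Fin N → Fin N → ℝ)
    (b_symm : ∀ i j, b i j = b j i) (b_diag : ∀ i, 0 < b i i) (b_off : ∀ i j, i ≠ j → b i j ≤ 0) :
    ∃ (x : Fin N → KK Ω (rotPt (π / k))) (U : Fin N → Euc n → ℝ), ∀ i,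
      κ / (b i i * (C ^ 3 + 1)) ≤ ‖mm hC (x i) (x i)‖ ∧ Continuous (U i) ∧ (∀ y ∉ Ω, U i y = 0) ∧
      ContDiffOn ℝ 2 (U i) Ω ∧ (∀ y ∈ Ω, -(lap (U i) y) = FF lam b U i y) ∧ H1norm2 Ω (U i) = ‖x i‖ ^ 2 ∧
      (∀ y, U i (rotPt (π / k) y) = - U i y) ∧ ∃ y ∈ Ω, U i y ≠ 0 := by
  obtain ⟨x, hx1, hx2⟩ := exists_weak hn hΩ hC hk lam κ hκ hκ1 hlam b b_symm b_diag b_off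
  obtain ⟨U, hU⟩ := classical_of_weak hn hΩ hC hx2
  refine ⟨x, U, fun i => ?_⟩
  obtain ⟨h1, h2, h3, h4, h5, h6, h7⟩ := hU i
  refine ⟨hx1 i, h1, h2, h4, h5, h6, h7, ?_⟩
  by_contra hcon
  push Not at hcon
  have hz : ∀ y, U i y = 0 := fun y => by
    by_cases hy : y ∈ Ω
    · exact hcon y hy
    · exact h2 y hy
  have : mm hC (x i) (x i) = 0 := by
    apply Lp.ext
    filter_upwards [mm_ae hC (x i) (x i), h3, Lp.coeFn_zero ℝ 2 (volume : Measure (Euc n))] with y a e z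
    rw [a, ← e, hz, z]; simp
  have h0 := hx1 i
  rw [this, norm_zero] at h0
  have hCp := hC.pos
  have hbp := b_diag i
  have : 0 < κ / (b i i * (C ^ 3 + 1)) := by positivity
  linarith

end unb

section sym
variable {n : ℕ} {Ω : Set (Euc n)}

lemma anti_iter (hn : n = 2 ∨ n = 3) {θ : ℝ} {U : Euc n → ℝ} (h : ∀ y, U (rotPt θ y) = - U y) (m : ℕ) (y : Euc n) :
    U (rotPt (-(m * θ)) y) = (-1) ^ m * U y := by
  induction m with
  | zero => simp [rotPt_zero hn]
  | succ m ih =>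
    have := h (rotPt (-((m + 1 : ℕ) * θ)) y)
    rw [rotPt_comp hn] at this
    have e : θ + -((m + 1 : ℕ) * θ) = -(m * θ) := by push_cast; ring
    rw [e, ih] at this
    rw [pow_succ]; linarith

lemma inv_iter (hn : n = 2 ∨ n = 3) (hΩ : RadialDomain Ω) {θ : ℝ} {U : Euc n → ℝ} (h : RotInv θ Ω U) (m : ℕ) :
    RotInv (m * θ) Ω U := by
  induction m with
  | zero => intro y _; simp [rotPt_zero hn]
  | succ m ih =>
    intro y hy
    have hy' : rotPt (-(m * θ)) y ∈ Ω := (hΩ.mem_iff (rotPt_norm hn _ _)).2 hy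
    have := h _ hy'
    rw [rotPt_comp hn, ih y hy] at this
    have e : -θ + -(m * θ) = -((m + 1 : ℕ) * θ) := by push_cast; ring
    rw [← e, this]

lemma sym_facts (hn : n = 2 ∨ n = 3) (hΩ : RadialDomain Ω) (j l : ℕ) {U : Euc n → ℝ}
    (h : ∀ y, U (rotPt (π / (2 ^ j * (2 * l + 1) : ℕ)) y) = - U y) (h0 : ∃ y ∈ Ω, U y ≠ 0) :
    ((∃ x ∈ Ω, 0 < U x) ∧ (∃ x ∈ Ω, U x < 0)) ∧ RotInv (2 * π / ((2 : ℝ) ^ j)) Ω U ∧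
        ¬ RotInv (2 * π / ((2 : ℝ) ^ (j + 1))) Ω U ∧ ¬ IsRadialFn Ω U := by
  obtain ⟨y, hy, hy0⟩ := h0
  have hl : (2 * (l : ℝ) + 1) ≠ 0 := by positivity
  have hm : ∀ θ, rotPt θ y ∈ Ω := fun θ => (hΩ.mem_iff (rotPt_norm hn _ _)).2 hy
  refine ⟨?_, ?_, ?_, ?_⟩
  · have h1 := h y
    rcases lt_or_gt_of_ne hy0 with h2 | h2
    · exact ⟨⟨_, hm _, by rw [h1]; linarith⟩, y, hy, h2⟩
    · exact ⟨⟨y, hy, h2⟩, _, hm _, by rw [h1]; linarith⟩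
  · intro z _
    have := anti_iter hn h (2 * (2 * l + 1)) z
    rw [(even_two_mul _).neg_one_pow, one_mul] at this
    rw [← this]; congr 3; push_cast; field_simp
  · intro hr
    have := anti_iter hn h (2 * l + 1) y
    rw [(odd_two_mul_add_one _).neg_one_pow] at this
    have h2 := hr y hy
    have e : -(2 * π / (2:ℝ) ^ (j + 1)) = -(((2 * l + 1 : ℕ) : ℝ) * (π / (2 ^ j * (2 * l + 1) : ℕ))) := by
      push_cast; rw [pow_succ]; field_simp
    rw [e, this] at h2
    apply hy0; linarith
  · intro hr
    have h2 := hr _ (hm (π / (2 ^ j * (2 * l + 1) : ℕ))) y hy (rotPt_norm hn _ _)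
    rw [h y] at h2
    apply hy0; linarith

lemma sym_ne (hn : n = 2 ∨ n = 3) (hΩ : RadialDomain Ω) {j₁ j₂ : ℕ} (hj : j₁ < j₂) {U : Euc n → ℝ}
    (h2 : RotInv (2 * π / ((2 : ℝ) ^ j₂)) Ω U) : RotInv (2 * π / ((2 : ℝ) ^ (j₁ + 1))) Ω U := by
  obtain ⟨d, rfl⟩ := Nat.exists_eq_add_of_le (show j₁ + 1 ≤ j₂ from hj)
  have := inv_iter hn hΩ h2 (2 ^ d)
  convert this using 1
  push_cast
  rw [pow_add]
  field_simp
  ring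

end sym
end

noncomputable section
open Real MeasureTheory Finset
open scoped ContDiff Topology

lemma lam_pos {N p B : ℕ} {lam mu : ℕ → ℝ} {beta : ℕ → ℕ → ℝ} (h : SysAssump N p B lam mu beta) {i : ℕ}
    (hi : i ∈ Finset.Icc 1 N) : 0 < lam i := by
  obtain ⟨hp, hN, hB, hA, -⟩ := h
  rw [Finset.mem_Icc] at hi
  have hp0 := hp.pos
  have h1 : (i - 1) / p < B := (Nat.div_lt_iff_lt_mul hp0).2 (by rw [mul_comm]; omega)
  have h2 := Nat.div_add_mod (i - 1) p
  have h3 := Nat.mod_lt (i - 1) hp0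
  refine (hA ((i - 1) / p + 1) (Finset.mem_Icc.2 ⟨Nat.le_add_left _ _, h1⟩) i (Finset.mem_Icc.2 ⟨?_, ?_⟩)).2
  · rw [mul_add]; omega
  · rw [mul_add]; omega

lemma sum_conv (N : ℕ) (f : ℕ → ℝ) : ∑ i ∈ Finset.Icc 1 N, f i = ∑ m : Fin N, f (m + 1) := by
  rw [Fin.sum_univ_eq_sum_range (fun m => f (m + 1)), Finset.range_eq_Ico, Finset.sum_Ico_add' f 0 N 1]
  rfl

lemma angle_tendsto (j : ℕ) :
    Filter.Tendsto (fun l : ℕ => π / ((2 ^ j * (2 * l + 1) : ℕ) : ℝ)) Filter.atTop (𝓝 0) := by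
  refine Filter.Tendsto.const_div_atTop ?_ _
  refine tendsto_natCast_atTop_atTop.comp (Filter.tendsto_atTop_mono (fun l => ?_) Filter.tendsto_id)
  have := Nat.one_le_two_pow (n := j)
  show l ≤ 2 ^ j * (2 * l + 1)
  nlinarith

end

open scoped ContDiff Topology

/-- Corollary 1.5 of the paper. For each integer `j ≥ 0` there is an
unbounded sequence `S⁽ʲ⁾` of classical solutions, all components nodal, each component
being `𝓡_{2π/2ʲ}`-invariant but not `𝓡_{2π/2ʲ⁺¹}`-invariant (in particular non-radial);
moreover the sequences `S⁽ʲ¹⁾` and `S⁽ʲ²⁾` are disjoint for `j₁ ≠ j₂`. -/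
theorem multiple_nonradial_nodal_solutions_powers
    {n : ℕ} (hn : n = 2 ∨ n = 3) (Ω : Set (Euc n)) (hΩ : RadialDomain Ω)
    (N p B : ℕ) (lam mu : ℕ → ℝ) (beta : ℕ → ℕ → ℝ)
    (hassump : SysAssump N p B lam mu beta) :
    ∃ u : ℕ → ℕ → ℕ → Euc n → ℝ,   -- `u j l` is the `l`-th solution of the sequence `S⁽ʲ⁾`
      (∀ j l, IsClassicalSolution Ω N lam mu beta (u j l)) ∧
      (∀ j l, ∀ i ∈ Finset.Icc 1 N, (∃ x ∈ Ω, 0 < u j l i x) ∧ (∃ x ∈ Ω, u j l i x < 0)) ∧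
      (∀ j, ∀ C : ℝ, ∃ l, C < ∑ i ∈ Finset.Icc 1 N, H1norm2 Ω (u j l i)) ∧
      (∀ j l, ∀ i ∈ Finset.Icc 1 N,
        RotInv (2 * π / ((2 : ℝ) ^ j)) Ω (u j l i) ∧
        ¬ RotInv (2 * π / ((2 : ℝ) ^ (j + 1))) Ω (u j l i) ∧
        ¬ IsRadialFn Ω (u j l i)) ∧
      (∀ j₁ j₂ l₁ l₂, j₁ ≠ j₂ → ∃ i ∈ Finset.Icc 1 N, u j₁ l₁ i ≠ u j₂ l₂ i) := by
  have hN : 1 ≤ N := by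
    obtain ⟨hp, hN, hB, -⟩ := hassump
    rw [hN]; exact Nat.mul_pos hp.pos hB
  have hlam0 : ∀ i ∈ Finset.Icc 1 N, 0 < lam i := fun i hi => lam_pos hassump hi
  obtain ⟨-, -, -, -, hbeta, hmu, -, -⟩ := hassump
  obtain ⟨C, hC0, hCle⟩ := sobolev_test (by omega) hΩ.isOpen hΩ.isBounded
  have hC : SobC Ω C := ⟨hC0, hCle⟩
  have hmem : ∀ i : Fin N, (i : ℕ) + 1 ∈ Finset.Icc 1 N := fun i => Finset.mem_Icc.2 ⟨by omega, by omega⟩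
  obtain ⟨κ, hκ, hκ1, hlam⟩ : ∃ κ : ℝ, 0 < κ ∧ κ ≤ 1 ∧ ∀ i : Fin N, κ ≤ lam (i + 1) := by
    have hne : (Finset.Icc 1 N).Nonempty := ⟨1, Finset.mem_Icc.2 ⟨le_rfl, hN⟩⟩
    obtain ⟨i₀, h1, h2⟩ := Finset.exists_min_image _ lam hne
    exact ⟨min 1 (lam i₀), lt_min one_pos (hlam0 i₀ h1), min_le_left _ _,
      fun i => (min_le_right _ _).trans (h2 _ (hmem i))⟩
  let b : Fin N → Fin N → ℝ := fun i m => if i = m then mu (i + 1) else beta (i + 1) (m + 1)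
  have hne : ∀ {i m : Fin N}, i ≠ m → (i : ℕ) + 1 ≠ m + 1 := fun h e => h (Fin.ext (by omega))
  have b_diag' : ∀ i, b i i = mu (i + 1) := fun i => by simp [b]
  have b_diag : ∀ i, 0 < b i i := fun i => by rw [b_diag']; exact hmu _ (hmem i)
  have b_off' : ∀ i m, i ≠ m → b i m = beta (i + 1) (m + 1) := fun i m h => by simp [b, h]
  have b_off : ∀ i m, i ≠ m → b i m ≤ 0 := fun i m h => by
    rw [b_off' i m h]; exact (hbeta _ (hmem i) _ (hmem m) (hne h)).2
  have b_symm : ∀ i m, b i m = b m i := fun i m => by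
    by_cases h : i = m
    · rw [h]
    · rw [b_off' i m h, b_off' m i (Ne.symm h)]; exact (hbeta _ (hmem i) _ (hmem m) (hne h)).1
  have hk : ∀ j l : ℕ, 0 < 2 ^ j * (2 * l + 1) := fun j l => by positivity
  choose x U hU using fun j l : ℕ => exists_sol hn hΩ hC (hk j l) (fun i : Fin N => lam (i + 1)) κ hκ hκ1 hlam b
    b_symm b_diag b_off
  clear_value b
  let u : ℕ → ℕ → ℕ → Euc n → ℝ := fun j l i => if h : i - 1 < N then U j l ⟨i - 1, h⟩ else 0
  have hu : ∀ j l (i : Fin N), u j l (i + 1) = U j l i := fun j l i => by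
    simp [u]
  clear_value u
  have hidx : ∀ i ∈ Finset.Icc 1 N, ∃ m : Fin N, i = m + 1 := fun i hi => by
    rw [Finset.mem_Icc] at hi
    exact ⟨⟨i - 1, by omega⟩, by simp; omega⟩
  have hsym : ∀ j l (m : Fin N), _ := fun j l m =>
    sym_facts hn hΩ j l (hU j l m).2.2.2.2.2.2.1 (hU j l m).2.2.2.2.2.2.2
  refine ⟨u, ?_, ?_, ?_, ?_, ?_⟩
  · intro j l i hi
    obtain ⟨m, rfl⟩ := hidx i hi
    obtain ⟨-, h1, h2, h3, h4, -⟩ := hU j l m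
    rw [hu]
    refine ⟨h3, h1.continuousOn, fun y hy => h2 y fun hyΩ => ?_, fun y hy => ?_⟩
    · rw [hΩ.isOpen.frontier_eq] at hy
      exact hy.2 hyΩ
    · rw [h4 y hy, FF]
      have e1 := Finset.add_sum_erase (Finset.Icc 1 N)
        (fun i => if i = m + 1 then mu (m + 1) * U j l m y ^ 3 else beta (m + 1) i * U j l m y * u j l i y ^ 2) hi
      rw [sum_conv] at e1
      have e2 : ∑ i ∈ (Finset.Icc 1 N).erase (m + 1), (if i = m + 1 then mu (m + 1) * U j l m y ^ 3 else
          beta (m + 1) i * U j l m y * u j l i y ^ 2) =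
          ∑ i ∈ (Finset.Icc 1 N).erase (m + 1), beta (m + 1) i * U j l m y * u j l i y ^ 2 :=
        Finset.sum_congr rfl fun i hi => by rw [if_neg (Finset.ne_of_mem_erase hi)]
      rw [e2] at e1
      simp only [if_true] at e1
      rw [e1]
      have e3 : ∀ i : Fin N, b m i * (U j l m y * U j l i y ^ 2) = if (i : ℕ) + 1 = m + 1 then
          mu (m + 1) * U j l m y ^ 3 else beta (m + 1) (i + 1) * U j l m y * u j l (i + 1) y ^ 2 := fun i => by
        by_cases h : m = i
        · subst h; rw [if_pos rfl, b_diag']; ring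
        · rw [if_neg (hne (Ne.symm h)), b_off' m i h, hu]; ring
      rw [Finset.sum_congr rfl fun i _ => e3 i]; ring
  · intro j l i hi
    obtain ⟨m, rfl⟩ := hidx i hi
    rw [hu]; exact (hsym j l m).1
  · intro j M
    let m : Fin N := ⟨0, hN⟩
    have hc : 0 < κ / (b m m * (C ^ 3 + 1)) := by
      have := b_diag m
      positivity
    obtain ⟨l, hl⟩ := unbounded hn hΩ hC (angle_tendsto j) (fun l => x j l m) hc (fun l => (hU j l m).1) M
    refine ⟨l, hl.trans_le ?_⟩
    rw [sum_conv, ← (hU j l m).2.2.2.2.2.1]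
    simp only [hu]
    exact Finset.single_le_sum (f := fun i => H1norm2 Ω (U j l i))
      (fun i _ => by rw [(hU j l i).2.2.2.2.2.1]; positivity) (Finset.mem_univ m)
  · intro j l i hi
    obtain ⟨m, rfl⟩ := hidx i hi
    rw [hu]; exact (hsym j l m).2
  · intro j₁ j₂ l₁ l₂ hj
    let m : Fin N := ⟨0, hN⟩
    refine ⟨m + 1, hmem m, fun e => ?_⟩
    rw [hu, hu] at e
    rcases lt_or_gt_of_ne hj with h | h
    · refine (hsym j₁ l₁ m).2.2.1 ?_
      rw [e]
      exact sym_ne hn hΩ h (hsym j₂ l₂ m).2.1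
    · refine (hsym j₂ l₂ m).2.2.1 ?_
      rw [← e]
      exact sym_ne hn hΩ h (hsym j₁ l₁ m).2.1

end
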